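/- With notation as in the study of the multiview variety ($n\geq 3$ general cameras, $D_Q=Y_n\cap H_Q$ for general $\bm\beta$), the stratification $D_Q = S_0 \sqcup \bigsqcup_{i<j} S_{i,j}^0 \sqcup \bigsqcup_{i<j} S_{i,j}^1 \sqcup \bigsqcup_{i<j<k} S_{i,j,k}$ is a Whitney stratification of $D_Q$, where $S_0$ is the smooth locus of $D_Q$, $S_{i,j,k} = D_{\infty,i}\cap D_{\infty,j}\cap D_{\infty,k}$ (a point), $S_{i,j}^1$ is the set of 4 points of $D_{\infty,i}\cap D_{\infty,j}\setminus\bigcup_{k\neq i,j} S_{i,j,k}$ where $((y_{2i-1}-\beta_{2i-1}x_i)^2+(y_{2i}-\beta_{2i}x_i)^2)((y_{2j-1}-\beta_{2j-1}x_j)^2+(y_{2j}-\beta_{2j}x_j)^2)=0$, and $S_{i,j}^0$ is the complement of $S_{i,j}^1$ in $D_{\infty,i}\cap D_{\infty,j}\setminus\bigcup_{k\neq i,j}S_{i,j,k}$. -/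

import Mathlib

open scoped Manifold Topology
open Filter

noncomputable section

namespace PaperED

/-! Affine algebraic geometry over ℂ: algebraic subsets of ℂⁿ, genericity,
Zariski tangent spaces, smoothness, and the Euclidean distance degree. -/

/-- "P holds for a general point": P holds on a nonempty Zariski-open subset. -/
def Generically {K : Type} [CommSemiring K] {σ : Type} (P : (σ → K) → Prop) : Prop :=
  ∃ q : MvPolynomial σ K, q ≠ 0 ∧ ∀ a : σ → K, MvPolynomial.eval a q ≠ 0 → P a

/-- Affine algebraic subsets of ℂⁿ (common zero loci of polynomials). -/
def IsAlgSet {n : ℕ} (X : Set (Fin n → ℂ)) : Prop :=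
  ∃ S : Set (MvPolynomial (Fin n) ℂ),
    X = {x | ∀ p ∈ S, MvPolynomial.eval x p = 0}

/-- The differential of a polynomial at a point, as a linear functional. -/
def diffAt {n : ℕ} (p : MvPolynomial (Fin n) ℂ) (x : Fin n → ℂ) : (Fin n → ℂ) →ₗ[ℂ] ℂ :=
  ∑ i, MvPolynomial.eval x (MvPolynomial.pderiv i p) • LinearMap.proj i

/-- The Zariski tangent space of `X ⊆ ℂⁿ` at `x`. -/
def zTangent {n : ℕ} (X : Set (Fin n → ℂ)) (x : Fin n → ℂ) : Submodule ℂ (Fin n → ℂ) :=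
  ⨅ p ∈ {p : MvPolynomial (Fin n) ℂ | ∀ y ∈ X, MvPolynomial.eval y p = 0},
    LinearMap.ker (diffAt p x)

/-- `ψ` is a local holomorphic parametrization of `S` around `x`, with `d` parameters. -/
def IsParamAt {E : Type} [NormedAddCommGroup E] [NormedSpace ℂ E]
    (S : Set E) (x : E) (d : ℕ) (ψ : (Fin d → ℂ) → E) (U : Set (Fin d → ℂ)) : Prop :=
  IsOpen U ∧ (0 : Fin d → ℂ) ∈ U ∧ ψ 0 = x ∧ DifferentiableOn ℂ ψ U ∧
    Set.InjOn ψ U ∧ Function.Injective (fderiv ℂ ψ 0) ∧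
    ∃ V ∈ 𝓝 x, ψ '' U = S ∩ V

/-- `S` is, near `x`, a `d`-dimensional complex submanifold. -/
def IsSmoothGermAt {E : Type} [NormedAddCommGroup E] [NormedSpace ℂ E]
    (S : Set E) (x : E) (d : ℕ) : Prop :=
  ∃ ψ U, IsParamAt S x d ψ U

/-- `X` is a (nonempty) smooth closed subvariety of ℂⁿ of pure dimension `d`. -/
def IsSmoothClosedOfDim {n : ℕ} (X : Set (Fin n → ℂ)) (d : ℕ) : Prop :=
  IsAlgSet X ∧ X.Nonempty ∧
    ∀ x ∈ X, IsSmoothGermAt X x d ∧ Module.finrank ℂ ↥(zTangent X x) = d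

/-- Critical points of the squared distance function `f_α` on the locus of `X` where
the tangent space has dimension `d` (the smooth locus, when `dim X = d`):
the vector `x - α` is orthogonal to the tangent space w.r.t. `∑ zᵢwᵢ`. -/
def edCritSet {n : ℕ} (X : Set (Fin n → ℂ)) (d : ℕ) (α : Fin n → ℂ) : Set (Fin n → ℂ) :=
  {x | x ∈ X ∧ Module.finrank ℂ ↥(zTangent X x) = d ∧
    ∀ v ∈ zTangent X x, (∑ i, (x i - α i) * v i) = 0}

/-- The Euclidean distance degree of `X` (of dimension `d`) equals `k`: for a general
data point `α`, the squared distance function `f_α` has exactly `k` critical points on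
the smooth locus of `X`. -/
def HasEDDeg {n : ℕ} (X : Set (Fin n → ℂ)) (d : ℕ) (k : ℕ) : Prop :=
  Generically (K := ℂ) (σ := Fin n) fun α =>
    (edCritSet X d α).Finite ∧ (edCritSet X d α).ncard = k

/-- `U_β`: the complement in ℂⁿ of the hypersurface `∑ (zᵢ - βᵢ)² + β₀ = 0`. -/
def quadCompl {n : ℕ} (β : Fin (n + 1) → ℂ) : Set (Fin n → ℂ) :=
  {z | (∑ i : Fin n, (z i - β i.succ) ^ 2) + β 0 ≠ 0}

/-! The multiview variety of `n` cameras in `(ℙ²)ⁿ` and its affine chart. -/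

abbrev P2 := Projectivization ℂ (Fin 3 → ℂ)

instance : TopologicalSpace P2 :=
  @instTopologicalSpaceQuotient _ (projectivizationSetoid ℂ (Fin 3 → ℂ)) _

/-- The point of ℙ² with homogeneous coordinate vector `v` (junk value if `v = 0`). -/
def mkP (v : Fin 3 → ℂ) : P2 :=
  if h : v ≠ 0 then Projectivization.mk ℂ v h
  else Projectivization.mk ℂ (fun _ => 1) (by
    intro h0; exact one_ne_zero (congrFun h0 0))

/-- The tuple of cameras (3×4 matrices) with complex parameters `a`. -/
def camOfC {n : ℕ} (a : Fin n × Fin 3 × Fin 4 → ℂ) : Fin n → Matrix (Fin 3) (Fin 4) ℂ :=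
  fun i => Matrix.of fun r c => a (i, r, c)

/-- The tuple of cameras with real parameters `a`, viewed as complex matrices. -/
def camOfR {n : ℕ} (a : Fin n × Fin 3 × Fin 4 → ℝ) : Fin n → Matrix (Fin 3) (Fin 4) ℂ :=
  fun i => Matrix.of fun r c => (a (i, r, c) : ℂ)

/-- The tuple of chart matrices (elements of GL₃ giving affine charts of ℙ²). -/
def chartOf {n : ℕ} (cpar : Fin n × Fin 3 × Fin 3 → ℂ) : Fin n → Matrix (Fin 3) (Fin 3) ℂ :=
  fun i => Matrix.of fun r c => cpar (i, r, c)

/-- The image of the joint camera map `ℙ³ ⇢ (ℙ²)ⁿ` (on its locus of definition). -/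
def mvImage {n : ℕ} (A : Fin n → Matrix (Fin 3) (Fin 4) ℂ) : Set (Fin n → P2) :=
  {P | ∃ y : Fin 4 → ℂ, y ≠ 0 ∧ (∀ i, (A i).mulVec y ≠ 0) ∧ ∀ i, P i = mkP ((A i).mulVec y)}

/-- The multiview variety `Yₙ ⊆ (ℙ²)ⁿ`: the closure of the image of the camera map. -/
def mvVariety {n : ℕ} (A : Fin n → Matrix (Fin 3) (Fin 4) ℂ) : Set (Fin n → P2) :=
  closure (mvImage A)

def affLift (z : Fin 2 → ℂ) : Fin 3 → ℂ := Fin.cons 1 z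

/-- The coordinate pair of the `i`-th factor, for `z ∈ ℂ²ⁿ`. -/
def camCoord (n : ℕ) (z : Fin (2 * n) → ℂ) (i : Fin n) : Fin 2 → ℂ :=
  fun k => z ⟨2 * i.1 + k.1, by have := i.2; have := k.2; omega⟩

/-- The affine chart `ℂ²ⁿ → (ℙ²)ⁿ` determined by the chart matrices `Cs`. -/
def chartMapN {n : ℕ} (Cs : Fin n → Matrix (Fin 3) (Fin 3) ℂ) (z : Fin (2 * n) → ℂ) :
    Fin n → P2 :=
  fun i => mkP ((Cs i).mulVec <| affLift (camCoord n z i))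

/-- The affine multiview variety `Xₙ = Yₙ ∩ ℂ²ⁿ ⊆ ℂ²ⁿ`, in the chart `Cs`. -/
def affineMV {n : ℕ} (A : Fin n → Matrix (Fin 3) (Fin 4) ℂ)
    (Cs : Fin n → Matrix (Fin 3) (Fin 3) ℂ) : Set (Fin (2 * n) → ℂ) :=
  chartMapN Cs ⁻¹' mvVariety A

/-- The line at infinity of the affine chart of ℙ² given by the matrix `Cm`. -/
def infLine (Cm : Matrix (Fin 3) (Fin 3) ℂ) : Set P2 :=
  {p | ∃ w : Fin 3 → ℂ, w ≠ 0 ∧ w 0 = 0 ∧ p = mkP (Cm.mulVec w)}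

/-- `D_{∞,i} = Yₙ ∩ H_{∞,i}`. -/
def Dinf {n : ℕ} (A : Fin n → Matrix (Fin 3) (Fin 4) ℂ)
    (Cs : Fin n → Matrix (Fin 3) (Fin 3) ℂ) (i : Fin n) : Set (Fin n → P2) :=
  mvVariety A ∩ {P | P i ∈ infLine (Cs i)}

/-- `D_∞ = Yₙ ∩ H_∞`, the divisor at infinity. -/
def DinfAll {n : ℕ} (A : Fin n → Matrix (Fin 3) (Fin 4) ℂ)
    (Cs : Fin n → Matrix (Fin 3) (Fin 3) ℂ) : Set (Fin n → P2) :=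
  mvVariety A ∩ ⋃ i, {P | P i ∈ infLine (Cs i)}

/-- The affine quadric hypersurface `∑ (zᵢ - βᵢ)² + β₀ = 0` in `ℂ²ⁿ`. -/
def quadSet (n : ℕ) (β : Fin (2 * n + 1) → ℂ) : Set (Fin (2 * n) → ℂ) :=
  {z | (∑ i : Fin (2 * n), (z i - β i.succ) ^ 2) + β 0 = 0}

/-- `H_Q`: the closure in `(ℙ²)ⁿ` of the affine quadric hypersurface. -/
def HQ {n : ℕ} (Cs : Fin n → Matrix (Fin 3) (Fin 3) ℂ) (β : Fin (2 * n + 1) → ℂ) :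
    Set (Fin n → P2) :=
  closure (chartMapN Cs '' quadSet n β)

/-- `D_Q = Yₙ ∩ H_Q`. -/
def DQ {n : ℕ} (A : Fin n → Matrix (Fin 3) (Fin 4) ℂ)
    (Cs : Fin n → Matrix (Fin 3) (Fin 3) ℂ) (β : Fin (2 * n + 1) → ℂ) :
    Set (Fin n → P2) :=
  mvVariety A ∩ HQ Cs β

/-! Smooth points of subsets of `(ℙ²)ⁿ`, via standard affine charts. -/

/-- The standard affine chart of `(ℙ²)ⁿ` indexed by `j`, inserting `1` in slot `j i`. -/
def stdChart {n : ℕ} (j : Fin n → Fin 3) (z : Fin n → Fin 2 → ℂ) : Fin n → P2 :=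
  fun i => mkP (Fin.insertNth (j i) (1 : ℂ) (z i))

/-- `p` is a smooth point of `S ⊆ (ℙ²)ⁿ`, of local (complex) dimension `d`. -/
def IsSmoothPtP {n : ℕ} (S : Set (Fin n → P2)) (p : Fin n → P2) (d : ℕ) : Prop :=
  ∃ (j : Fin n → Fin 3) (z₀ : Fin n → Fin 2 → ℂ), stdChart j z₀ = p ∧
    IsSmoothGermAt (E := Fin n → Fin 2 → ℂ) (stdChart j ⁻¹' S) z₀ d

/-! The stratification of `D_Q` from Proposition 4.7. -/

/-- Relative to the chart matrix `Cs i`, with homogeneous coordinates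
`(xᵢ, y_{2i-1}, y_{2i}) = (w 0, w 1, w 2)`, the point `p ∈ ℙ²` satisfies
`(y_{2i-1} - β_{2i-1} xᵢ)² + (y_{2i} - β_{2i} xᵢ)² = 0`. -/
def QuadCondAt {n : ℕ} (Cs : Fin n → Matrix (Fin 3) (Fin 3) ℂ)
    (β : Fin (2 * n + 1) → ℂ) (i : Fin n) (p : P2) : Prop :=
  ∃ w : Fin 3 → ℂ, w ≠ 0 ∧ p = mkP ((Cs i).mulVec w) ∧
    (w 1 - β ⟨2 * i.1 + 1, by have := i.2; omega⟩ * w 0) ^ 2 +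
      (w 2 - β ⟨2 * i.1 + 2, by have := i.2; omega⟩ * w 0) ^ 2 = 0

/-- `D_{∞,i} ∩ D_{∞,j}` minus the triple intersections. -/
def edgeCore {n : ℕ} (A : Fin n → Matrix (Fin 3) (Fin 4) ℂ)
    (Cs : Fin n → Matrix (Fin 3) (Fin 3) ℂ) (i j : Fin n) : Set (Fin n → P2) :=
  (Dinf A Cs i ∩ Dinf A Cs j) \ ⋃ (k : Fin n), ⋃ (_ : k ≠ i ∧ k ≠ j), Dinf A Cs k

/-- The four special points `S¹_{i,j}` on the line `D_{∞,i} ∩ D_{∞,j}`. -/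
def strat1 {n : ℕ} (A : Fin n → Matrix (Fin 3) (Fin 4) ℂ)
    (Cs : Fin n → Matrix (Fin 3) (Fin 3) ℂ) (β : Fin (2 * n + 1) → ℂ)
    (i j : Fin n) : Set (Fin n → P2) :=
  {P ∈ edgeCore A Cs i j | QuadCondAt Cs β i (P i) ∨ QuadCondAt Cs β j (P j)}

/-- The open stratum `S⁰_{i,j}` of the line `D_{∞,i} ∩ D_{∞,j}`. -/
def strat0 {n : ℕ} (A : Fin n → Matrix (Fin 3) (Fin 4) ℂ)
    (Cs : Fin n → Matrix (Fin 3) (Fin 3) ℂ) (β : Fin (2 * n + 1) → ℂ)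
    (i j : Fin n) : Set (Fin n → P2) :=
  edgeCore A Cs i j \ strat1 A Cs β i j

/-- The triple-point stratum `S_{i,j,k} = D_{∞,i} ∩ D_{∞,j} ∩ D_{∞,k}`. -/
def strat3 {n : ℕ} (A : Fin n → Matrix (Fin 3) (Fin 4) ℂ)
    (Cs : Fin n → Matrix (Fin 3) (Fin 3) ℂ) (i j k : Fin n) : Set (Fin n → P2) :=
  Dinf A Cs i ∩ Dinf A Cs j ∩ Dinf A Cs k

/-- The open stratum `S₀`: the smooth locus of `D_Q`. -/
def stratSm {n : ℕ} (A : Fin n → Matrix (Fin 3) (Fin 4) ℂ)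
    (Cs : Fin n → Matrix (Fin 3) (Fin 3) ℂ) (β : Fin (2 * n + 1) → ℂ) :
    Set (Fin n → P2) :=
  DQ A Cs β \ ⋃ (i : Fin n), ⋃ (j : Fin n), ⋃ (_ : i ≠ j), (Dinf A Cs i ∩ Dinf A Cs j)

/-- The strata of the stratification of `D_Q`. -/
def IsStratumOf {n : ℕ} (A : Fin n → Matrix (Fin 3) (Fin 4) ℂ)
    (Cs : Fin n → Matrix (Fin 3) (Fin 3) ℂ) (β : Fin (2 * n + 1) → ℂ)
    (S : Set (Fin n → P2)) : Prop :=
  S = stratSm A Cs β ∨ (∃ i j, i ≠ j ∧ S = strat0 A Cs β i j) ∨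
    (∃ i j, i ≠ j ∧ S = strat1 A Cs β i j) ∨
    (∃ i j k : Fin n, i ≠ j ∧ i ≠ k ∧ j ≠ k ∧ S = strat3 A Cs i j k)

/-! Whitney conditions, in the standard affine charts. -/

/-- The set of tangent directions of `S` at `x` (limits of rescaled secants from `x`). -/
def tanSp {E : Type} [NormedAddCommGroup E] [NormedSpace ℂ E] (S : Set E) (x : E) :
    Set E :=
  {v | ∃ (u : ℕ → E) (c : ℕ → ℂ), (∀ k, u k ∈ S) ∧
    Tendsto u atTop (𝓝 x) ∧ Tendsto (fun k => c k • (u k - x)) atTop (𝓝 v)}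

/-- The sequence of subspaces `W k` converges to `τ`: `τ` is exactly the set of limits
of sequences `w k ∈ W k`. -/
def SubspLim {E : Type} [NormedAddCommGroup E] (W : ℕ → Set E) (τ : Set E) : Prop :=
  ∀ v : E, v ∈ τ ↔ ∃ w : ℕ → E, (∀ k, w k ∈ W k) ∧ Tendsto w atTop (𝓝 v)

/-- Whitney's conditions (a) and (b) for the pair of strata `(R, T)` of a subset of
`(ℙ²)ⁿ`, checked in the standard affine charts: at every point `p` of `R`, for every
sequence of points of `T` converging to `p` whose tangent spaces converge to `τ`,
(a) the tangent space of `R` at `p` is contained in `τ`, and (b) every limit of secant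
directions between the sequence and a sequence in `R` converging to `p` lies in `τ`. -/
def WhitneyCondAB {n : ℕ} (R T : Set (Fin n → P2)) : Prop :=
  ∀ (j : Fin n → Fin 3) (p : Fin n → Fin 2 → ℂ), stdChart j p ∈ R →
    ∀ (x y : ℕ → Fin n → Fin 2 → ℂ) (τ : Set (Fin n → Fin 2 → ℂ)) (c : ℕ → ℂ),
      (∀ k, stdChart j (x k) ∈ T) → (∀ k, stdChart j (y k) ∈ R) →
      Tendsto x atTop (𝓝 p) → Tendsto y atTop (𝓝 p) →
      SubspLim (fun k => tanSp (stdChart j ⁻¹' T) (x k)) τ →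
      (tanSp (stdChart j ⁻¹' R) p ⊆ τ) ∧
      (∀ v : Fin n → Fin 2 → ℂ, v ≠ 0 →
        Tendsto (fun k => c k • (x k - y k)) atTop (𝓝 v) → v ∈ τ)

/-- A locally closed subset. -/
def IsLocClosed {X : Type} [TopologicalSpace X] (S : Set X) : Prop :=
  ∃ U Z : Set X, IsOpen U ∧ IsClosed Z ∧ S = U ∩ Z

/-! ### Genericity -/

theorem Generically.mono {K : Type} [CommSemiring K] {σ : Type} {P Q : (σ → K) → Prop}
    (hP : Generically P) (h : ∀ a, P a → Q a) : Generically Q := by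
  obtain ⟨q, hq, hq'⟩ := hP
  exact ⟨q, hq, fun a ha => h a (hq' a ha)⟩

theorem Generically.and {K : Type} [Field K] {σ : Type} {P Q : (σ → K) → Prop}
    (hP : Generically P) (hQ : Generically Q) : Generically fun a => P a ∧ Q a := by
  obtain ⟨p, hp, hp'⟩ := hP
  obtain ⟨q, hq, hq'⟩ := hQ
  refine ⟨p * q, mul_ne_zero hp hq, fun a ha => ?_⟩
  rw [map_mul] at ha
  exact ⟨hp' a (left_ne_zero_of_mul ha), hq' a (right_ne_zero_of_mul ha)⟩

theorem Generically.of_forall {K : Type} [Field K] {σ : Type} {P : (σ → K) → Prop}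
    (h : ∀ a, P a) : Generically P :=
  ⟨1, one_ne_zero, fun a _ => h a⟩

theorem Generically.all {K : Type} [Field K] {σ ι : Type} [Finite ι] {P : ι → (σ → K) → Prop}
    (h : ∀ i, Generically (P i)) : Generically fun a => ∀ i, P i a := by
  classical
  cases nonempty_fintype ι
  choose q hq hq' using h
  refine ⟨∏ i, q i, Finset.prod_ne_zero_iff.mpr fun i _ => hq i, fun a ha i => hq' i a ?_⟩
  rw [map_prod] at ha
  exact Finset.prod_ne_zero_iff.mp ha i (Finset.mem_univ i)

theorem Generically.imp {K : Type} [Field K] {σ : Type} {p : Prop} {P : (σ → K) → Prop}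
    (h : p → Generically P) : Generically fun a => p → P a := by
  by_cases hp : p
  · exact (h hp).mono fun a ha _ => ha
  · exact Generically.of_forall fun a h => absurd h hp

/-- A nonzero polynomial in two groups of variables is, for general values of the first group,
nonzero at general values of the second group. -/
theorem generically_eval_sumElim_ne_zero {K : Type} [Field K] {σ τ : Type}
    {Q : MvPolynomial (σ ⊕ τ) K} (hQ : Q ≠ 0) :
    Generically (K := K) (σ := σ) fun a => Generically (K := K) (σ := τ) fun c =>
      MvPolynomial.eval (Sum.elim a c) Q ≠ 0 := by
  classical
  let e := (MvPolynomial.renameEquiv K (Equiv.sumComm σ τ)).trans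
    (MvPolynomial.sumAlgEquiv K τ σ)
  have he : e Q ≠ 0 := fun h => hQ (e.injective (by rw [h, map_zero]))
  obtain ⟨m, hm⟩ := MvPolynomial.ne_zero_iff.mp he
  refine ⟨_, hm, fun a ha => ⟨MvPolynomial.map (MvPolynomial.eval a) (e Q), ?_, fun c hc => ?_⟩⟩
  · intro h
    apply ha
    rw [← MvPolynomial.coeff_map, h, MvPolynomial.coeff_zero]
  · have key : ∀ p : MvPolynomial (σ ⊕ τ) K,
        MvPolynomial.eval (Sum.elim a c) p =
          MvPolynomial.eval c (MvPolynomial.map (MvPolynomial.eval a) (e p)) := by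
      intro p
      induction p using MvPolynomial.induction_on with
      | C r => simp [e]
      | add p q hp hq => simp only [map_add, hp, hq]
      | mul_X p i hp =>
        rw [map_mul, hp, map_mul, map_mul, map_mul]
        congr 1
        cases i <;> simp [e]
    exact (key Q).trans_ne hc

/-- The image of a rational map from an affine space of smaller dimension lies in a hypersurface. -/
theorem exists_hypersurface_of_card_lt {K : Type} [Field K] {σ τ : Type} [Fintype σ] [Fintype τ]
    (h : Fintype.card σ < Fintype.card τ) (f : τ → MvPolynomial σ K) (d : MvPolynomial σ K) :
    ∃ Q : MvPolynomial τ K, Q ≠ 0 ∧ ∀ (t : σ → K) (β : τ → K), MvPolynomial.eval t d ≠ 0 →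
      (∀ k, β k * MvPolynomial.eval t d = MvPolynomial.eval t (f k)) →
      MvPolynomial.eval β Q = 0 := by
  classical
  by_cases hd : d = 0
  · exact ⟨1, one_ne_zero, fun t β ht => absurd (by simp [hd]) ht⟩
  have hle : Submonoid.powers d ≤ nonZeroDivisors (MvPolynomial σ K) :=
    powers_le_nonZeroDivisors_of_noZeroDivisors hd
  let L := Localization.Away d
  have : IsDomain L := IsLocalization.isDomain_localization hle
  let x : τ → L := fun k => IsLocalization.mk' L (f k) (⟨d, 1, by simp⟩ : Submonoid.powers d)
  have : FaithfulSMul (MvPolynomial σ K) L :=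
    (faithfulSMul_iff_algebraMap_injective _ _).mpr (IsLocalization.injective L hle)
  have htr : Algebra.trdeg K L = Fintype.card σ := by
    have h1 := _root_.trdeg_add_eq (R := K) (S := MvPolynomial σ K) (A := L)
    have h2 : Algebra.IsAlgebraic (MvPolynomial σ K) L :=
      IsLocalization.isAlgebraic L (Submonoid.powers d)
    rw [MvPolynomial.trdeg_of_isDomain, trdeg_eq_zero] at h1
    rw [← h1]
    simp
  have hx : ¬ AlgebraicIndependent K x := by
    intro hx
    have h1 := hx.lift_cardinalMk_le_trdeg
    rw [htr] at h1
    simp only [Cardinal.mk_fintype, Cardinal.lift_natCast, Nat.cast_le] at h1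
    omega
  rw [algebraicIndependent_iff] at hx
  push Not at hx
  obtain ⟨Q, hQ, hQ0⟩ := hx
  refine ⟨Q, hQ0, fun t β ht hβ => ?_⟩
  let φ : L →+* K := IsLocalization.Away.lift d (g := MvPolynomial.eval t)
    (isUnit_iff_ne_zero.mpr ht)
  have hφ : ∀ p, φ (algebraMap _ L p) = MvPolynomial.eval t p := fun p =>
    IsLocalization.Away.lift_eq d _ p
  have hφx : ∀ k, φ (x k) = β k := by
    intro k
    have h1 : x k * algebraMap _ L d = algebraMap _ L (f k) :=
      IsLocalization.mk'_spec L (f k) (⟨d, 1, by simp⟩ : Submonoid.powers d)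
    have h2 := congrArg φ h1
    rw [map_mul, hφ, hφ, ← hβ k] at h2
    exact mul_right_cancel₀ ht h2
  have h3 := congrArg φ hQ
  rw [map_zero, MvPolynomial.aeval_def, MvPolynomial.hom_eval₂] at h3
  have h4 : φ.comp (algebraMap K L) = RingHom.id K := by
    ext r
    rw [RingHom.comp_apply, IsScalarTower.algebraMap_apply K (MvPolynomial σ K) L, hφ]
    simp [MvPolynomial.algebraMap_eq]
  rw [h4] at h3
  have h5 : (fun i => φ (x i)) = β := funext hφx
  rw [h5] at h3
  exact h3

/-! ### Local parametrizations and Whitney's condition (b) -/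

section LocalAnalysis

variable {E : Type} [NormedAddCommGroup E] [NormedSpace ℂ E]
  {V : Type} [NormedAddCommGroup V] [NormedSpace ℂ V]
  {W : Type} [NormedAddCommGroup W] [NormedSpace ℂ W]

/-- `ψ` is an immersive local parametrization of the set `S` around `p = ψ 0`. -/
structure IsLocParam (ψ : V → E) (S : Set E) (p : E) : Prop where
  smooth : ContDiffAt ℂ 1 ψ 0
  zero : ψ 0 = p
  inj : Function.Injective (fderiv ℂ ψ 0)
  nhds : map ψ (𝓝 0) = 𝓝[S] p

theorem IsLocParam.eventually_mem {ψ : V → E} {S : Set E} {p : E} (h : IsLocParam ψ S p) :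
    ∀ᶠ s in 𝓝 0, ψ s ∈ S := by
  have : S ∈ map ψ (𝓝 0) := h.nhds ▸ self_mem_nhdsWithin
  exact this

theorem IsLocParam.congr {ψ : V → E} {S S' : Set E} {p : E} (h : IsLocParam ψ S p)
    (hS : 𝓝[S] p = 𝓝[S'] p) : IsLocParam ψ S' p :=
  ⟨h.smooth, h.zero, h.inj, h.nhds.trans hS⟩

theorem IsLocParam.comp {ψ : V → E} {S D : Set E} {p : E} (h : IsLocParam ψ S p)
    {φ : W → V} (hφ : IsLocParam φ (ψ ⁻¹' D) 0) : IsLocParam (ψ ∘ φ) (S ∩ D) p := by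
  have h1 : ContDiffAt ℂ 1 ψ (φ 0) := by rw [hφ.zero]; exact h.smooth
  refine ⟨h1.comp 0 hφ.smooth, by simp [hφ.zero, h.zero], ?_, ?_⟩
  · rw [fderiv_comp 0 (h1.differentiableAt one_ne_zero)
      (hφ.smooth.differentiableAt one_ne_zero), hφ.zero]
    exact h.inj.comp hφ.inj
  · rw [← Filter.map_map, hφ.nhds, nhdsWithin, Filter.map_inf_principal_preimage, h.nhds,
      nhdsWithin, nhdsWithin, inf_assoc, inf_principal]

theorem IsLocParam.isSmoothGermAt {d : ℕ} {ψ : (Fin d → ℂ) → E} {S : Set E} {p : E}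
    (h : IsLocParam ψ S p) : IsSmoothGermAt S p d := by
  have hstrict := h.smooth.hasStrictFDerivAt one_ne_zero
  obtain ⟨K, hK, hK'⟩ := (fderiv ℂ ψ 0).toLinearMap.exists_antilipschitzWith
    (LinearMap.ker_eq_bot.mpr h.inj)
  have hinj : ∃ U ∈ 𝓝 (0 : Fin d → ℂ), Set.InjOn ψ U := by
    obtain ⟨U, hU, hU'⟩ := hstrict.approximates_deriv_on_nhds (c := K⁻¹ / 2)
      (Or.inr (by positivity))
    refine ⟨U, hU, ?_⟩
    intro x hx y hy hxy
    by_contra hne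
    have h1 := hU' x hx y hy
    rw [hxy, sub_self, zero_sub, norm_neg] at h1
    have h2 := hK'.le_mul_dist x y
    simp only [dist_eq_norm] at h2
    have h3 : ((fderiv ℂ ψ 0).toLinearMap) x - ((fderiv ℂ ψ 0).toLinearMap) y
      = fderiv ℂ ψ 0 (x - y) := by simp
    rw [h3] at h2
    have h4 : 0 < ‖x - y‖ := norm_pos_iff.mpr (sub_ne_zero.mpr hne)
    have h5 : (K : ℝ) * ((K⁻¹ / 2 : NNReal) : ℝ) = 1 / 2 := by
      push_cast; field_simp
    have h6 : ‖x - y‖ ≤ (K : ℝ) * (((K⁻¹ / 2 : NNReal) : ℝ) * ‖x - y‖) :=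
      h2.trans (mul_le_mul_of_nonneg_left h1 K.2)
    rw [← mul_assoc, h5] at h6
    linarith
  obtain ⟨U₁, hU₁, hU₁'⟩ := hinj
  have hdiff : ∀ᶠ s in 𝓝 (0 : Fin d → ℂ), DifferentiableAt ℂ ψ s :=
    (h.smooth.eventually (by simp)).mono fun s hs => hs.differentiableAt one_ne_zero
  obtain ⟨U, hU, hUo, h0⟩ := mem_nhds_iff.mp
    (inter_mem hU₁ (inter_mem hdiff h.eventually_mem))
  have himg : ψ '' U ∈ 𝓝[S] p := h.nhds ▸ image_mem_map (hUo.mem_nhds h0)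
  obtain ⟨V, hV, hV'⟩ := mem_nhdsWithin_iff_exists_mem_nhds_inter.mp himg
  refine ⟨ψ, U, hUo, h0, h.zero, fun x hx => (hU hx).2.1.differentiableWithinAt,
    hU₁'.mono fun x hx => (hU hx).1, h.inj, V ∪ ψ '' U, mem_of_superset hV Set.subset_union_left,
    ?_⟩
  ext x
  constructor
  · intro hx
    refine ⟨?_, Or.inr hx⟩
    obtain ⟨s, hs, rfl⟩ := hx
    exact (hU hs).2.2
  · rintro ⟨hxS, hx | hx⟩
    · exact hV' ⟨hx, hxS⟩
    · exact hx

/-- An immersive parametrization has a strictly differentiable local left inverse. -/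
theorem IsLocParam.exists_leftInverse [FiniteDimensional ℂ V] [FiniteDimensional ℂ E]
    {ψ : V → E} {S : Set E} {p : E} (h : IsLocParam ψ S p) :
    ∃ (π : E → V) (π' : E →L[ℂ] V), HasStrictFDerivAt π π' p ∧ π p = 0 ∧
      ∀ᶠ x in 𝓝[S] p, ψ (π x) = x := by
  have : CompleteSpace V := FiniteDimensional.complete ℂ V
  obtain ⟨L₀, hL₀⟩ := (fderiv ℂ ψ 0).toLinearMap.exists_leftInverse_of_injective
    (LinearMap.ker_eq_bot.mpr h.inj)
  let L : E →L[ℂ] V := LinearMap.toContinuousLinearMap L₀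
  have hL : L ∘L fderiv ℂ ψ 0 = (ContinuousLinearEquiv.refl ℂ V : V →L[ℂ] V) := by
    ext v
    exact LinearMap.congr_fun hL₀ v
  have hφ : HasStrictFDerivAt (fun s => L (ψ s))
      ((ContinuousLinearEquiv.refl ℂ V : V →L[ℂ] V)) 0 := by
    rw [← hL]
    exact L.hasStrictFDerivAt.comp 0 (h.smooth.hasStrictFDerivAt one_ne_zero)
  have hinv := hφ.to_localInverse
  rw [h.zero] at hinv
  refine ⟨fun x => hφ.localInverse _ _ _ (L x), _, hinv.comp p L.hasStrictFDerivAt, ?_, ?_⟩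
  · have := hφ.localInverse_apply_image
    rwa [h.zero] at this
  · rw [← h.nhds, eventually_map]
    filter_upwards [hφ.eventually_left_inverse] with s hs
    rw [hs]

/-- Near a point where the differential of `f` does not vanish, the level sets of `f` are
straightened by a local diffeomorphism tangent to the identity. -/
theorem exists_straightening [CompleteSpace V] {f : V → ℂ} {s : V} (hf : ContDiffAt ℂ 1 f s)
    (hs : f s = 0) (hd : fderiv ℂ f s ≠ 0) :
    ∃ ρ : V → V, ContDiffAt ℂ 1 ρ 0 ∧ ρ 0 = s ∧
      HasFDerivAt ρ (ContinuousLinearMap.id ℂ V) 0 ∧ map ρ (𝓝 0) = 𝓝 s ∧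
      ∀ᶠ k in 𝓝 0, f (ρ k) = fderiv ℂ f s k := by
  obtain ⟨a₀, ha₀⟩ : ∃ a, fderiv ℂ f s a ≠ 0 := by
    by_contra! hcon
    exact hd (ContinuousLinearMap.ext hcon)
  let f' := fderiv ℂ f s
  let a := (f' a₀)⁻¹ • a₀
  have ha : f' a = 1 := by simp [a, f', ha₀]
  let Φ : V → V := fun x => f x • a + ((x - s) - f' (x - s) • a)
  have hΦs : Φ s = 0 := by simp [Φ, hs]
  have hΦ : ContDiffAt ℂ 1 Φ s := by
    have h1 : ContDiffAt ℂ 1 (fun x => x - s) s := contDiffAt_id.sub contDiffAt_const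
    have h2 : ContDiffAt ℂ 1 (fun x => f' (x - s)) s := f'.contDiff.contDiffAt.comp s h1
    exact (hf.smul contDiffAt_const).add (h1.sub (h2.smul contDiffAt_const))
  have hΦ' : HasStrictFDerivAt Φ ((ContinuousLinearEquiv.refl ℂ V : V →L[ℂ] V)) s := by
    have h0 : HasStrictFDerivAt f f' s := hf.hasStrictFDerivAt one_ne_zero
    have h1 : HasStrictFDerivAt (fun x => x - s) (ContinuousLinearMap.id ℂ V) s :=
      (hasStrictFDerivAt_id s).sub_const s
    have h2 : HasStrictFDerivAt (fun x => f' (x - s)) f' s := f'.hasStrictFDerivAt.comp s h1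
    have h3 := (h0.smul_const a).add (h1.sub (h2.smul_const a))
    refine h3.congr_fderiv ?_
    ext v
    simp
  have hinv := hΦ'.to_localInverse
  have hL0 : hΦ'.localInverse _ _ _ 0 = s := by
    have := hΦ'.localInverse_apply_image
    rwa [hΦs] at this
  rw [hΦs] at hinv
  refine ⟨hΦ'.localInverse _ _ _, ?_, hL0, hinv.hasFDerivAt, ?_, ?_⟩
  · have := (hΦ'.toOpenPartialHomeomorph Φ).contDiffAt_symm
      (f₀' := ContinuousLinearEquiv.refl ℂ V) (a := 0) (n := 1) ?_ ?_ ?_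
    · simpa [← HasStrictFDerivAt.localInverse_def] using this
    · have := hΦ'.image_mem_toOpenPartialHomeomorph_target
      rwa [hΦs] at this
    · rw [← HasStrictFDerivAt.localInverse_def, hL0]
      exact hΦ'.hasFDerivAt
    · rw [← HasStrictFDerivAt.localInverse_def, hL0]
      exact hΦ
  · have := hinv.map_nhds_eq_of_equiv
    rwa [hL0] at this
  · have := hΦ'.eventually_right_inverse
    rw [hΦs] at this
    filter_upwards [this] with k hk
    have h2 := congrArg f' hk
    simpa [Φ, ha] using h2

/-- Smooth level sets are parametrized by the kernel of the differential. -/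
theorem exists_isLocParam_level {f : (Fin 3 → ℂ) → ℂ}
    (hf : ContDiffAt ℂ 1 f 0) (hs : f 0 = 0) (hd : fderiv ℂ f 0 ≠ 0) :
    ∃ φ : (Fin 2 → ℂ) → Fin 3 → ℂ, IsLocParam φ {x | f x = 0} 0 := by
  obtain ⟨ρ, hρ, hρ0, hρ', hmap, hker⟩ := exists_straightening hf hs hd
  let K := LinearMap.ker (fderiv ℂ f 0).toLinearMap
  have hK : Module.finrank ℂ K = 2 := by
    have h1 := (fderiv ℂ f 0).toLinearMap.finrank_range_add_finrank_ker
    have h2 : LinearMap.range (fderiv ℂ f 0).toLinearMap = ⊤ :=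
      LinearMap.range_eq_top.mpr (LinearMap.surjective
        (fun h => hd (ContinuousLinearMap.ext fun v => LinearMap.congr_fun h v)))
    rw [h2, finrank_top, Module.finrank_self, Module.finrank_fin_fun] at h1
    change 1 + Module.finrank ℂ K = 3 at h1
    omega
  let e : (Fin 2 → ℂ) ≃L[ℂ] K := ContinuousLinearEquiv.ofFinrankEq (by simp [hK])
  let ι : (Fin 2 → ℂ) →L[ℂ] (Fin 3 → ℂ) := K.subtypeL ∘L (e : (Fin 2 → ℂ) →L[ℂ] K)
  have hι0 : ι 0 = 0 := map_zero ι
  have hιmap : map ι (𝓝 0) = 𝓝[(K : Set (Fin 3 → ℂ))] 0 := by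
    have h1 : map e (𝓝 0) = 𝓝 0 := by
      have := e.toHomeomorph.map_nhds_eq 0
      simpa using this
    change map ((fun x : K => (x : Fin 3 → ℂ)) ∘ e) (𝓝 0) = _
    rw [← Filter.map_map, h1]
    exact map_nhds_subtype_val (0 : K)
  refine ⟨fun x => ρ (ι x), ?_, ?_, ?_, ?_⟩
  · exact (hι0 ▸ hρ : ContDiffAt ℂ 1 ρ (ι 0)).comp 0 ι.contDiff.contDiffAt
  · simp [hι0, hρ0]
  · have h1 : HasFDerivAt ρ (ContinuousLinearMap.id ℂ _) (ι 0) := hι0 ▸ hρ'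
    have h2 : HasFDerivAt (fun x => ρ (ι x)) _ 0 := h1.comp 0 ι.hasFDerivAt
    rw [h2.fderiv]
    exact Subtype.val_injective.comp e.injective
  · change map (ρ ∘ ι) (𝓝 0) = _
    rw [← Filter.map_map, hιmap]
    have h2 : 𝓝[(K : Set (Fin 3 → ℂ))] 0 = 𝓝 0 ⊓ 𝓟 (ρ ⁻¹' {x | f x = 0}) := by
      change _ = 𝓝[ρ ⁻¹' {x | f x = 0}] 0
      apply nhdsWithin_eq_iff_eventuallyEq.mpr
      filter_upwards [hker] with k hk
      simp only [eq_iff_iff]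
      change k ∈ K ↔ f (ρ k) = 0
      rw [hk]
      exact LinearMap.mem_ker
    rw [h2, Filter.map_inf_principal_preimage, hmap]
    rfl

theorem tendsto_smul_sub_of_hasStrictFDerivAt {ψ : V → E} {ψ' : V →L[ℂ] E} {x ν : V}
    (h : HasStrictFDerivAt ψ ψ' x) {u v : ℕ → V} {c : ℕ → ℂ} (hu : Tendsto u atTop (𝓝 x))
    (hv : Tendsto v atTop (𝓝 x)) (hc : Tendsto (fun k => c k • (u k - v k)) atTop (𝓝 ν)) :
    Tendsto (fun k => c k • (ψ (u k) - ψ (v k))) atTop (𝓝 (ψ' ν)) := by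
  have h1 := h.isLittleO.comp_tendsto (hu.prodMk_nhds hv)
  have h2 := ((Asymptotics.isBigO_refl c atTop).smul_isLittleO h1).trans_isBigO
    (hc.isBigO_one ℝ)
  have h3 := (Asymptotics.isLittleO_one_iff ℝ).mp h2
  have h4 := h3.add ((ψ'.continuous.tendsto ν).comp hc)
  simp only [zero_add] at h4
  refine h4.congr fun k => ?_
  simp only [Function.comp_apply, map_smul, smul_sub, map_sub]
  abel

theorem tendsto_smul_sub_of_hasFDerivAt {ψ : V → E} {ψ' : V →L[ℂ] E} {x ν : V}
    (h : HasFDerivAt ψ ψ' x) {u : ℕ → V} {c : ℕ → ℂ} (hu : Tendsto u atTop (𝓝 x))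
    (hc : Tendsto (fun k => c k • (u k - x)) atTop (𝓝 ν)) :
    Tendsto (fun k => c k • (ψ (u k) - ψ x)) atTop (𝓝 (ψ' ν)) := by
  have h1 := h.isLittleO.comp_tendsto hu
  have h2 := ((Asymptotics.isBigO_refl c atTop).smul_isLittleO h1).trans_isBigO
    (hc.isBigO_one ℝ)
  have h3 := (Asymptotics.isLittleO_one_iff ℝ).mp h2
  have h4 := h3.add ((ψ'.continuous.tendsto ν).comp hc)
  simp only [zero_add] at h4
  refine h4.congr fun k => ?_
  simp only [Function.comp_apply, map_smul, smul_sub, map_sub]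
  abel

theorem zero_mem_tanSp {S : Set E} {x : E} (hx : x ∈ S) : (0 : E) ∈ tanSp S x :=
  ⟨fun _ => x, fun _ => 0, fun _ => hx, tendsto_const_nhds, by simp⟩

theorem tanSp_of_eventually {S : Set E} {x v : E} (hx : x ∈ S) {u : ℕ → E} {c : ℕ → ℂ}
    (hu : ∀ᶠ k in atTop, u k ∈ S) (hux : Tendsto u atTop (𝓝 x))
    (hc : Tendsto (fun k => c k • (u k - x)) atTop (𝓝 v)) : v ∈ tanSp S x := by
  classical
  refine ⟨fun k => if u k ∈ S then u k else x, c, fun k => ?_, ?_, ?_⟩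
  · dsimp only
    split_ifs with h
    · exact h
    · exact hx
  · refine hux.congr' ?_
    filter_upwards [hu] with k hk
    simp [hk]
  · refine hc.congr' ?_
    filter_upwards [hu] with k hk
    simp [hk]

theorem map_mem_tanSp {ψ : V → E} {T : Set E} {s ν : V} (hψ : DifferentiableAt ℂ ψ s)
    (hν : ν ∈ tanSp (ψ ⁻¹' T) s) : fderiv ℂ ψ s ν ∈ tanSp T (ψ s) := by
  obtain ⟨u, c, hu, hus, hc⟩ := hν
  refine ⟨fun k => ψ (u k), c, hu, hψ.continuousAt.tendsto.comp hus,
    tendsto_smul_sub_of_hasFDerivAt hψ.hasFDerivAt hus hc⟩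

/-- The kernel of the differential consists of tangent directions of the level set. -/
theorem mem_tanSp_of_fderiv_eq_zero [CompleteSpace V] {f : V → ℂ} {T : Set V} {s ν : V}
    (hf : ContDiffAt ℂ 1 f s) (hs : f s = 0) (hd : fderiv ℂ f s ≠ 0) (hsT : s ∈ T)
    (hT : T ∈ 𝓝[{x | f x = 0}] s) (hν : fderiv ℂ f s ν = 0) : ν ∈ tanSp T s := by
  obtain ⟨ρ, -, hρ0, hρ', hmap, hker⟩ := exists_straightening hf hs hd
  have h1 : Tendsto (fun k : ℕ => ((k : ℂ) + 1)⁻¹ • ν) atTop (𝓝 0) := by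
    have : Tendsto (fun k : ℕ => ((k : ℂ) + 1)⁻¹) atTop (𝓝 0) := by
      simpa using tendsto_one_div_add_atTop_nhds_zero_nat (𝕜 := ℂ)
    simpa using this.smul_const ν
  have h2 : Tendsto (fun k : ℕ => ρ (((k : ℂ) + 1)⁻¹ • ν)) atTop (𝓝 s) := by
    have := hρ'.continuousAt.tendsto.comp h1
    rwa [hρ0] at this
  refine tanSp_of_eventually (u := fun k : ℕ => ρ (((k : ℂ) + 1)⁻¹ • ν))
    (c := fun k => (k : ℂ) + 1) hsT ?_ h2 ?_
  · have h3 : Tendsto (fun k : ℕ => ρ (((k : ℂ) + 1)⁻¹ • ν)) atTop (𝓝[{x | f x = 0}] s) := by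
      refine tendsto_nhdsWithin_iff.mpr ⟨h2, ?_⟩
      filter_upwards [h1.eventually hker] with k hk
      simp [hk, hν]
    exact h3 hT
  · have h4 := tendsto_smul_sub_of_hasFDerivAt hρ' (ν := ν)
      (u := fun k : ℕ => ((k : ℂ) + 1)⁻¹ • ν) (c := fun k : ℕ => (k : ℂ) + 1) h1 ?_
    · simpa [hρ0] using h4
    · refine tendsto_const_nhds.congr fun k => ?_
      have : (k : ℂ) + 1 ≠ 0 := by exact_mod_cast k.succ_ne_zero
      simp [smul_smul, this]

end LocalAnalysis

theorem exists_tendsto_of_infDist {E : Type} [NormedAddCommGroup E]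
    {A : ℕ → Set E} {z : ℕ → E} {v : E}
    (hA : ∀ ε > 0, ∀ᶠ k in atTop, ∃ w ∈ A k, ‖z k - w‖ ≤ ε) (hz : Tendsto z atTop (𝓝 v)) :
    ∃ w : ℕ → E, (∀ᶠ k in atTop, w k ∈ A k) ∧ Tendsto w atTop (𝓝 v) := by
  classical
  have hne : ∀ᶠ k in atTop, (A k).Nonempty :=
    (hA 1 one_pos).mono fun k ⟨w, hw, _⟩ => ⟨w, hw⟩
  have hch : ∀ k : ℕ, ∃ w, (A k).Nonempty →
      w ∈ A k ∧ dist (z k) w < Metric.infDist (z k) (A k) + 1 / ((k : ℝ) + 1) := by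
    intro k
    by_cases hk : (A k).Nonempty
    · obtain ⟨w, hw, hw'⟩ := (Metric.infDist_lt_iff (x := z k) hk).mp
        (lt_add_of_pos_right _ (by positivity : (0 : ℝ) < 1 / ((k : ℝ) + 1)))
      exact ⟨w, fun _ => ⟨hw, hw'⟩⟩
    · exact ⟨0, fun h => absurd h hk⟩
  choose w hw using hch
  refine ⟨w, hne.mono fun k hk => (hw k hk).1, ?_⟩
  have h1 : Tendsto (fun k => Metric.infDist (z k) (A k)) atTop (𝓝 0) := by
    refine Metric.tendsto_nhds.mpr fun ε hε => ?_
    filter_upwards [hA (ε / 2) (half_pos hε)] with k hk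
    obtain ⟨w, hw, hw'⟩ := hk
    have := Metric.infDist_le_dist_of_mem (x := z k) hw
    rw [dist_eq_norm] at this
    rw [dist_zero_right, Real.norm_of_nonneg Metric.infDist_nonneg]
    linarith
  have h2 := h1.add (tendsto_one_div_add_atTop_nhds_zero_nat (𝕜 := ℝ))
  rw [add_zero] at h2
  have h3 : Tendsto (fun k => z k - w k) atTop (𝓝 0) := by
    refine squeeze_zero_norm' (hne.mono fun k hk => ?_) h2
    rw [← dist_eq_norm]
    exact (hw k hk).2.le
  simpa using hz.sub h3

section WhitneyB

variable {E : Type} [NormedAddCommGroup E] [NormedSpace ℂ E]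
  {V : Type} [NormedAddCommGroup V] [NormedSpace ℂ V]

/-- Limits of secants between `T` and `R` at `p` are limits of tangent vectors of `T`. -/
def WhitneyB (T R : Set E) (p : E) : Prop :=
  ∀ (x y : ℕ → E) (c : ℕ → ℂ) (v : E), (∀ᶠ k in atTop, x k ∈ T) → (∀ᶠ k in atTop, y k ∈ R) →
    Tendsto x atTop (𝓝 p) → Tendsto y atTop (𝓝 p) →
    Tendsto (fun k => c k • (x k - y k)) atTop (𝓝 v) →
    ∃ w : ℕ → E, (∀ᶠ k in atTop, w k ∈ tanSp T (x k)) ∧ Tendsto w atTop (𝓝 v)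

theorem exists_slow_sequence {P : ℕ → ℕ → Prop} (h : ∀ m, ∀ᶠ k in atTop, P m k) :
    ∃ m : ℕ → ℕ, Tendsto m atTop atTop ∧ ∀ᶠ k in atTop, P (m k) k := by
  classical
  let Q : ℕ → ℕ → Prop := fun k m => ∀ k' ≥ k, ∀ m' ≤ m, P m' k'
  have hQ : ∀ M, ∃ K, ∀ k ≥ K, Q k M := by
    intro M
    have h1 : ∀ᶠ k in atTop, ∀ m ∈ Finset.range (M + 1), P m k :=
      (Filter.eventually_all_finset _).mpr fun m _ => h m
    obtain ⟨K, hK⟩ := eventually_atTop.mp h1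
    exact ⟨K, fun k hk k' hk' m hm => hK k' (hk.trans hk') m (Finset.mem_range.mpr (by omega))⟩
  refine ⟨fun k => Nat.findGreatest (Q k) k, ?_, ?_⟩
  · refine tendsto_atTop.mpr fun M => ?_
    obtain ⟨K, hK⟩ := hQ M
    filter_upwards [eventually_ge_atTop K, eventually_ge_atTop M] with k hk hM
    exact Nat.le_findGreatest hM (hK k hk)
  · obtain ⟨K, hK⟩ := hQ 0
    filter_upwards [eventually_ge_atTop K] with k hk
    have := Nat.findGreatest_spec (P := Q k) (Nat.zero_le k) (hK k hk)
    exact this k le_rfl _ le_rfl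

/-- Condition (b) in all standard charts implies both Whitney conditions. -/
theorem whitneyCondAB_of_whitneyB {n : ℕ} {R T : Set (Fin n → P2)}
    (h : ∀ j p, stdChart j p ∈ R → WhitneyB (stdChart j ⁻¹' T) (stdChart j ⁻¹' R) p) :
    WhitneyCondAB R T := by
  classical
  intro j p hp x y τ c hx hy hxp hyp hτ
  have key : ∀ (y : ℕ → Fin n → Fin 2 → ℂ) (c : ℕ → ℂ) (v : Fin n → Fin 2 → ℂ),
      (∀ k, stdChart j (y k) ∈ R) → Tendsto y atTop (𝓝 p) →
      Tendsto (fun k => c k • (x k - y k)) atTop (𝓝 v) → v ∈ τ := by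
    intro y c v hy hyp hv
    obtain ⟨w, hw, hwv⟩ := h j p hp x y c v (.of_forall hx) (.of_forall hy) hxp hyp hv
    refine (hτ v).mpr ⟨fun k => if w k ∈ tanSp (stdChart j ⁻¹' T) (x k) then w k else 0,
      fun k => ?_, hwv.congr' ?_⟩
    · dsimp only
      split_ifs with hk
      · exact hk
      · exact zero_mem_tanSp (hx k)
    · filter_upwards [hw] with k hk
      simp [hk]
  refine ⟨?_, fun v _ hv => key y c v hy hyp hv⟩
  rintro v ⟨u, d, hu, hup, hv⟩
  have h1 : ∀ m : ℕ, ∀ᶠ k in atTop, ‖d m • (x k - p)‖ < 1 / ((m : ℝ) + 1) := by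
    intro m
    have h2 : Tendsto (fun k => ‖d m • (x k - p)‖) atTop (𝓝 0) := by
      have h3 := ((hxp.sub_const p).const_smul (d m)).norm
      simpa using h3
    exact h2.eventually (gt_mem_nhds (by positivity))
  obtain ⟨m, hm, hm'⟩ := exists_slow_sequence h1
  refine key (fun k => u (m k)) (fun k => -d (m k)) v (fun k => hu _) (hup.comp hm) ?_
  have h2 : Tendsto (fun k => d (m k) • (x k - p)) atTop (𝓝 0) := by
    refine squeeze_zero_norm' (hm'.mono fun k hk => hk.le) ?_
    exact tendsto_one_div_add_atTop_nhds_zero_nat.comp hm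
  have h3 := (hv.comp hm).sub h2
  rw [sub_zero] at h3
  refine h3.congr fun k => ?_
  simp only [Function.comp_apply, smul_sub, neg_smul]
  abel

/-- Criterion for condition (b) for an open part of a hypersurface `{f = 0}`. -/
theorem whitneyB_of_hypersurface {f : V → ℂ} {T R : Set V}
    (hT : ∀ᶠ s in 𝓝 0, s ∈ T → ∀ ν, fderiv ℂ f s ν = 0 → ν ∈ tanSp T s)
    (hest : ∀ ε > 0, ∀ᶠ q : V × V in 𝓝 (0, 0), q.1 ∈ T → q.2 ∈ R →
      ∃ a, ‖a‖ ≤ 1 ∧ fderiv ℂ f q.1 a ≠ 0 ∧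
        ‖fderiv ℂ f q.1 (q.1 - q.2)‖ ≤ ε * ‖fderiv ℂ f q.1 a‖ * ‖q.1 - q.2‖) :
    WhitneyB T R 0 := by
  intro x y c v hx hy hx0 hy0 hv
  refine exists_tendsto_of_infDist (fun ε hε => ?_) hv
  obtain ⟨B, hB⟩ : ∃ B > 0, ∀ᶠ k in atTop, ‖c k • (x k - y k)‖ < B :=
    ⟨‖v‖ + 1, by positivity, hv.norm.eventually (gt_mem_nhds (lt_add_one _))⟩
  filter_upwards [(hx0.prodMk_nhds hy0).eventually (hest (ε / B) (div_pos hε hB.1)),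
    hx0.eventually hT, hB.2, hx, hy] with k h1 h2 h3 hxk hyk
  obtain ⟨a, ha, ha0, hle⟩ := h1 hxk hyk
  set f' := fderiv ℂ f (x k)
  refine ⟨c k • (x k - y k) - (f' (c k • (x k - y k)) / f' a) • a, h2 hxk _ ?_, ?_⟩
  · rw [map_sub, map_smul f' (_ / _), smul_eq_mul, div_mul_cancel₀ _ ha0, sub_self]
  · rw [sub_sub_cancel, norm_smul, norm_div]
    have h4 : ‖f' (c k • (x k - y k))‖ ≤ (ε / B) * ‖f' a‖ * ‖c k • (x k - y k)‖ := by
      rw [map_smul, norm_smul, norm_smul]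
      calc ‖c k‖ * ‖f' (x k - y k)‖ ≤ ‖c k‖ * ((ε / B) * ‖f' a‖ * ‖x k - y k‖) := by gcongr
        _ = _ := by ring
    have h5 : 0 < ‖f' a‖ := norm_pos_iff.mpr ha0
    calc ‖f' (c k • (x k - y k))‖ / ‖f' a‖ * ‖a‖
        ≤ ‖f' (c k • (x k - y k))‖ / ‖f' a‖ * 1 := by gcongr
      _ ≤ ε := by
        rw [mul_one, div_le_iff₀ h5]
        refine h4.trans ?_
        calc (ε / B) * ‖f' a‖ * ‖c k • (x k - y k)‖ ≤ (ε / B) * ‖f' a‖ * B := by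
              have := hB.1
              gcongr
          _ = _ := by have := hB.1.ne'; field_simp

theorem exists_norm_le_one_of_ne_zero {f' : V →L[ℂ] ℂ} (h : f' ≠ 0) :
    ∃ a, ‖a‖ ≤ 1 ∧ f' a ≠ 0 := by
  obtain ⟨a, ha⟩ : ∃ a, f' a ≠ 0 := by
    by_contra! hcon
    exact h (ContinuousLinearMap.ext hcon)
  have h0 : (‖a‖ : ℂ) ≠ 0 := by
    have : a ≠ 0 := by rintro rfl; simp at ha
    exact_mod_cast norm_ne_zero_iff.mpr this
  refine ⟨(‖a‖ : ℂ)⁻¹ • a, ?_, by simp [ha, h0]⟩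
  rw [norm_smul, norm_inv, Complex.norm_real, norm_norm]
  exact inv_mul_le_one

theorem IsLocParam.whitneyB [FiniteDimensional ℂ V] [FiniteDimensional ℂ E] {ψ : V → E}
    {Y T R : Set E} {p : E} (h : IsLocParam ψ Y p) (hTY : T ⊆ Y) (hRY : R ⊆ Y)
    (hV : WhitneyB (ψ ⁻¹' T) (ψ ⁻¹' R) 0) : WhitneyB T R p := by
  intro x y c v hx hy hxp hyp hv
  obtain ⟨π, π', hπ, hπp, hinv⟩ := h.exists_leftInverse
  have hpi : ∀ {x : ℕ → E}, Tendsto x atTop (𝓝 p) → Tendsto (fun k => π (x k)) atTop (𝓝 0) := by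
    intro x hx
    have := hπ.continuousAt.tendsto.comp hx
    rwa [hπp] at this
  have hxi : ∀ᶠ k in atTop, ψ (π (x k)) = x k :=
    (tendsto_nhdsWithin_iff.mpr ⟨hxp, hx.mono fun k hk => hTY hk⟩).eventually hinv
  have hyi : ∀ᶠ k in atTop, ψ (π (y k)) = y k :=
    (tendsto_nhdsWithin_iff.mpr ⟨hyp, hy.mono fun k hk => hRY hk⟩).eventually hinv
  have hc := tendsto_smul_sub_of_hasStrictFDerivAt hπ hxp hyp hv
  obtain ⟨w, hw, hwv⟩ := hV (fun k => π (x k)) (fun k => π (y k)) c (π' v)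
    (by filter_upwards [hx, hxi] with k h1 h2; simpa [h2] using h1)
    (by filter_upwards [hy, hyi] with k h1 h2; simpa [h2] using h1) (hpi hxp) (hpi hyp) hc
  have hdiff : ∀ᶠ s in 𝓝 (0 : V), DifferentiableAt ℂ ψ s :=
    (h.smooth.eventually (by simp)).mono fun s hs => hs.differentiableAt one_ne_zero
  have hv' : fderiv ℂ ψ 0 (π' v) = v := by
    have h1 := tendsto_smul_sub_of_hasStrictFDerivAt
      (h.smooth.hasStrictFDerivAt one_ne_zero) (hpi hxp) (hpi hyp) hc
    refine tendsto_nhds_unique h1 (hv.congr' ?_)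
    filter_upwards [hxi, hyi] with k h2 h3
    rw [h2, h3]
  refine ⟨fun k => fderiv ℂ ψ (π (x k)) (w k), ?_, ?_⟩
  · filter_upwards [hw, hxi, (hpi hxp).eventually hdiff] with k h1 h2 h3
    have := map_mem_tanSp h3 h1
    rwa [h2] at this
  · have h1 : ContinuousAt (fderiv ℂ ψ) 0 :=
      (h.smooth.fderiv_right (m := 0) (by simp)).continuousAt
    have h2 : Tendsto (fun k => fderiv ℂ ψ (π (x k))) atTop (𝓝 (fderiv ℂ ψ 0)) :=
      h1.tendsto.comp (hpi hxp)
    have h3 := ((isBoundedBilinearMap_apply (𝕜 := ℂ) (E := V) (F := E)).continuous.tendsto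
      (fderiv ℂ ψ 0, π' v)).comp (h2.prodMk_nhds hwv)
    rw [← hv']
    exact h3

/-- Condition (b) holds if both strata lie in a manifold in which the first one is open. -/
theorem IsLocParam.whitneyB_of_isOpen [FiniteDimensional ℂ V] [FiniteDimensional ℂ E]
    {ψ : V → E} {M O R : Set E} {p : E} (h : IsLocParam ψ M p) (hO : IsOpen O) (hR : R ⊆ M) :
    WhitneyB (M ∩ O) R p := by
  refine h.whitneyB Set.inter_subset_left hR ?_
  intro x y c v hx hy hx0 hy0 hv
  refine ⟨_, ?_, hv⟩
  have h1 : ∀ᶠ s in 𝓝 (0 : V), ∀ᶠ s' in 𝓝 s, ψ s' ∈ M := h.eventually_mem.eventually_nhds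
  have h2 : ∀ᶠ s in 𝓝 (0 : V), ContinuousAt ψ s :=
    (h.smooth.eventually (by simp)).mono fun s hs => hs.continuousAt
  filter_upwards [hx0.eventually h1, hx0.eventually h2, hx] with k h3 h4 h5
  have hopen : ∀ᶠ s in 𝓝 (x k), s ∈ ψ ⁻¹' (M ∩ O) := by
    filter_upwards [h3, h4.preimage_mem_nhds (hO.mem_nhds h5.2)] with s h6 h7
    exact ⟨h6, h7⟩
  set ν := c k • (x k - y k)
  have h6 : Tendsto (fun m : ℕ => x k + ((m : ℂ) + 1)⁻¹ • ν) atTop (𝓝 (x k)) := by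
    have : Tendsto (fun m : ℕ => ((m : ℂ) + 1)⁻¹) atTop (𝓝 0) := by
      simpa using tendsto_one_div_add_atTop_nhds_zero_nat (𝕜 := ℂ)
    simpa using (this.smul_const ν).const_add (x k)
  refine tanSp_of_eventually (c := fun m : ℕ => (m : ℂ) + 1) h5 (h6.eventually hopen) h6 ?_
  refine tendsto_const_nhds.congr fun m => ?_
  have : (m : ℂ) + 1 ≠ 0 := by exact_mod_cast m.succ_ne_zero
  simp [smul_smul, this]

theorem whitneyB_of_finite {T R : Set E} {p : E} (hT : T.Finite) (h : p ∈ T → R ⊆ T) :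
    WhitneyB T R p := by
  intro x y c v hx hy hxp hyp hv
  have key : ∀ x : ℕ → E, (∀ᶠ k in atTop, x k ∈ T) → Tendsto x atTop (𝓝 p) →
      ∀ᶠ k in atTop, x k = p := by
    intro x hx hxp
    have h1 : (T \ {p})ᶜ ∈ 𝓝 p := (hT.subset Set.sdiff_subset).isClosed.isOpen_compl.mem_nhds
      (by simp)
    filter_upwards [hxp h1, hx] with k h2 h3
    by_contra h4
    exact h2 ⟨h3, h4⟩
  have h1 := key x hx hxp
  have hpT : p ∈ T := by
    obtain ⟨k, h2, h3⟩ := (h1.and hx).exists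
    exact h2 ▸ h3
  have h2 := key y (hy.mono fun k hk => h hpT hk) hyp
  have hv0 : v = 0 := by
    refine tendsto_nhds_unique hv (tendsto_const_nhds.congr' ?_)
    filter_upwards [h1, h2] with k h3 h4
    simp [h3, h4]
  subst hv0
  exact ⟨fun _ => 0, hx.mono fun k hk => zero_mem_tanSp hk, tendsto_const_nhds⟩

end WhitneyB

section Estimates

variable {A B C : (Fin 3 → ℂ) → ℂ}

theorem fderiv_mul_apply {g h : (Fin 3 → ℂ) → ℂ} {s : Fin 3 → ℂ} (hg : DifferentiableAt ℂ g s)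
    (hh : DifferentiableAt ℂ h s) (v : Fin 3 → ℂ) :
    fderiv ℂ (fun s => g s * h s) s v = fderiv ℂ g s v * h s + g s * fderiv ℂ h s v := by
  rw [fderiv_fun_mul hg hh]
  simp
  ring

theorem fderiv_coord_sq (i : Fin 3) (s v : Fin 3 → ℂ) :
    fderiv ℂ (fun s : Fin 3 → ℂ => s i ^ 2) s v = 2 * s i * v i := by
  have h : HasFDerivAt (fun s : Fin 3 → ℂ => s i)
      (ContinuousLinearMap.proj (R := ℂ) (φ := fun _ : Fin 3 => ℂ) i) s :=
    hasFDerivAt_apply i s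
  rw [(h.pow 2).fderiv]
  simp

theorem fderiv_coord (i : Fin 3) (s v : Fin 3 → ℂ) :
    fderiv ℂ (fun s : Fin 3 → ℂ => s i) s v = v i := by
  have h : HasFDerivAt (fun s : Fin 3 → ℂ => s i)
      (ContinuousLinearMap.proj (R := ℂ) (φ := fun _ : Fin 3 => ℂ) i) s :=
    hasFDerivAt_apply i s
  rw [h.fderiv]
  simp

/-- A uniform bound for the differential of a continuously differentiable function. -/
theorem exists_fderiv_bound (hA : ContDiff ℂ 1 A) :
    ∃ K > 0, ∀ᶠ s in 𝓝 0, ∀ v, ‖fderiv ℂ A s v‖ ≤ K * ‖v‖ := by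
  refine ⟨‖fderiv ℂ A 0‖ + 1, by positivity, ?_⟩
  have h1 : Continuous (fun s => ‖fderiv ℂ A s‖) := (hA.continuous_fderiv one_ne_zero).norm
  filter_upwards [h1.continuousAt.eventually (gt_mem_nhds (lt_add_one _))] with s hs v
  exact ((fderiv ℂ A s).le_opNorm v).trans (by gcongr)

theorem exists_norm_bounds (hA : ContDiff ℂ 1 A) (h0 : A 0 ≠ 0) :
    ∃ α > 0, ∃ β > 0, ∀ᶠ s in 𝓝 0, α ≤ ‖A s‖ ∧ ‖A s‖ ≤ β := by
  have h1 : 0 < ‖A 0‖ := norm_pos_iff.mpr h0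
  refine ⟨‖A 0‖ / 2, by positivity, ‖A 0‖ + 1, by positivity, ?_⟩
  have h2 := hA.continuous.norm.continuousAt (x := 0)
  filter_upwards [h2.eventually (lt_mem_nhds (half_lt_self h1)),
    h2.eventually (gt_mem_nhds (lt_add_one _))] with s h3 h4
  exact ⟨h3.le, h4.le⟩

theorem eventually_norm_le {δ : ℝ} (hδ : 0 < δ) : ∀ᶠ s in 𝓝 (0 : Fin 3 → ℂ), ‖s‖ ≤ δ := by
  filter_upwards [Metric.ball_mem_nhds (0 : Fin 3 → ℂ) hδ] with s hs
  exact (mem_ball_zero_iff.mp hs).le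

/-- The estimate behind condition (b) along the double curve `{s 0 = s 1 = 0}`. -/
theorem estimate_double (hA : ContDiff ℂ 1 A) (hB : ContDiff ℂ 1 B) (hA0 : A 0 ≠ 0)
    (hB0 : B 0 ≠ 0) {f : (Fin 3 → ℂ) → ℂ} (hf : f = fun s => A s * s 1 ^ 2 + B s * s 0 ^ 2)
    {ε : ℝ} (hε : 0 < ε) :
    ∀ᶠ s in 𝓝 (0 : Fin 3 → ℂ), f s = 0 → fderiv ℂ f s ≠ 0 → ∀ t : Fin 3 → ℂ, t 0 = 0 → t 1 = 0 →
      ∃ a, ‖a‖ ≤ 1 ∧ fderiv ℂ f s a ≠ 0 ∧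
        ‖fderiv ℂ f s (s - t)‖ ≤ ε * ‖fderiv ℂ f s a‖ * ‖s - t‖ := by
  have hd : ∀ s v, fderiv ℂ f s v = fderiv ℂ A s v * s 1 ^ 2 + A s * (2 * s 1 * v 1) +
      (fderiv ℂ B s v * s 0 ^ 2 + B s * (2 * s 0 * v 0)) := by
    intro s v
    have h1 := (hA.differentiable one_ne_zero) s
    have h2 := (hB.differentiable one_ne_zero) s
    rw [hf, fderiv_fun_add (by fun_prop) (by fun_prop), add_apply,
      fderiv_mul_apply h1 (by fun_prop), fderiv_mul_apply h2 (by fun_prop), fderiv_coord_sq,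
      fderiv_coord_sq]
  obtain ⟨K, hK, hK'⟩ := exists_fderiv_bound hA
  obtain ⟨L, hL, hL'⟩ := exists_fderiv_bound hB
  obtain ⟨α, hα, _, _, hA'⟩ := exists_norm_bounds hA hA0
  obtain ⟨β, hβ, _, _, hB'⟩ := exists_norm_bounds hB hB0
  have key : ∀ (s t : Fin 3 → ℂ) (i : Fin 3) (γ : ℝ) (D : ℂ), 0 < γ → f s = 0 → t 0 = 0 → t 1 = 0 →
      (∀ v, ‖fderiv ℂ A s v‖ ≤ K * ‖v‖) → (∀ v, ‖fderiv ℂ B s v‖ ≤ L * ‖v‖) →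
      ‖s 0‖ ≤ ‖s i‖ → ‖s 1‖ ≤ ‖s i‖ → s i ≠ 0 → γ ≤ ‖D‖ → (K + L) * ‖s i‖ ≤ γ →
      (K + L) * ‖s i‖ ≤ ε * γ →
      fderiv ℂ f s (Pi.single i 1) = fderiv ℂ A s (Pi.single i 1) * s 1 ^ 2 +
        fderiv ℂ B s (Pi.single i 1) * s 0 ^ 2 + 2 * D * s i →
      ∃ a, ‖a‖ ≤ 1 ∧ fderiv ℂ f s a ≠ 0 ∧
        ‖fderiv ℂ f s (s - t)‖ ≤ ε * ‖fderiv ℂ f s a‖ * ‖s - t‖ := by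
    intro s t i γ D hγ hs ht0 ht1 hAK hBL hi0 hi1 hsi hD hsm hsm' he
    have hsi' : 0 < ‖s i‖ := norm_pos_iff.mpr hsi
    have hbound : ∀ v, ‖fderiv ℂ A s v * s 1 ^ 2 + fderiv ℂ B s v * s 0 ^ 2‖ ≤
        (K + L) * ‖s i‖ ^ 2 * ‖v‖ := by
      intro v
      refine (norm_add_le _ _).trans ?_
      rw [norm_mul, norm_mul, norm_pow, norm_pow]
      calc _ ≤ (K * ‖v‖) * ‖s i‖ ^ 2 + (L * ‖v‖) * ‖s i‖ ^ 2 := by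
            gcongr
            · exact hAK v
            · exact hBL v
        _ = _ := by ring
    have h1 : γ * ‖s i‖ ≤ ‖fderiv ℂ f s (Pi.single i 1)‖ := by
      rw [he]
      have h2 := hbound (Pi.single i 1)
      rw [Pi.norm_single, norm_one, mul_one] at h2
      have h3 := norm_sub_le_norm_add (2 * D * s i)
        (fderiv ℂ A s (Pi.single i 1) * s 1 ^ 2 + fderiv ℂ B s (Pi.single i 1) * s 0 ^ 2)
      rw [add_comm (2 * D * s i), norm_mul, norm_mul, Complex.norm_ofNat] at h3
      nlinarith
    refine ⟨Pi.single i 1, by rw [Pi.norm_single, norm_one], ?_, ?_⟩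
    · rw [← norm_pos_iff]
      exact lt_of_lt_of_le (by positivity) h1
    · have h2 : fderiv ℂ f s (s - t) =
          fderiv ℂ A s (s - t) * s 1 ^ 2 + fderiv ℂ B s (s - t) * s 0 ^ 2 := by
        have h3 : A s * s 1 ^ 2 + B s * s 0 ^ 2 = 0 := by rw [hf] at hs; exact hs
        rw [hd, Pi.sub_apply, Pi.sub_apply, ht0, ht1]
        linear_combination 2 * h3
      rw [h2]
      refine (hbound _).trans ?_
      have h3 : (K + L) * ‖s i‖ ^ 2 ≤ ε * ‖fderiv ℂ f s (Pi.single i 1)‖ := by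
        calc (K + L) * ‖s i‖ ^ 2 = ((K + L) * ‖s i‖) * ‖s i‖ := by ring
          _ ≤ (ε * γ) * ‖s i‖ := by gcongr
          _ = ε * (γ * ‖s i‖) := by ring
          _ ≤ _ := by gcongr
      gcongr
  filter_upwards [hK', hL', hA', hB', eventually_norm_le (δ := α / (K + L)) (by positivity),
    eventually_norm_le (δ := β / (K + L)) (by positivity),
    eventually_norm_le (δ := ε * α / (K + L)) (by positivity),
    eventually_norm_le (δ := ε * β / (K + L)) (by positivity)]
    with s h1 h2 h3 h4 h5 h6 h7 h8 hs hnd t ht0 ht1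
  rw [le_div_iff₀ (by positivity), mul_comm] at h5 h6 h7 h8
  have hle : ∀ i, (K + L) * ‖s i‖ ≤ (K + L) * ‖s‖ := fun i => by
    gcongr
    exact norm_le_pi_norm s i
  have hne : s 0 ≠ 0 ∨ s 1 ≠ 0 := by
    by_contra! hcon
    refine hnd (ContinuousLinearMap.ext fun v => ?_)
    rw [hd, hcon.1, hcon.2]
    simp
  rcases le_total ‖s 1‖ ‖s 0‖ with h | h
  · refine key s t 0 β (B s) hβ hs ht0 ht1 h1 h2 le_rfl h ?_ h4.1 ((hle 0).trans h6)
      ((hle 0).trans h8) ?_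
    · rintro h0
      rw [h0, norm_zero, norm_le_zero_iff] at h
      exact hne.elim (fun h' => h' h0) (fun h' => h' h)
    · rw [hd]
      simp
      ring
  · refine key s t 1 α (A s) hα hs ht0 ht1 h1 h2 h le_rfl ?_ h3.1 ((hle 1).trans h5)
      ((hle 1).trans h7) ?_
    · rintro h0
      rw [h0, norm_zero, norm_le_zero_iff] at h
      exact hne.elim (fun h' => h' h) (fun h' => h' h0)
    · rw [hd]
      simp
      ring

theorem norm_bound_of_smul_pow {ε : ℝ} {f' : (Fin 3 → ℂ) →L[ℂ] ℂ} {s : Fin 3 → ℂ}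
    (hf' : f' ≠ 0) (h : f' s = 0) (hε : 0 < ε) :
    ∃ a, ‖a‖ ≤ 1 ∧ f' a ≠ 0 ∧ ‖f' s‖ ≤ ε * ‖f' a‖ * ‖s‖ := by
  obtain ⟨a, ha, ha'⟩ := exists_norm_le_one_of_ne_zero hf'
  exact ⟨a, ha, ha', by rw [h, norm_zero]; positivity⟩

/-- The estimate behind condition (b) at a point where the double curve meets the residual
quadratic cone. -/
theorem estimate_pinch (hA : ContDiff ℂ 1 A) (hB : ContDiff ℂ 1 B) (hA0 : A 0 ≠ 0)
    (hB0 : B 0 ≠ 0) {f : (Fin 3 → ℂ) → ℂ}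
    (hf : f = fun s => A s * (s 1 ^ 2 * s 2) + B s * s 0 ^ 2) {ε : ℝ} (hε : 0 < ε) :
    ∀ᶠ s in 𝓝 (0 : Fin 3 → ℂ), f s = 0 → fderiv ℂ f s ≠ 0 →
      ∃ a, ‖a‖ ≤ 1 ∧ fderiv ℂ f s a ≠ 0 ∧
        ‖fderiv ℂ f s s‖ ≤ ε * ‖fderiv ℂ f s a‖ * ‖s‖ := by
  have hd : ∀ s v, fderiv ℂ f s v = fderiv ℂ A s v * (s 1 ^ 2 * s 2) +
      A s * (2 * s 1 * v 1 * s 2 + s 1 ^ 2 * v 2) +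
      (fderiv ℂ B s v * s 0 ^ 2 + B s * (2 * s 0 * v 0)) := by
    intro s v
    have h1 := (hA.differentiable one_ne_zero) s
    have h2 := (hB.differentiable one_ne_zero) s
    rw [hf, fderiv_fun_add (by fun_prop) (by fun_prop), add_apply,
      fderiv_mul_apply h1 (by fun_prop), fderiv_mul_apply h2 (by fun_prop),
      fderiv_mul_apply (by fun_prop) (by fun_prop), fderiv_coord_sq,
      fderiv_coord_sq, fderiv_coord]
  obtain ⟨K, hK, hK'⟩ := exists_fderiv_bound hA
  obtain ⟨L, hL, hL'⟩ := exists_fderiv_bound hB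
  obtain ⟨α, hα, _, _, hA'⟩ := exists_norm_bounds hA hA0
  obtain ⟨β, hβ, β', hβ', hB'⟩ := exists_norm_bounds hB hB0
  obtain ⟨αs, hαs, α', hα', hA''⟩ := exists_norm_bounds hA hA0
  set M : ℝ := K * (β' / α) + L with hM
  have hM0 : 0 < M := by positivity
  filter_upwards [hK', hL', hA', hB', hA'', eventually_norm_le (δ := β / M) (by positivity),
    eventually_norm_le (δ := 1) one_pos,
    eventually_norm_le (δ := (ε * β / (M + β')) ^ 2 / (α' / β)) (by positivity)]
    with s h1 h2 h3 h4 h3' h5 h6 h7 hs hnd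
  rw [le_div_iff₀ (by positivity), mul_comm] at h5 h7
  have hX : A s * (s 1 ^ 2 * s 2) = - (B s * s 0 ^ 2) := by
    rw [hf] at hs
    exact eq_neg_of_add_eq_zero_left hs
  have hXn : ‖A s‖ * ‖s 1 ^ 2 * s 2‖ = ‖B s‖ * ‖s 0‖ ^ 2 := by
    have := congrArg norm hX
    simpa [norm_mul] using this
  have h8 : ‖s 1 ^ 2 * s 2‖ ≤ β' / α * ‖s 0‖ ^ 2 := by
    rw [div_mul_eq_mul_div, le_div_iff₀ hα]
    calc ‖s 1 ^ 2 * s 2‖ * α ≤ ‖s 1 ^ 2 * s 2‖ * ‖A s‖ := by gcongr; exact h3.1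
      _ = ‖B s‖ * ‖s 0‖ ^ 2 := by rw [← hXn]; ring
      _ ≤ β' * ‖s 0‖ ^ 2 := by gcongr; exact h4.2
  have hbound : ∀ v, ‖fderiv ℂ A s v * (s 1 ^ 2 * s 2) + fderiv ℂ B s v * s 0 ^ 2‖ ≤
      M * ‖s 0‖ ^ 2 * ‖v‖ := by
    intro v
    refine (norm_add_le _ _).trans ?_
    rw [norm_mul, norm_mul (fderiv ℂ B s v), norm_pow]
    calc _ ≤ (K * ‖v‖) * (β' / α * ‖s 0‖ ^ 2) + (L * ‖v‖) * ‖s 0‖ ^ 2 := by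
          gcongr
          · exact h1 v
          · exact h2 v
      _ = _ := by rw [hM]; ring
  have hds : fderiv ℂ f s s =
      (fderiv ℂ A s s * (s 1 ^ 2 * s 2) + fderiv ℂ B s s * s 0 ^ 2) + -(B s * s 0 ^ 2) := by
    rw [hd]
    linear_combination 3 * hX
  by_cases hs0 : s 0 = 0
  · refine norm_bound_of_smul_pow hnd ?_ hε
    have h9 := hbound s
    have h10 : M * ‖s 0‖ ^ 2 * ‖s‖ = 0 := by simp [hs0]
    rw [h10, norm_le_zero_iff] at h9
    rw [hds, h9, hs0]
    simp
  have hs0' : 0 < ‖s 0‖ := norm_pos_iff.mpr hs0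
  have hle : ∀ i, ‖s i‖ ≤ ‖s‖ := fun i => norm_le_pi_norm s i
  have h9 : β * ‖s 0‖ ≤ ‖fderiv ℂ f s (Pi.single 0 1)‖ := by
    have he : fderiv ℂ f s (Pi.single 0 1) = (fderiv ℂ A s (Pi.single 0 1) * (s 1 ^ 2 * s 2) +
        fderiv ℂ B s (Pi.single 0 1) * s 0 ^ 2) + 2 * B s * s 0 := by
      rw [hd]
      simp
      ring
    rw [he]
    have h10 := hbound (Pi.single 0 1)
    rw [Pi.norm_single, norm_one, mul_one] at h10
    have h11 := norm_sub_le_norm_add (2 * B s * s 0) (fderiv ℂ A s (Pi.single 0 1) *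
      (s 1 ^ 2 * s 2) + fderiv ℂ B s (Pi.single 0 1) * s 0 ^ 2)
    rw [add_comm (2 * B s * s 0), norm_mul, norm_mul, Complex.norm_ofNat] at h11
    have h12 : M * ‖s 0‖ ≤ β := (by gcongr; exact hle 0 : M * ‖s 0‖ ≤ M * ‖s‖).trans h5
    nlinarith [h4.1]
  refine ⟨Pi.single 0 1, by rw [Pi.norm_single, norm_one], ?_, ?_⟩
  · rw [← norm_pos_iff]
    exact lt_of_lt_of_le (by positivity) h9
  have h10 : (M + β') * ‖s 0‖ ≤ ε * β * ‖s‖ := by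
    have h11 : ‖s 0‖ ^ 2 ≤ α' / β * ‖s‖ ^ 3 := by
      rw [div_mul_eq_mul_div, le_div_iff₀ hβ]
      calc ‖s 0‖ ^ 2 * β ≤ ‖s 0‖ ^ 2 * ‖B s‖ := by gcongr; exact h4.1
        _ = ‖A s‖ * ‖s 1 ^ 2 * s 2‖ := by rw [hXn]; ring
        _ = ‖A s‖ * (‖s 1‖ ^ 2 * ‖s 2‖) := by rw [norm_mul, norm_pow]
        _ ≤ α' * (‖s‖ ^ 2 * ‖s‖) := by
          gcongr
          · exact h3'.2
          · exact hle 1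
          · exact hle 2
        _ = _ := by ring
    have h12 : ‖s 0‖ ^ 2 ≤ (ε * β / (M + β') * ‖s‖) ^ 2 := by
      calc ‖s 0‖ ^ 2 ≤ (α' / β * ‖s‖) * ‖s‖ ^ 2 := by rw [pow_succ] at h11; linarith
        _ ≤ (ε * β / (M + β')) ^ 2 * ‖s‖ ^ 2 := by gcongr
        _ = _ := by ring
    have h13 := (pow_le_pow_iff_left₀ hs0'.le (by positivity) two_ne_zero).mp h12
    rw [div_mul_eq_mul_div, le_div_iff₀ (by positivity)] at h13
    linarith
  rw [hds]
  calc _ ≤ M * ‖s 0‖ ^ 2 * ‖s‖ + ‖B s‖ * ‖s 0‖ ^ 2 := by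
        refine (norm_add_le _ _).trans ?_
        rw [norm_neg, norm_mul (B s), norm_pow]
        gcongr
        exact hbound s
    _ ≤ M * ‖s 0‖ ^ 2 * 1 + β' * ‖s 0‖ ^ 2 := by
        gcongr
        exact h4.2
    _ = ((M + β') * ‖s 0‖) * ‖s 0‖ := by ring
    _ ≤ (ε * β * ‖s‖) * ‖s 0‖ := by gcongr
    _ = ε * (β * ‖s 0‖) * ‖s‖ := by ring
    _ ≤ _ := by gcongr

/-- The estimate behind condition (b) at a triple point. -/
theorem estimate_triple (hA : ContDiff ℂ 1 A) (hB : ContDiff ℂ 1 B) (hC : ContDiff ℂ 1 C)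
    (hA0 : A 0 ≠ 0) (hB0 : B 0 ≠ 0) (hC0 : C 0 ≠ 0) {f : (Fin 3 → ℂ) → ℂ}
    (hf : f = fun s => A s * (s 1 ^ 2 * s 2 ^ 2) + B s * (s 0 ^ 2 * s 2 ^ 2) +
      C s * (s 0 ^ 2 * s 1 ^ 2)) {ε : ℝ} (hε : 0 < ε) :
    ∀ᶠ s in 𝓝 (0 : Fin 3 → ℂ), f s = 0 → fderiv ℂ f s ≠ 0 →
      ∃ a, ‖a‖ ≤ 1 ∧ fderiv ℂ f s a ≠ 0 ∧
        ‖fderiv ℂ f s s‖ ≤ ε * ‖fderiv ℂ f s a‖ * ‖s‖ := by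
  have hd : ∀ s v, fderiv ℂ f s v = (fderiv ℂ A s v * (s 1 ^ 2 * s 2 ^ 2) +
      fderiv ℂ B s v * (s 0 ^ 2 * s 2 ^ 2) + fderiv ℂ C s v * (s 0 ^ 2 * s 1 ^ 2)) +
      (A s * (2 * s 1 * v 1 * s 2 ^ 2 + s 1 ^ 2 * (2 * s 2 * v 2)) +
      B s * (2 * s 0 * v 0 * s 2 ^ 2 + s 0 ^ 2 * (2 * s 2 * v 2)) +
      C s * (2 * s 0 * v 0 * s 1 ^ 2 + s 0 ^ 2 * (2 * s 1 * v 1))) := by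
    intro s v
    have h1 := (hA.differentiable one_ne_zero) s
    have h2 := (hB.differentiable one_ne_zero) s
    have h3 := (hC.differentiable one_ne_zero) s
    rw [hf, fderiv_fun_add (by fun_prop) (by fun_prop), add_apply,
      fderiv_fun_add (by fun_prop) (by fun_prop), add_apply,
      fderiv_mul_apply h1 (by fun_prop), fderiv_mul_apply h2 (by fun_prop),
      fderiv_mul_apply h3 (by fun_prop),
      fderiv_mul_apply (by fun_prop) (by fun_prop), fderiv_mul_apply (by fun_prop) (by fun_prop),
      fderiv_mul_apply (by fun_prop) (by fun_prop), fderiv_coord_sq,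
      fderiv_coord_sq, fderiv_coord_sq]
    ring
  obtain ⟨K, hK, hK'⟩ := exists_fderiv_bound hA
  obtain ⟨L, hL, hL'⟩ := exists_fderiv_bound hB
  obtain ⟨N, hN, hN'⟩ := exists_fderiv_bound hC
  obtain ⟨α, hα, _, _, hA'⟩ := exists_norm_bounds hA hA0
  obtain ⟨β, hβ, _, _, hB'⟩ := exists_norm_bounds hB hB0
  obtain ⟨γ, hγ, _, _, hC'⟩ := exists_norm_bounds hC hC0
  set J : ℝ := K / α + L / β + N / γ with hJ
  have hJ0 : 0 < J := by positivity
  filter_upwards [hK', hL', hN', hA', hB', hC', eventually_norm_le (δ := 1 / J) (by positivity),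
    eventually_norm_le (δ := ε / J) (by positivity)]
    with s hK hL hN hA' hB' hC' h5 h6 hs hnd
  rw [le_div_iff₀ (by positivity), mul_comm] at h5 h6
  set X := A s * (s 1 ^ 2 * s 2 ^ 2) with hX
  set Y := B s * (s 0 ^ 2 * s 2 ^ 2) with hY
  set Z := C s * (s 0 ^ 2 * s 1 ^ 2) with hZ
  have hsum : X + Y + Z = 0 := by rw [hf] at hs; exact hs
  have hterm : ∀ (D : (Fin 3 → ℂ) →L[ℂ] ℂ) (a m : ℂ) (k b M : ℝ) (v : Fin 3 → ℂ), 0 < b → b ≤ ‖a‖ →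
      ‖D v‖ ≤ k * ‖v‖ → ‖a * m‖ ≤ M → ‖D v * m‖ ≤ k / b * M * ‖v‖ := by
    intro D a m k b M v hb hba hD hM
    rw [norm_mul] at hM ⊢
    have h1 : b * ‖m‖ ≤ M := (by gcongr : b * ‖m‖ ≤ ‖a‖ * ‖m‖).trans hM
    calc ‖D v‖ * ‖m‖ ≤ (k * ‖v‖) * ‖m‖ := by gcongr
      _ = (k * ‖v‖) / b * (b * ‖m‖) := by field_simp
      _ ≤ (k * ‖v‖) / b * M := by
          have : 0 ≤ k * ‖v‖ := (norm_nonneg _).trans hD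
          gcongr
      _ = _ := by ring
  have key : ∀ (i : Fin 3) (M : ℝ) (W : ℂ), M = ‖W‖ → ‖X‖ ≤ M → ‖Y‖ ≤ M → ‖Z‖ ≤ M →
      s i * fderiv ℂ f s (Pi.single i 1) = s i * (fderiv ℂ A s (Pi.single i 1) *
        (s 1 ^ 2 * s 2 ^ 2) + fderiv ℂ B s (Pi.single i 1) * (s 0 ^ 2 * s 2 ^ 2) +
        fderiv ℂ C s (Pi.single i 1) * (s 0 ^ 2 * s 1 ^ 2)) + -2 * W →
      ∃ a, ‖a‖ ≤ 1 ∧ fderiv ℂ f s a ≠ 0 ∧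
        ‖fderiv ℂ f s s‖ ≤ ε * ‖fderiv ℂ f s a‖ * ‖s‖ := by
    intro i M W hMW hXM hYM hZM he
    have hbound : ∀ v, ‖fderiv ℂ A s v * (s 1 ^ 2 * s 2 ^ 2) +
        fderiv ℂ B s v * (s 0 ^ 2 * s 2 ^ 2) + fderiv ℂ C s v * (s 0 ^ 2 * s 1 ^ 2)‖ ≤
        J * M * ‖v‖ := by
      intro v
      refine (norm_add₃_le).trans ?_
      have h1 := hterm (fderiv ℂ A s) (A s) _ K α M v hα hA'.1 (hK v) hXM
      have h2 := hterm (fderiv ℂ B s) (B s) _ L β M v hβ hB'.1 (hL v) hYM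
      have h3 := hterm (fderiv ℂ C s) (C s) _ N γ M v hγ hC'.1 (hN v) hZM
      rw [hJ]
      linarith
    have hM0 : 0 ≤ M := hMW ▸ norm_nonneg _
    have hds : fderiv ℂ f s s = fderiv ℂ A s s * (s 1 ^ 2 * s 2 ^ 2) +
        fderiv ℂ B s s * (s 0 ^ 2 * s 2 ^ 2) + fderiv ℂ C s s * (s 0 ^ 2 * s 1 ^ 2) := by
      rw [hd]
      linear_combination 4 * hsum
    have hdsb : ‖fderiv ℂ f s s‖ ≤ J * M * ‖s‖ := by
      rw [hds]
      exact hbound s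
    rcases hM0.eq_or_lt with hM0 | hM0
    · refine norm_bound_of_smul_pow hnd ?_ hε
      rw [← hM0, mul_zero, zero_mul, norm_le_zero_iff] at hdsb
      exact hdsb
    have h1 : M ≤ ‖s‖ * ‖fderiv ℂ f s (Pi.single i 1)‖ := by
      have h2 := hbound (Pi.single i 1)
      rw [Pi.norm_single, norm_one, mul_one] at h2
      have h3 := norm_sub_le_norm_add (-2 * W) (s i * (fderiv ℂ A s (Pi.single i 1) *
        (s 1 ^ 2 * s 2 ^ 2) + fderiv ℂ B s (Pi.single i 1) * (s 0 ^ 2 * s 2 ^ 2) +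
        fderiv ℂ C s (Pi.single i 1) * (s 0 ^ 2 * s 1 ^ 2)))
      rw [add_comm (-2 * W), ← he, norm_mul, norm_neg, Complex.norm_ofNat, norm_mul (s i),
        norm_mul (s i), ← hMW] at h3
      have h4 : ‖s i‖ ≤ ‖s‖ := norm_le_pi_norm s i
      have h7 : ‖s i‖ * (J * M) ≤ M := by
        calc ‖s i‖ * (J * M) ≤ ‖s‖ * (J * M) := by gcongr
          _ = (J * ‖s‖) * M := by ring
          _ ≤ 1 * M := by gcongr
          _ = M := one_mul M
      have h8 : ‖s i‖ * ‖fderiv ℂ A s (Pi.single i 1) *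
        (s 1 ^ 2 * s 2 ^ 2) + fderiv ℂ B s (Pi.single i 1) * (s 0 ^ 2 * s 2 ^ 2) +
        fderiv ℂ C s (Pi.single i 1) * (s 0 ^ 2 * s 1 ^ 2)‖ ≤ ‖s i‖ * (J * M) := by gcongr
      have h9 : ‖s i‖ * ‖fderiv ℂ f s (Pi.single i 1)‖ ≤
        ‖s‖ * ‖fderiv ℂ f s (Pi.single i 1)‖ := by gcongr
      linarith
    refine ⟨Pi.single i 1, by rw [Pi.norm_single, norm_one], ?_, ?_⟩
    · intro h0
      rw [h0, norm_zero, mul_zero] at h1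
      exact absurd hM0 h1.not_gt
    · calc _ ≤ J * M * ‖s‖ := hdsb
        _ ≤ J * (‖s‖ * ‖fderiv ℂ f s (Pi.single i 1)‖) * ‖s‖ := by gcongr
        _ = (J * ‖s‖) * ‖fderiv ℂ f s (Pi.single i 1)‖ * ‖s‖ := by ring
        _ ≤ _ := by gcongr
  have k0 := fun M hM h1 h2 h3 => key 0 M X hM h1 h2 h3 (by
    rw [hd]
    simp
    linear_combination 2 * hsum)
  have k1 := fun M hM h1 h2 h3 => key 1 M Y hM h1 h2 h3 (by
    rw [hd]
    simp
    linear_combination 2 * hsum)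
  have k2 := fun M hM h1 h2 h3 => key 2 M Z hM h1 h2 h3 (by
    rw [hd]
    simp
    linear_combination 2 * hsum)
  rcases le_total ‖X‖ ‖Y‖ with h | h
  · rcases le_total ‖Y‖ ‖Z‖ with h' | h'
    · exact k2 _ rfl (h.trans h') h' le_rfl
    · exact k1 _ rfl h le_rfl h'
  · rcases le_total ‖X‖ ‖Z‖ with h' | h'
    · exact k2 _ rfl h' (h.trans h') le_rfl
    · exact k0 _ rfl le_rfl h h'

end Estimates

/-! The topology of `(ℙ²)ⁿ` in homogeneous coordinates. -/

theorem mkP_of_ne_zero {v : Fin 3 → ℂ} (hv : v ≠ 0) : mkP v = Projectivization.mk ℂ v hv :=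
  dif_pos hv

theorem mkP_eq_mkP_iff {v w : Fin 3 → ℂ} (hv : v ≠ 0) (hw : w ≠ 0) :
    mkP v = mkP w ↔ ∃ c : ℂ, c ≠ 0 ∧ w = c • v := by
  rw [mkP_of_ne_zero hv, mkP_of_ne_zero hw, Projectivization.mk_eq_mk_iff']
  constructor
  · rintro ⟨a, ha⟩
    have ha0 : a ≠ 0 := by
      rintro rfl
      exact hv (by rw [← ha, zero_smul])
    exact ⟨a⁻¹, inv_ne_zero ha0, by rw [← ha, smul_smul, inv_mul_cancel₀ ha0, one_smul]⟩
  · rintro ⟨c, hc, rfl⟩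
    exact ⟨c⁻¹, by rw [smul_smul, inv_mul_cancel₀ hc, one_smul]⟩

theorem exists_mkP_eq (P : P2) : ∃ v, v ≠ 0 ∧ mkP v = P :=
  ⟨P.rep, P.rep_nonzero, by rw [mkP_of_ne_zero P.rep_nonzero, Projectivization.mk_rep]⟩

theorem map_mkP_nhds {v : Fin 3 → ℂ} (hv : v ≠ 0) : map mkP (𝓝 v) = 𝓝 (mkP v) := by
  let q : {u : Fin 3 → ℂ // u ≠ 0} → P2 :=
    @Quotient.mk _ (projectivizationSetoid ℂ (Fin 3 → ℂ))
  have hq : ∀ u : {u : Fin 3 → ℂ // u ≠ 0}, q u = mkP u.1 := fun u =>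
    (mkP_of_ne_zero u.2).symm
  have hcont : Continuous q := continuous_quot_mk
  have hne : IsOpen {u : Fin 3 → ℂ | u ≠ 0} := isOpen_compl_singleton
  apply le_antisymm
  · intro U hU
    have h1 : q ⁻¹' U ∈ 𝓝 (⟨v, hv⟩ : {u : Fin 3 → ℂ // u ≠ 0}) :=
      hcont.continuousAt (by rwa [hq])
    have h2 := (hne.isOpenEmbedding_subtypeVal.image_mem_nhds (x := ⟨v, hv⟩)).mpr h1
    refine mem_map.mpr (mem_of_superset h2 ?_)
    rintro _ ⟨u, hu, rfl⟩
    have : q u ∈ U := hu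
    rwa [hq] at this
  · intro U hU
    obtain ⟨O, hO, hOo, hvO⟩ := mem_nhds_iff.mp (mem_map.mp hU)
    have h1 : IsOpen (mkP '' (O ∩ {u | u ≠ 0})) := by
      have h2 : IsOpen (q ⁻¹' (mkP '' (O ∩ {u | u ≠ 0}))) := by
        have : q ⁻¹' (mkP '' (O ∩ {u | u ≠ 0})) =
            ⋃ c : {c : ℂ // c ≠ 0}, (fun u : {u : Fin 3 → ℂ // u ≠ 0} => c.1 • u.1) ⁻¹' O := by
          ext u
          simp only [Set.mem_preimage, Set.mem_image, Set.mem_iUnion, hq]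
          constructor
          · rintro ⟨w, ⟨hwO, hw⟩, hwu⟩
            obtain ⟨c, hc, rfl⟩ := (mkP_eq_mkP_iff u.2 hw).mp hwu.symm
            exact ⟨⟨c, hc⟩, hwO⟩
          · rintro ⟨c, hc⟩
            exact ⟨c.1 • u.1, ⟨hc, smul_ne_zero c.2 u.2⟩,
              ((mkP_eq_mkP_iff u.2 (smul_ne_zero c.2 u.2)).mpr ⟨c.1, c.2, rfl⟩).symm⟩
        rw [this]
        exact isOpen_iUnion fun c => hOo.preimage (continuous_subtype_val.const_smul c.1)
      exact h2
    refine mem_of_superset (h1.mem_nhds ⟨v, ⟨hvO, hv⟩, rfl⟩) ?_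
    rintro _ ⟨u, ⟨hu, -⟩, rfl⟩
    exact hO hu

section Charts

variable {n : ℕ}

/-- The point of `(ℙ²)ⁿ` with homogeneous coordinates `w` relative to the charts `C`. -/
def pt (C : Fin n → Matrix (Fin 3) (Fin 3) ℂ) (w : Fin n → Fin 3 → ℂ) : Fin n → P2 :=
  fun l => mkP ((C l).mulVec (w l))

variable {C : Fin n → Matrix (Fin 3) (Fin 3) ℂ}

theorem inv_mulVec_mulVec {M : Matrix (Fin 3) (Fin 3) ℂ} (hM : IsUnit M.det) (v : Fin 3 → ℂ) :
    M⁻¹.mulVec (M.mulVec v) = v := by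
  rw [Matrix.mulVec_mulVec, Matrix.nonsing_inv_mul _ hM, Matrix.one_mulVec]

theorem mulVec_inv_mulVec {M : Matrix (Fin 3) (Fin 3) ℂ} (hM : IsUnit M.det) (v : Fin 3 → ℂ) :
    M.mulVec (M⁻¹.mulVec v) = v := by
  rw [Matrix.mulVec_mulVec, Matrix.mul_nonsing_inv _ hM, Matrix.one_mulVec]

theorem mulVec_ne_zero {M : Matrix (Fin 3) (Fin 3) ℂ} (hM : IsUnit M.det) {v : Fin 3 → ℂ}
    (hv : v ≠ 0) : M.mulVec v ≠ 0 := fun h =>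
  hv (by rw [← inv_mulVec_mulVec hM v, h, Matrix.mulVec_zero])

theorem continuous_mulVec {r s : ℕ} (M : Matrix (Fin r) (Fin s) ℂ) : Continuous M.mulVec :=
  (Matrix.toLin' M).continuous_of_finiteDimensional

theorem map_mulVec_nhds {M : Matrix (Fin 3) (Fin 3) ℂ} (hM : IsUnit M.det) (v : Fin 3 → ℂ) :
    map M.mulVec (𝓝 v) = 𝓝 (M.mulVec v) := by
  apply le_antisymm
  · exact (continuous_mulVec M).continuousAt
  · have h1 : map M⁻¹.mulVec (𝓝 (M.mulVec v)) ≤ 𝓝 v := by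
      have := (continuous_mulVec M⁻¹).continuousAt (x := M.mulVec v)
      rwa [ContinuousAt, inv_mulVec_mulVec hM] at this
    calc 𝓝 (M.mulVec v) = map M.mulVec (map M⁻¹.mulVec (𝓝 (M.mulVec v))) := by
          rw [map_map]
          conv_lhs => rw [← map_id (f := 𝓝 (M.mulVec v))]
          congr 1
          funext u
          exact (mulVec_inv_mulVec hM u).symm
      _ ≤ _ := map_mono h1

theorem map_pt_nhds (hC : ∀ l, IsUnit (C l).det) {w : Fin n → Fin 3 → ℂ} (hw : ∀ l, w l ≠ 0) :
    map (pt C) (𝓝 w) = 𝓝 (pt C w) := by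
  have hs : ∀ l, Function.Surjective fun v : Fin 3 → ℂ => mkP ((C l).mulVec v) := by
    intro l P
    obtain ⟨v, -, rfl⟩ := exists_mkP_eq P
    exact ⟨(C l)⁻¹.mulVec v, by simp only [mulVec_inv_mulVec (hC l)]⟩
  have h := map_piMap_pi (f := fun l (v : Fin 3 → ℂ) => mkP ((C l).mulVec v))
    (.of_forall hs) (fun l => 𝓝 (w l))
  rw [nhds_pi, nhds_pi]
  refine (h.trans ?_ : map (Pi.map _) _ = _)
  congr 1
  funext l
  rw [pt, ← map_mkP_nhds (mulVec_ne_zero (hC l) (hw l)), ← map_mulVec_nhds (hC l), map_map]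
  rfl

theorem exists_pt_eq (hC : ∀ l, IsUnit (C l).det) (P : Fin n → P2) :
    ∃ w : Fin n → Fin 3 → ℂ, (∀ l, w l ≠ 0) ∧ pt C w = P := by
  choose v hv hvP using fun l => exists_mkP_eq (P l)
  refine ⟨fun l => (C l)⁻¹.mulVec (v l), fun l h => hv l ?_, funext fun l => ?_⟩
  · rw [← mulVec_inv_mulVec (hC l) (v l)]
    exact (congrArg _ h).trans (Matrix.mulVec_zero _)
  · rw [pt, mulVec_inv_mulVec (hC l), hvP]

theorem mkP_mulVec_eq_iff {M : Matrix (Fin 3) (Fin 3) ℂ} (hM : IsUnit M.det)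
    {v w : Fin 3 → ℂ} (hv : v ≠ 0) (hw : w ≠ 0) :
    mkP (M.mulVec v) = mkP (M.mulVec w) ↔ ∃ c : ℂ, c ≠ 0 ∧ w = c • v := by
  rw [mkP_eq_mkP_iff (mulVec_ne_zero hM hv) (mulVec_ne_zero hM hw)]
  refine exists_congr fun c => and_congr_right fun _ => ⟨fun h => ?_, fun h => ?_⟩
  · rw [← inv_mulVec_mulVec hM w, h, Matrix.mulVec_smul, inv_mulVec_mulVec hM]
  · rw [h, Matrix.mulVec_smul]

theorem pt_eq_pt_iff (hC : ∀ l, IsUnit (C l).det) {v w : Fin n → Fin 3 → ℂ}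
    (hv : ∀ l, v l ≠ 0) (hw : ∀ l, w l ≠ 0) :
    pt C v = pt C w ↔ ∀ l, ∃ c : ℂ, c ≠ 0 ∧ w l = c • v l := by
  rw [funext_iff]
  exact forall_congr' fun l => mkP_mulVec_eq_iff (hC l) (hv l) (hw l)

theorem eventually_nhds_pt (hC : ∀ l, IsUnit (C l).det) {w : Fin n → Fin 3 → ℂ}
    (hw : ∀ l, w l ≠ 0) {p : (Fin n → P2) → Prop} :
    (∀ᶠ Q in 𝓝 (pt C w), p Q) ↔ ∀ᶠ v in 𝓝 w, p (pt C v) := by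
  rw [← map_pt_nhds hC hw, eventually_map]

theorem frequently_nhds_pt (hC : ∀ l, IsUnit (C l).det) {w : Fin n → Fin 3 → ℂ}
    (hw : ∀ l, w l ≠ 0) {p : (Fin n → P2) → Prop} :
    (∃ᶠ Q in 𝓝 (pt C w), p Q) ↔ ∃ᶠ v in 𝓝 w, p (pt C v) := by
  rw [← map_pt_nhds hC hw, frequently_map]

theorem eventually_forall_ne_zero {w : Fin n → Fin 3 → ℂ} (hw : ∀ l, w l ≠ 0) :
    ∀ᶠ v in 𝓝 w, ∀ l, v l ≠ 0 :=
  eventually_all.mpr fun l => (continuous_apply l).continuousAt.eventually_ne (hw l)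

/-- A set of points is closed if it is given by a closed condition on nonzero homogeneous
coordinates. -/
theorem isClosed_of_pt (hC : ∀ l, IsUnit (C l).det) {Z : Set (Fin n → P2)}
    {K : Set (Fin n → Fin 3 → ℂ)} (hK : IsClosed K)
    (h : ∀ w, (∀ l, w l ≠ 0) → (pt C w ∈ Z ↔ w ∈ K)) : IsClosed Z := by
  rw [← isOpen_compl_iff, isOpen_iff_mem_nhds]
  intro P hP
  obtain ⟨w, hw, rfl⟩ := exists_pt_eq hC P
  refine (eventually_nhds_pt hC hw (p := fun Q => Q ∈ Zᶜ)).mpr ?_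
  filter_upwards [eventually_forall_ne_zero hw,
    hK.isOpen_compl.mem_nhds fun hk => hP ((h w hw).mpr hk)] with v hv hvK hvZ
  exact hvK ((h v hv).mp hvZ)

theorem insertNth_one_ne_zero (m : Fin 3) (z : Fin 2 → ℂ) :
    (Fin.insertNth m (1 : ℂ) z : Fin 3 → ℂ) ≠ 0 := by
  intro h
  have := congrFun h m
  simp at this

theorem stdChart_injective (j : Fin n → Fin 3) : Function.Injective (stdChart j) := by
  intro x y hxy
  funext l
  obtain ⟨c, -, hc⟩ := (mkP_eq_mkP_iff (insertNth_one_ne_zero _ _)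
    (insertNth_one_ne_zero _ _)).mp (congrFun hxy l)
  have h1 := congrFun hc (j l)
  simp only [Fin.insertNth_apply_same, Pi.smul_apply, smul_eq_mul, mul_one] at h1
  funext k
  have h2 := congrFun hc ((j l).succAbove k)
  simp only [Fin.insertNth_apply_succAbove, Pi.smul_apply, smul_eq_mul, ← h1, one_mul] at h2
  exact h2.symm

theorem mkP_eq_insertNth {v : Fin 3 → ℂ} (m : Fin 3) (hm : v m ≠ 0) :
    mkP v = mkP (Fin.insertNth m (1 : ℂ) fun k => v (m.succAbove k) / v m) := by
  refine (mkP_eq_mkP_iff (fun h => hm (congrFun h m)) (insertNth_one_ne_zero _ _)).mpr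
    ⟨(v m)⁻¹, inv_ne_zero hm, funext fun k => ?_⟩
  refine Fin.succAboveCases m ?_ (fun k => ?_) k
  · simp [inv_mul_cancel₀ hm]
  · simp [div_eq_inv_mul]

theorem exists_stdChart_eq (P : Fin n → P2) : ∃ j x, stdChart j x = P := by
  choose v hv hvP using fun l => exists_mkP_eq (P l)
  choose j hj using fun l => Function.ne_iff.mp (hv l)
  exact ⟨j, fun l k => v l ((j l).succAbove k) / v l (j l), funext fun l => by
    rw [stdChart, ← mkP_eq_insertNth (j l) (hj l), hvP]⟩

theorem continuous_stdChart (j : Fin n → Fin 3) : Continuous (stdChart j) := by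
  refine continuous_pi fun l => continuous_iff_continuousAt.mpr fun x => ?_
  have h1 : ContinuousAt mkP (Fin.insertNth (j l) (1 : ℂ) (x l) : Fin 3 → ℂ) :=
    (map_mkP_nhds (insertNth_one_ne_zero _ _)).le
  have h2 : Continuous fun x : Fin n → Fin 2 → ℂ =>
      (Fin.insertNth (j l) (1 : ℂ) (x l) : Fin 3 → ℂ) :=
    continuous_pi fun k => Fin.succAboveCases (j l) (by simpa using continuous_const)
      (fun k => by simpa using by fun_prop) k
  exact ContinuousAt.comp (f := fun x : Fin n → Fin 2 → ℂ =>
      (Fin.insertNth (j l) (1 : ℂ) (x l) : Fin 3 → ℂ)) h1 h2.continuousAt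

end Charts

/-! Points of the multiview variety in homogeneous coordinates. -/

section Multiview

variable {n : ℕ}

/-- Proportionality of coordinate vectors, as a closed condition. -/
def Par (w v : Fin 3 → ℂ) : Prop := ∀ a b, w a * v b = w b * v a

theorem par_iff {w v : Fin 3 → ℂ} (hw : w ≠ 0) : Par w v ↔ ∃ c : ℂ, v = c • w := by
  constructor
  · intro h
    obtain ⟨a, ha⟩ := Function.ne_iff.mp hw
    refine ⟨v a / w a, funext fun b => ?_⟩
    have := h a b
    simp only [Pi.zero_apply, ne_eq, Pi.smul_apply, smul_eq_mul] at *
    field_simp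
    linear_combination this
  · rintro ⟨c, rfl⟩ a b
    simp only [Pi.smul_apply, smul_eq_mul]
    ring

theorem par_smul (w : Fin 3 → ℂ) (c : ℂ) : Par w (c • w) := by
  intro a b
  simp only [Pi.smul_apply, smul_eq_mul]
  ring

theorem Par.const_smul {w v : Fin 3 → ℂ} (h : Par w v) (c : ℂ) : Par w (c • v) := by
  intro a b
  simp only [Pi.smul_apply, smul_eq_mul]
  linear_combination c * h a b

/-- The point `y` of `ℂ⁴` is seen by the cameras `B` at the image points `w`, wherever its
image is defined. -/
def Incident (B : Fin n → Matrix (Fin 3) (Fin 4) ℂ) (w : Fin n → Fin 3 → ℂ)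
    (y : Fin 4 → ℂ) : Prop :=
  ∀ l, Par (w l) ((B l).mulVec y)

/-- The position conditions on cameras (in the coordinates of the affine charts) under which
the divisors at infinity meet as expected. -/
structure GenPos (B : Fin n → Matrix (Fin 3) (Fin 4) ℂ) : Prop where
  four : ∀ i j k l, i ≠ j → i ≠ k → i ≠ l → j ≠ k → j ≠ l → k ≠ l → ∀ y,
    (B i).mulVec y 0 = 0 → (B j).mulVec y 0 = 0 → (B k).mulVec y 0 = 0 →
    (B l).mulVec y 0 = 0 → y = 0
  center : ∀ i j, i ≠ j → ∀ y, (B i).mulVec y 0 = 0 → (B j).mulVec y = 0 → y = 0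
  quad : ∀ i j, i ≠ j → ∀ ε ε' : ℂ, ε ^ 2 = -1 → ε' ^ 2 = -1 → ∀ y,
    (B i).mulVec y 0 = 0 → (B j).mulVec y 0 = 0 →
    (B i).mulVec y 1 + ε * (B i).mulVec y 2 = 0 →
    (B j).mulVec y 1 + ε' * (B j).mulVec y 2 = 0 → y = 0
  triple : ∀ i j k, i ≠ j → i ≠ k → j ≠ k → ∀ ε : ℂ, ε ^ 2 = -1 → ∀ y,
    (B i).mulVec y 0 = 0 → (B j).mulVec y 0 = 0 → (B k).mulVec y 0 = 0 →
    (B i).mulVec y 1 + ε * (B i).mulVec y 2 = 0 → y = 0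
  fiber : ∀ w : Fin n → Fin 3 → ℂ, (∀ l, w l ≠ 0) → ∀ y y', y ≠ 0 →
    Incident B w y → Incident B w y' → ∃ c : ℂ, y' = c • y

variable {B : Fin n → Matrix (Fin 3) (Fin 4) ℂ}

theorem Incident.smul {w : Fin n → Fin 3 → ℂ} {y : Fin 4 → ℂ} (h : Incident B w y) (c : ℂ) :
    Incident B w (c • y) := fun l => by
  rw [Matrix.mulVec_smul]
  exact (h l).const_smul c

theorem incident_self (y : Fin 4 → ℂ) : Incident B (fun l => (B l).mulVec y) y :=
  fun _ _ _ => mul_comm _ _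

theorem isClosed_setOf_incident (B : Fin n → Matrix (Fin 3) (Fin 4) ℂ) {K : Set (Fin 4 → ℂ)}
    (hK : IsClosed K) : IsClosed {w | ∃ y ∈ K, ‖y‖ = 1 ∧ Incident B w y} := by
  have hcpt : CompactSpace (Metric.sphere (0 : Fin 4 → ℂ) 1) :=
    isCompact_iff_compactSpace.mp (isCompact_sphere _ _)
  have hcl : IsClosed {q : (Fin n → Fin 3 → ℂ) × Metric.sphere (0 : Fin 4 → ℂ) 1 |
      q.2.1 ∈ K ∧ Incident B q.1 q.2.1} := by
    refine (hK.preimage (by fun_prop)).inter ?_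
    have : {q : (Fin n → Fin 3 → ℂ) × Metric.sphere (0 : Fin 4 → ℂ) 1 |
        Incident B q.1 q.2.1} = ⋂ l, ⋂ a, ⋂ b, {q | q.1 l a * (B l).mulVec q.2.1 b =
          q.1 l b * (B l).mulVec q.2.1 a} := by
      ext q
      simp [Incident, Par]
    change IsClosed {q : (Fin n → Fin 3 → ℂ) × Metric.sphere (0 : Fin 4 → ℂ) 1 |
        Incident B q.1 q.2.1}
    rw [this]
    refine isClosed_iInter fun l => isClosed_iInter fun a => isClosed_iInter fun b => ?_
    have hB : ∀ a, Continuous fun q : (Fin n → Fin 3 → ℂ) × Metric.sphere (0 : Fin 4 → ℂ) 1 =>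
        (B l).mulVec q.2.1 a := fun a =>
      (continuous_apply a).comp ((continuous_mulVec (B l)).comp
        (continuous_subtype_val.comp continuous_snd))
    have hw : ∀ a, Continuous fun q : (Fin n → Fin 3 → ℂ) × Metric.sphere (0 : Fin 4 → ℂ) 1 =>
        q.1 l a := fun a => by fun_prop
    exact isClosed_eq ((hw a).mul (hB b)) ((hw b).mul (hB a))
  convert isClosedMap_fst_of_compactSpace _ hcl using 1
  ext w
  constructor
  · rintro ⟨y, h1, h2, h3⟩
    exact ⟨(w, ⟨y, mem_sphere_zero_iff_norm.mpr h2⟩), ⟨h1, h3⟩, rfl⟩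
  · rintro ⟨⟨w, y⟩, ⟨h1, h3⟩, rfl⟩
    exact ⟨y.1, h1, mem_sphere_zero_iff_norm.mp y.2, h3⟩

theorem exists_norm_one_of_incident {K : Set (Fin 4 → ℂ)}
    (hK : ∀ c : ℂ, c ≠ 0 → ∀ y ∈ K, c • y ∈ K) {w : Fin n → Fin 3 → ℂ} {y : Fin 4 → ℂ}
    (hy : y ≠ 0) (hyK : y ∈ K) (h : Incident B w y) : ∃ y ∈ K, ‖y‖ = 1 ∧ Incident B w y := by
  have h0 : (‖y‖ : ℂ)⁻¹ ≠ 0 := inv_ne_zero (by exact_mod_cast norm_ne_zero_iff.mpr hy)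
  refine ⟨(‖y‖ : ℂ)⁻¹ • y, hK _ h0 _ hyK, ?_, h.smul _⟩
  rw [norm_smul, norm_inv, Complex.norm_real, norm_norm,
    inv_mul_cancel₀ (norm_ne_zero_iff.mpr hy)]

theorem GenPos.eventually_incident (hB : GenPos B) {O : Set (Fin 4 → ℂ)} (hO : IsOpen O)
    (hc : ∀ c : ℂ, c ≠ 0 → ∀ y ∈ O, c • y ∈ O) {w : Fin n → Fin 3 → ℂ} (hw : ∀ l, w l ≠ 0)
    {y₀ : Fin 4 → ℂ} (hy₀ : y₀ ≠ 0) (hi : Incident B w y₀) (hyO : y₀ ∈ O) :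
    ∀ᶠ v in 𝓝 w, ∀ y, y ≠ 0 → Incident B v y → y ∈ O := by
  have hcl := isClosed_setOf_incident B hO.isClosed_compl
  have hn : w ∉ {w | ∃ y ∈ Oᶜ, ‖y‖ = 1 ∧ Incident B w y} := by
    rintro ⟨y, hy, hy1, hyi⟩
    obtain ⟨c, rfl⟩ := hB.fiber w hw y₀ y hy₀ hi hyi
    refine hy (hc c ?_ _ hyO)
    rintro rfl
    simp at hy1
  filter_upwards [hcl.isOpen_compl.mem_nhds hn] with v hv y hy hyi
  by_contra hyO'
  refine hv (exists_norm_one_of_incident (K := Oᶜ)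
    (fun c hc0 z hz hzO => hz ?_) hy hyO' hyi)
  have := hc c⁻¹ (inv_ne_zero hc0) _ hzO
  rwa [smul_smul, inv_mul_cancel₀ hc0, one_smul] at this

theorem GenPos.exists_preimage (hB : GenPos B) {i j : Fin n} (hij : i ≠ j) (t : ℂ)
    (v : Fin 3 → ℂ) : ∃ y, (B i).mulVec y 0 = t ∧ (B j).mulVec y = v := by
  let L : (Fin 4 → ℂ) →ₗ[ℂ] (Fin 4 → ℂ) :=
    LinearMap.pi (Fin.cons ((LinearMap.proj 0).comp (B i).mulVecLin)
      fun k => (LinearMap.proj k).comp (B j).mulVecLin)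
  have h0 : ∀ y, L y 0 = (B i).mulVec y 0 := fun y => rfl
  have hs : ∀ y k, L y (Fin.succ k) = (B j).mulVec y k := fun y k => rfl
  have hinj : Function.Injective L := by
    rw [← LinearMap.ker_eq_bot, LinearMap.ker_eq_bot']
    intro y hy
    exact hB.center i j hij y (by rw [← h0, hy]; rfl) (funext fun k => by rw [← hs, hy]; rfl)
  obtain ⟨y, hy⟩ := LinearMap.injective_iff_surjective.mp hinj (Fin.cons t v)
  exact ⟨y, by rw [← h0, hy]; rfl, funext fun k => by rw [← hs, hy]; rfl⟩

variable {A : Fin n → Matrix (Fin 3) (Fin 4) ℂ} {C : Fin n → Matrix (Fin 3) (Fin 3) ℂ}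

theorem pt_mem_mvImage (hC : ∀ l, IsUnit (C l).det) (hA : ∀ l, A l = C l * B l)
    {y : Fin 4 → ℂ} (hy : ∀ l, (B l).mulVec y ≠ 0) (hy0 : y ≠ 0) :
    pt C (fun l => (B l).mulVec y) ∈ mvImage A := by
  refine ⟨y, hy0, fun l => ?_, fun l => ?_⟩
  · rw [hA, ← Matrix.mulVec_mulVec]
    exact mulVec_ne_zero (hC l) (hy l)
  · rw [hA, ← Matrix.mulVec_mulVec]
    rfl

theorem pt_mem_mvVariety_iff (hB : GenPos B) (hC : ∀ l, IsUnit (C l).det)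
    (hA : ∀ l, A l = C l * B l) (hn : 2 ≤ n) {w : Fin n → Fin 3 → ℂ} (hw : ∀ l, w l ≠ 0) :
    pt C w ∈ mvVariety A ↔ ∃ y, y ≠ 0 ∧ Incident B w y := by
  rw [mvVariety, mem_closure_iff_frequently, frequently_nhds_pt hC hw]
  constructor
  · intro h
    have hcl := isClosed_setOf_incident B (isClosed_univ (X := Fin 4 → ℂ))
    have h2 : ∃ᶠ v in 𝓝 w, v ∈ {w | ∃ y ∈ Set.univ, ‖y‖ = 1 ∧ Incident B w y} := by
      refine (h.and_eventually (eventually_forall_ne_zero hw)).mono ?_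
      rintro v ⟨⟨y, hy0, hy, hvy⟩, hv⟩
      refine exists_norm_one_of_incident (K := Set.univ)
        (fun _ _ _ _ => trivial) hy0 trivial fun l => ?_
      have h3 := hvy l
      have hBy : (B l).mulVec y ≠ 0 := fun h0 => hy l (by
        rw [hA, ← Matrix.mulVec_mulVec, h0, Matrix.mulVec_zero])
      rw [hA, ← Matrix.mulVec_mulVec] at h3
      obtain ⟨c, -, hc⟩ := (mkP_mulVec_eq_iff (hC l) (hv l) hBy).mp h3
      rw [hc]
      exact par_smul _ _
    obtain ⟨y, -, hy1, hy⟩ := hcl.mem_of_frequently_of_tendsto h2 tendsto_id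
    refine ⟨y, ?_, hy⟩
    rintro rfl
    simp at hy1
  · rintro ⟨y, hy0, hy⟩
    have hcur : ∃ u : Fin 4 → ℂ, ∀ l, ∃ c : ℂ, (B l).mulVec y ≠ 0 ∧ c ≠ 0 ∧
        (B l).mulVec y = c • w l ∨ (B l).mulVec y = 0 ∧ (B l).mulVec u = w l := by
      have hdef : ∀ l, (B l).mulVec y ≠ 0 → ∃ c : ℂ, (B l).mulVec y ≠ 0 ∧ c ≠ 0 ∧
          (B l).mulVec y = c • w l := by
        intro l hl
        obtain ⟨c, hc⟩ := (par_iff (hw l)).mp (hy l)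
        refine ⟨c, hl, ?_, hc⟩
        rintro rfl
        exact hl (by rw [hc, zero_smul])
      by_cases hz : ∃ i, (B i).mulVec y = 0
      · obtain ⟨i, hi⟩ := hz
        have : Nontrivial (Fin n) := Fin.nontrivial_iff_two_le.mpr hn
        obtain ⟨j, hj⟩ := exists_ne i
        obtain ⟨u, -, hu⟩ := hB.exists_preimage hj 0 (w i)
        refine ⟨u, fun l => ?_⟩
        by_cases hl : l = i
        · subst hl
          exact ⟨0, Or.inr ⟨hi, hu⟩⟩
        · obtain ⟨c, hc⟩ := hdef l fun h0 => hy0 (hB.center l i hl y (by rw [h0]; rfl) hi)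
          exact ⟨c, Or.inl hc⟩
      · push Not at hz
        refine ⟨0, fun l => ?_⟩
        obtain ⟨c, hc⟩ := hdef l (hz l)
        exact ⟨c, Or.inl hc⟩
    obtain ⟨u, hu⟩ := hcur
    choose c hc using hu
    classical
    let v : ℂ → Fin n → Fin 3 → ℂ := fun s l =>
      if (B l).mulVec y = 0 then w l else (c l)⁻¹ • (B l).mulVec (y + s • u)
    have hv : Tendsto v (𝓝[≠] 0) (𝓝 w) := by
      refine (tendsto_pi_nhds.mpr fun l => ?_)
      by_cases hl : (B l).mulVec y = 0
      · simp only [v, hl, if_true]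
        exact tendsto_const_nhds
      · obtain ⟨h1, h2, h3⟩ | ⟨h1, -⟩ := hc l
        · simp only [v, hl, if_false]
          have : Continuous fun s : ℂ => (c l)⁻¹ • (B l).mulVec (y + s • u) :=
            Continuous.const_smul ((continuous_mulVec (B l)).comp
              (by fun_prop : Continuous fun s : ℂ => y + s • u)) (c l)⁻¹
          have h4 := (this.tendsto 0).mono_left (nhdsWithin_le_nhds (s := {0}ᶜ))
          rwa [zero_smul, add_zero, h3, smul_smul, inv_mul_cancel₀ h2, one_smul] at h4
        · exact absurd h1 hl
    refine hv.frequently ((Eventually.frequently ?_).mono fun s hs => hs)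
    have h1 : ∀ᶠ s in 𝓝[≠] (0 : ℂ), ∀ l, v s l ≠ 0 :=
      hv.eventually (eventually_forall_ne_zero hw)
    have h2 : ∀ᶠ s in 𝓝[≠] (0 : ℂ), y + s • u ≠ 0 := by
      have : Tendsto (fun s : ℂ => y + s • u) (𝓝[≠] 0) (𝓝 (y + (0 : ℂ) • u)) :=
        ((by fun_prop : Continuous fun s : ℂ => y + s • u).tendsto 0).mono_left
          nhdsWithin_le_nhds
      exact this.eventually_ne (by simpa using hy0)
    filter_upwards [h1, h2, self_mem_nhdsWithin] with s hs1 hs2 hs0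
    have hs0' : s ≠ 0 := hs0
    have key : ∀ l, ∃ e : ℂ, e ≠ 0 ∧ (B l).mulVec (y + s • u) = e • v s l := by
      intro l
      obtain ⟨h1, h2, h3⟩ | ⟨h1, h2⟩ := hc l
      · refine ⟨c l, h2, ?_⟩
        simp only [v, h1, if_false]
        rw [smul_smul, mul_inv_cancel₀ h2, one_smul]
      · refine ⟨s, hs0', ?_⟩
        simp only [v, h1, if_true]
        rw [Matrix.mulVec_add, h1, zero_add, Matrix.mulVec_smul, h2]
    have hne : ∀ l, (B l).mulVec (y + s • u) ≠ 0 := by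
      intro l
      obtain ⟨e, he, hel⟩ := key l
      rw [hel]
      exact smul_ne_zero he (hs1 l)
    rw [(pt_eq_pt_iff hC hs1 hne).mpr key]
    exact pt_mem_mvImage hC hA hne hs2

theorem pt_mem_infLine_iff (hC : ∀ l, IsUnit (C l).det) {w : Fin n → Fin 3 → ℂ}
    (hw : ∀ l, w l ≠ 0) (i : Fin n) : pt C w i ∈ infLine (C i) ↔ w i 0 = 0 := by
  constructor
  · rintro ⟨v, hv, hv0, h⟩
    obtain ⟨c, hc, hcv⟩ := (mkP_mulVec_eq_iff (hC i) (hw i) hv).mp h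
    rw [hcv] at hv0
    simpa [hc] using hv0
  · intro h
    exact ⟨w i, hw i, h, rfl⟩

theorem pt_mem_Dinf_iff (hC : ∀ l, IsUnit (C l).det) {w : Fin n → Fin 3 → ℂ}
    (hw : ∀ l, w l ≠ 0) (i : Fin n) :
    pt C w ∈ Dinf A C i ↔ pt C w ∈ mvVariety A ∧ w i 0 = 0 := by
  rw [Dinf, Set.mem_inter_iff, Set.mem_ofPred_eq, pt_mem_infLine_iff hC hw]

theorem isClosed_Dinf (hC : ∀ l, IsUnit (C l).det) (i : Fin n) : IsClosed (Dinf A C i) := by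
  refine isClosed_closure.inter (isClosed_of_pt hC (K := {w | w i 0 = 0}) ?_ fun w hw => ?_)
  · exact isClosed_eq (by fun_prop) continuous_const
  · exact pt_mem_infLine_iff hC hw i

end Multiview

/-! The multihomogeneous equation of the hypersurface `H_Q`. -/

section Quadric

variable {n : ℕ}

/-- The quadratic form `(v₁ - b₀ v₀)² + (v₂ - b₁ v₀)²`. -/
def nq (b : Fin 2 → ℂ) (v : Fin 3 → ℂ) : ℂ := (v 1 - b 0 * v 0) ^ 2 + (v 2 - b 1 * v 0) ^ 2

/-- The homogenization of `∑ |zₗ - bₗ|² + β₀` in the factors indexed by `S`. -/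
def gS (b : Fin n → Fin 2 → ℂ) (β₀ : ℂ) (S : Finset (Fin n)) (w : Fin n → Fin 3 → ℂ) : ℂ :=
  ∑ l ∈ S, nq (b l) (w l) * ∏ m ∈ S.erase l, w m 0 ^ 2 + β₀ * ∏ m ∈ S, w m 0 ^ 2

variable {b : Fin n → Fin 2 → ℂ} {β₀ : ℂ} {S : Finset (Fin n)} {w : Fin n → Fin 3 → ℂ}

theorem gS_empty : gS b β₀ ∅ w = β₀ := by simp [gS]

theorem gS_insert {i : Fin n} (hi : i ∉ S) :
    gS b β₀ (insert i S) w = nq (b i) (w i) * ∏ m ∈ S, w m 0 ^ 2 + w i 0 ^ 2 * gS b β₀ S w := by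
  rw [gS, gS, Finset.sum_insert hi, Finset.prod_insert hi, Finset.erase_insert hi]
  have : ∑ l ∈ S, nq (b l) (w l) * ∏ m ∈ (insert i S).erase l, w m 0 ^ 2 =
      ∑ l ∈ S, w i 0 ^ 2 * (nq (b l) (w l) * ∏ m ∈ S.erase l, w m 0 ^ 2) := by
    refine Finset.sum_congr rfl fun l hl => ?_
    have hli : i ≠ l := fun h => hi (h ▸ hl)
    rw [Finset.erase_insert_of_ne hli,
      Finset.prod_insert fun h => hi (Finset.mem_of_mem_erase h)]
    ring
  rw [this, ← Finset.mul_sum]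
  ring

theorem gS_congr {v : Fin n → Fin 3 → ℂ} (h : ∀ l ∈ S, v l = w l) :
    gS b β₀ S v = gS b β₀ S w := by
  induction S using Finset.induction_on with
  | empty => rw [gS_empty, gS_empty]
  | insert i S hi ih =>
    rw [gS_insert hi, gS_insert hi, ih fun l hl => h l (Finset.mem_insert_of_mem hl),
      h i (Finset.mem_insert_self _ _),
      Finset.prod_congr rfl fun m hm => by rw [h m (Finset.mem_insert_of_mem hm)]]

theorem nq_smul (b : Fin 2 → ℂ) (c : ℂ) (v : Fin 3 → ℂ) : nq b (c • v) = c ^ 2 * nq b v := by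
  simp only [nq, Pi.smul_apply, smul_eq_mul]
  ring

theorem gS_smul (c : Fin n → ℂ) :
    gS b β₀ S (fun l => c l • w l) = (∏ l ∈ S, c l ^ 2) * gS b β₀ S w := by
  induction S using Finset.induction_on with
  | empty => simp [gS_empty]
  | insert i S hi ih =>
    rw [gS_insert hi, gS_insert hi, ih, Finset.prod_insert hi, nq_smul]
    simp only [Pi.smul_apply, smul_eq_mul, mul_pow, Finset.prod_mul_distrib]
    ring

theorem gS_eq_of_ne_zero (h : ∀ l ∈ S, w l 0 ≠ 0) :
    gS b β₀ S w = (∏ l ∈ S, w l 0 ^ 2) *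
      (∑ l ∈ S, ((w l 1 / w l 0 - b l 0) ^ 2 + (w l 2 / w l 0 - b l 1) ^ 2) + β₀) := by
  induction S using Finset.induction_on with
  | empty => simp [gS_empty]
  | insert i S hi ih =>
    rw [gS_insert hi, ih fun l hl => h l (Finset.mem_insert_of_mem hl), Finset.prod_insert hi,
      Finset.sum_insert hi, nq]
    have := h i (Finset.mem_insert_self _ _)
    field_simp
    ring

theorem gS_univ_eq (i : Fin n) : gS b β₀ Finset.univ w =
    nq (b i) (w i) * ∏ m ∈ Finset.univ.erase i, w m 0 ^ 2 +
      w i 0 ^ 2 * gS b β₀ (Finset.univ.erase i) w := by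
  rw [← gS_insert (Finset.notMem_erase _ _), Finset.insert_erase (Finset.mem_univ _)]

theorem contDiff_apply_apply' (l : Fin n) (k : Fin 3) :
    ContDiff ℂ 1 fun w : Fin n → Fin 3 → ℂ => w l k :=
  (contDiff_apply ℂ ℂ k).comp (contDiff_apply ℂ (Fin 3 → ℂ) l)

theorem contDiff_gS (b : Fin n → Fin 2 → ℂ) (β₀ : ℂ) (S : Finset (Fin n)) :
    ContDiff ℂ 1 (gS b β₀ S) := by
  have h := contDiff_apply_apply' (n := n)
  refine ContDiff.add (ContDiff.sum fun l _ => ContDiff.mul ?_ (contDiff_prod fun m _ =>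
    (h m 0).pow 2)) (contDiff_const.mul (contDiff_prod fun m _ => (h m 0).pow 2))
  exact (((h l 1).sub (contDiff_const.mul (h l 0))).pow 2).add
    (((h l 2).sub (contDiff_const.mul (h l 0))).pow 2)

theorem nq_of_zero {b : Fin 2 → ℂ} {v : Fin 3 → ℂ} (h : v 0 = 0) :
    nq b v = v 1 ^ 2 + v 2 ^ 2 := by
  rw [nq, h]
  ring

/-! Density of the affine part of the hypersurface. -/

/-- The affine part of the multihomogeneous hypersurface. -/
def affZeros (b : Fin n → Fin 2 → ℂ) (β₀ : ℂ) : Set (Fin n → Fin 3 → ℂ) :=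
  {w | (∀ l, w l 0 ≠ 0) ∧ gS b β₀ Finset.univ w = 0}

theorem mem_closure_affZeros_of_single {i : Fin n} (hwi : w i ≠ 0) (hi : w i 0 = 0)
    (hl : ∀ l, l ≠ i → w l 0 ≠ 0) (hG : gS b β₀ Finset.univ w = 0) :
    w ∈ closure (affZeros b β₀) := by
  have hP : ∏ m ∈ Finset.univ.erase i, w m 0 ^ 2 ≠ 0 :=
    Finset.prod_ne_zero_iff.mpr fun m hm => pow_ne_zero 2 (hl m (Finset.ne_of_mem_erase hm))
  set P := ∏ m ∈ Finset.univ.erase i, w m 0 ^ 2 with hPdef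
  set R := gS b β₀ (Finset.univ.erase i) w with hR
  have hN : w i 1 ^ 2 + w i 2 ^ 2 = 0 := by
    rw [gS_univ_eq i, hi, nq_of_zero hi] at hG
    have h2 := hG
    rw [zero_pow two_ne_zero, zero_mul, add_zero] at h2
    exact (mul_eq_zero.mp h2).resolve_right hP
  have h1 : w i 1 ≠ 0 := by
    intro h1
    have h2 : w i 2 = 0 := by simpa [h1] using hN
    exact hwi (funext fun k => by fin_cases k <;> assumption)
  let s : ℂ → ℂ := fun x => -(x ^ 2 * R) / (4 * w i 1 ^ 2 * P)
  let v : ℂ → Fin n → Fin 3 → ℂ := fun x => Function.update w i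
    ![x, w i 1 + b i 0 * x + s x * w i 1, w i 2 + b i 1 * x - s x * w i 2]
  have hs : Continuous s := by fun_prop
  have hs0 : s 0 = 0 := by simp [s]
  have hv : Tendsto v (𝓝[≠] 0) (𝓝 w) := by
    have hc : Continuous v := by
      refine continuous_const.update i (continuous_pi fun k => ?_)
      fin_cases k
      · exact continuous_id
      · show Continuous fun x => w i 1 + b i 0 * x + s x * w i 1
        fun_prop
      · show Continuous fun x => w i 2 + b i 1 * x - s x * w i 2
        fun_prop
    have h0 : v 0 = w := by
      simp only [v, hs0]
      refine (Function.update_eq_self_iff).mpr ?_ |>.trans rfl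
      funext k
      fin_cases k <;> simp [hi]
    have := (hc.tendsto 0).mono_left (nhdsWithin_le_nhds (s := {0}ᶜ))
    rwa [h0] at this
  refine mem_closure_of_tendsto hv ?_
  filter_upwards [self_mem_nhdsWithin] with x hx
  have hx' : x ≠ 0 := hx
  have hvl : ∀ l, l ≠ i → v x l = w l := fun l hl => Function.update_of_ne hl _ _
  have hvi : v x i = ![x, w i 1 + b i 0 * x + s x * w i 1, w i 2 + b i 1 * x - s x * w i 2] :=
    Function.update_self _ _ _
  refine ⟨fun l => ?_, ?_⟩
  · by_cases h : l = i
    · rw [h, hvi]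
      exact hx'
    · rw [hvl l h]
      exact hl l h
  · rw [gS_univ_eq i, gS_congr fun l hl => hvl l (Finset.ne_of_mem_erase hl),
      Finset.prod_congr rfl fun m hm => by rw [hvl m (Finset.ne_of_mem_erase hm)],
      ← hPdef, ← hR, hvi, nq]
    simp only [Matrix.cons_val_zero, Matrix.cons_val_one, Matrix.cons_val_two, Matrix.head_cons,
      Matrix.tail_cons]
    have hsx : s x * (4 * w i 1 ^ 2 * P) = -(x ^ 2 * R) := by
      simp only [s]
      field_simp
    linear_combination hsx + ((1 + s x ^ 2 - 2 * s x) * P) * hN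

theorem mem_closure_affZeros_of_pair {i j : Fin n} (hij : i ≠ j) (hi : w i 0 = 0)
    (hj : w j 0 = 0) (hNi : w i 1 ^ 2 + w i 2 ^ 2 ≠ 0) (hNj : w j 1 ^ 2 + w j 2 ^ 2 ≠ 0)
    (hl : ∀ l, l ≠ i → l ≠ j → w l 0 ≠ 0) : w ∈ closure (affZeros b β₀) := by
  have hji : j ∈ (Finset.univ.erase i : Finset (Fin n)) :=
    Finset.mem_erase.mpr ⟨hij.symm, Finset.mem_univ _⟩
  set S := (Finset.univ.erase i).erase j with hS
  have hSi : ∀ l ∈ S, l ≠ i := fun l hl => Finset.ne_of_mem_erase (Finset.mem_of_mem_erase hl)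
  have hSj : ∀ l ∈ S, l ≠ j := fun l hl => Finset.ne_of_mem_erase hl
  have hdec : ∀ v, gS b β₀ Finset.univ v = nq (b i) (v i) * (v j 0 ^ 2 * ∏ m ∈ S, v m 0 ^ 2) +
      v i 0 ^ 2 * (nq (b j) (v j) * ∏ m ∈ S, v m 0 ^ 2 + v j 0 ^ 2 * gS b β₀ S v) := by
    intro v
    have hins : insert j S = Finset.univ.erase i := Finset.insert_erase hji
    rw [gS_univ_eq i, ← hins, gS_insert (Finset.notMem_erase _ _),
      Finset.prod_insert (Finset.notMem_erase _ _)]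
  have hP : ∏ m ∈ S, w m 0 ^ 2 ≠ 0 :=
    Finset.prod_ne_zero_iff.mpr fun m hm => pow_ne_zero 2 (hl m (hSi m hm) (hSj m hm))
  set P := ∏ m ∈ S, w m 0 ^ 2 with hPdef
  set R := gS b β₀ S w with hR
  set α := w i 1 ^ 2 + w i 2 ^ 2
  set α' := w j 1 ^ 2 + w j 2 ^ 2
  have hsq : ∀ y : ℂ, ∃ x : ℂ, x ^ 2 = -(α * P * y ^ 2) / (α' * P + y ^ 2 * R) := fun y =>
    IsAlgClosed.exists_pow_nat_eq _ two_pos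
  choose x hx using hsq
  have hd0 : ∀ᶠ y : ℂ in 𝓝[≠] 0, α' * P + y ^ 2 * R ≠ 0 := by
    have h : ContinuousAt (fun y : ℂ => α' * P + y ^ 2 * R) 0 := by fun_prop
    exact (h.eventually_ne (by simp [hNj, hP])).filter_mono nhdsWithin_le_nhds
  have hx0 : Tendsto x (𝓝[≠] 0) (𝓝 0) := by
    have h : ContinuousAt (fun y : ℂ => -(α * P * y ^ 2) / (α' * P + y ^ 2 * R)) 0 :=
      ContinuousAt.div (by fun_prop) (by fun_prop) (by simp [hNj, hP])
    have h2 := (h.tendsto.mono_left (nhdsWithin_le_nhds (s := {0}ᶜ))).norm.sqrt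
    simp only [← hx, norm_pow, Real.sqrt_sq (norm_nonneg _)] at h2
    have hx00 : x 0 = 0 := by simpa using hx 0
    rw [hx00] at h2
    rw [tendsto_zero_iff_norm_tendsto_zero]
    simpa using h2
  let v : ℂ → Fin n → Fin 3 → ℂ := fun y => Function.update (Function.update w i
    ![x y, w i 1 + b i 0 * x y, w i 2 + b i 1 * x y]) j
    ![y, w j 1 + b j 0 * y, w j 2 + b j 1 * y]
  have hvj : ∀ y, v y j = ![y, w j 1 + b j 0 * y, w j 2 + b j 1 * y] := fun y =>
    Function.update_self _ _ _
  have hvi : ∀ y, v y i = ![x y, w i 1 + b i 0 * x y, w i 2 + b i 1 * x y] := fun y => by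
    simp only [v]
    rw [Function.update_of_ne hij, Function.update_self]
  have hvl : ∀ y l, l ≠ i → l ≠ j → v y l = w l := fun y l h1 h2 => by
    simp only [v]
    rw [Function.update_of_ne h2, Function.update_of_ne h1]
  have hy0 : Tendsto (fun y : ℂ => y) (𝓝[≠] 0) (𝓝 0) := nhdsWithin_le_nhds
  have hvec : ∀ (l : Fin n) (z : ℂ → ℂ), w l 0 = 0 → Tendsto z (𝓝[≠] 0) (𝓝 0) →
      Tendsto (fun y => ![z y, w l 1 + b l 0 * z y, w l 2 + b l 1 * z y]) (𝓝[≠] 0)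
        (𝓝 (w l)) := by
    intro l z hl hz
    refine tendsto_pi_nhds.mpr fun k => ?_
    fin_cases k
    · simpa [hl] using hz
    · simpa using (hz.const_mul (b l 0)).const_add (w l 1)
    · simpa using (hz.const_mul (b l 1)).const_add (w l 2)
  have hv : Tendsto v (𝓝[≠] 0) (𝓝 w) := by
    refine tendsto_pi_nhds.mpr fun l => ?_
    by_cases h1 : l = i
    · subst h1
      simp only [hvi]
      exact hvec l x hi hx0
    by_cases h2 : l = j
    · subst h2
      simp only [hvj]
      exact hvec l _ hj hy0
    simp only [hvl _ l h1 h2]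
    exact tendsto_const_nhds
  refine mem_closure_of_tendsto hv ?_
  filter_upwards [self_mem_nhdsWithin, hd0] with y hy hd
  have hy' : y ≠ 0 := hy
  have hxy : x y ≠ 0 := by
    intro h
    have := hx y
    rw [h, zero_pow two_ne_zero, eq_comm, div_eq_zero_iff] at this
    simp [hNi, hP, hy', hd] at this
  refine ⟨fun l => ?_, ?_⟩
  · by_cases h1 : l = i
    · rw [h1, hvi]
      exact hxy
    by_cases h2 : l = j
    · rw [h2, hvj]
      exact hy'
    rw [hvl y l h1 h2]
    exact hl l h1 h2
  · rw [hdec, gS_congr fun l hl => hvl y l (hSi l hl) (hSj l hl),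
      Finset.prod_congr rfl fun m hm => by rw [hvl y m (hSi m hm) (hSj m hm)],
      ← hPdef, ← hR, hvi, hvj, nq, nq]
    simp only [Matrix.cons_val_zero, Matrix.cons_val_one, Matrix.cons_val_two, Matrix.head_cons,
      Matrix.tail_cons]
    have h3 : x y ^ 2 * (α' * P + y ^ 2 * R) = -(α * P * y ^ 2) := by
      rw [hx, div_mul_cancel₀ _ hd]
    simp only [α, α'] at h3
    linear_combination h3

theorem eventually_add_sq_ne_zero {v : Fin 3 → ℂ} (hv : v ≠ 0) (h0 : v 0 = 0) :
    ∀ᶠ τ : ℂ in 𝓝[≠] 0, (v 1 + τ) ^ 2 + v 2 ^ 2 ≠ 0 := by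
  by_cases h : v 1 ^ 2 + v 2 ^ 2 = 0
  · have h1 : v 1 ≠ 0 := by
      intro h1
      have h2 : v 2 = 0 := by simpa [h1] using h
      exact hv (funext fun k => by fin_cases k <;> assumption)
    have hc : ContinuousAt (fun τ : ℂ => 2 * v 1 + τ) 0 := by fun_prop
    filter_upwards [self_mem_nhdsWithin, (hc.eventually_ne (y := 0) (by simpa using h1)).filter_mono
      nhdsWithin_le_nhds] with τ hτ h2 h3
    exact mul_ne_zero (show τ ≠ 0 from hτ) h2 (by linear_combination h3 - h)
  · have hc : ContinuousAt (fun τ : ℂ => (v 1 + τ) ^ 2 + v 2 ^ 2) 0 := by fun_prop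
    exact (hc.eventually_ne (by simpa using h)).filter_mono nhdsWithin_le_nhds

theorem mem_closure_affZeros (hw : ∀ l, w l ≠ 0) (hG : gS b β₀ Finset.univ w = 0) :
    w ∈ closure (affZeros b β₀) := by
  by_cases h0 : ∀ l, w l 0 ≠ 0
  · exact subset_closure ⟨h0, hG⟩
  push Not at h0
  obtain ⟨i, hi⟩ := h0
  by_cases h1 : ∀ l, l ≠ i → w l 0 ≠ 0
  · exact mem_closure_affZeros_of_single (hw i) hi h1 hG
  push Not at h1
  obtain ⟨j, hji, hj⟩ := h1
  let v : ℂ → Fin n → Fin 3 → ℂ := fun τ l =>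
    if l = i ∨ l = j then ![0, w l 1 + τ, w l 2] else
    if w l 0 = 0 then ![τ, w l 1, w l 2] else w l
  have hv : Tendsto v (𝓝[≠] 0) (𝓝 w) := by
    have hc : Continuous v := by
      refine continuous_pi fun l => ?_
      by_cases h : l = i ∨ l = j
      · simp only [v, h, if_true]
        refine continuous_pi fun k => ?_
        fin_cases k
        · exact continuous_const
        · exact (continuous_const.add continuous_id : Continuous fun τ => w l 1 + τ)
        · exact continuous_const
      · by_cases h' : w l 0 = 0
        · simp only [v, h, h', if_true, if_false]
          refine continuous_pi fun k => ?_
          fin_cases k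
          · exact continuous_id
          · exact continuous_const
          · exact continuous_const
        · simp only [v, h, h', if_false]
          exact continuous_const
    have hv0 : v 0 = w := by
      funext l k
      by_cases h : l = i ∨ l = j
      · simp only [v, h, if_true]
        have : w l 0 = 0 := by rcases h with rfl | rfl <;> assumption
        fin_cases k <;> simp [this]
      · by_cases h' : w l 0 = 0
        · simp only [v, h, h', if_true, if_false]
          fin_cases k <;> simp [h']
        · simp only [v, h, h', if_false]
    have := (hc.tendsto 0).mono_left (nhdsWithin_le_nhds (s := {0}ᶜ))
    rwa [hv0] at this
  have hcl : w ∈ closure (closure (affZeros b β₀)) := by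
    refine mem_closure_of_tendsto hv ?_
    filter_upwards [self_mem_nhdsWithin, eventually_add_sq_ne_zero (hw i) hi,
      eventually_add_sq_ne_zero (hw j) hj] with τ hτ h2 h3
    refine mem_closure_affZeros_of_pair hji.symm ?_ ?_ ?_ ?_ fun l h4 h5 => ?_
    · simp [v]
    · simp [v]
    · simp only [v, true_or, if_true]
      exact h2
    · simp only [v, or_true, if_true]
      exact h3
    · by_cases h' : w l 0 = 0
      · simpa [v, h4, h5, h'] using hτ
      · simp [v, h4, h5, h']
  rwa [closure_closure] at hcl

/-! The hypersurface `H_Q` itself. -/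

variable {C : Fin n → Matrix (Fin 3) (Fin 3) ℂ}

/-- The affine coordinates of the base point of the quadric, grouped by factor. -/
def bOf (β : Fin (2 * n + 1) → ℂ) : Fin n → Fin 2 → ℂ :=
  fun l k => β (Fin.succ ⟨2 * l.1 + k.1, by have := l.2; have := k.2; omega⟩)

theorem sum_fin_two_mul (f : Fin (2 * n) → ℂ) : ∑ i, f i = ∑ l : Fin n, ∑ k : Fin 2,
    f ⟨2 * l.1 + k.1, by have := l.2; have := k.2; omega⟩ := by
  rw [← Fintype.sum_prod_type' (f := fun (l : Fin n) (k : Fin 2) =>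
    f ⟨2 * l.1 + k.1, by have := l.2; have := k.2; omega⟩)]
  refine (Fintype.sum_equiv (finProdFinEquiv.trans (finCongr (mul_comm n 2))) _ _
    fun p => ?_).symm
  congr 1
  ext
  simp [finProdFinEquiv, add_comm]

theorem gS_affLift (β : Fin (2 * n + 1) → ℂ) (z : Fin (2 * n) → ℂ) :
    gS (bOf β) (β 0) Finset.univ (fun l => affLift (camCoord n z l)) =
      ∑ i, (z i - β i.succ) ^ 2 + β 0 := by
  rw [gS_eq_of_ne_zero fun l _ => by simp [affLift], sum_fin_two_mul]
  simp only [affLift, Fin.cons_zero, one_pow, Finset.prod_const_one, one_mul, div_one,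
    Fin.sum_univ_two]
  rfl

theorem chartMapN_eq_pt (z : Fin (2 * n) → ℂ) :
    chartMapN C z = pt C fun l => affLift (camCoord n z l) := rfl

theorem exists_camCoord (f : Fin n → Fin 2 → ℂ) : ∃ z : Fin (2 * n) → ℂ, camCoord n z = f := by
  refine ⟨fun i => f ⟨i.1 / 2, by have := i.2; omega⟩ ⟨i.1 % 2, by omega⟩, ?_⟩
  funext l k
  simp only [camCoord]
  congr 1
  · have := k.2
    have h : (2 * l.1 + k.1) / 2 = l.1 := by omega
    exact Fin.ext h
  · ext
    have := k.2
    simp only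
    omega

theorem affLift_ne_zero (z : Fin 2 → ℂ) : affLift z ≠ 0 := by
  intro h
  have := congrFun h 0
  simp [affLift] at this

theorem pt_mem_HQ_iff (hC : ∀ l, IsUnit (C l).det) (β : Fin (2 * n + 1) → ℂ)
    {w : Fin n → Fin 3 → ℂ} (hw : ∀ l, w l ≠ 0) :
    pt C w ∈ HQ C β ↔ gS (bOf β) (β 0) Finset.univ w = 0 := by
  rw [HQ, mem_closure_iff_frequently, frequently_nhds_pt hC hw]
  constructor
  · intro h
    have hcl : IsClosed {w | gS (bOf β) (β 0) Finset.univ w = 0} :=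
      isClosed_eq (contDiff_gS _ _ _).continuous continuous_const
    refine hcl.mem_of_frequently_of_tendsto
      ((h.and_eventually (eventually_forall_ne_zero hw)).mono ?_) tendsto_id
    rintro v ⟨⟨z, hz, hzv⟩, hv⟩
    rw [chartMapN_eq_pt, pt_eq_pt_iff hC (fun l => affLift_ne_zero _) hv] at hzv
    choose c hc hcv using hzv
    show gS (bOf β) (β 0) Finset.univ v = 0
    rw [funext hcv, gS_smul, gS_affLift, show _ + β 0 = 0 from hz, mul_zero]
  · intro h
    refine (mem_closure_iff_frequently.mp (mem_closure_affZeros hw h)).mono ?_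
    rintro v ⟨hv, hG⟩
    obtain ⟨z, hz⟩ := exists_camCoord fun l (k : Fin 2) => v l k.succ / v l 0
    have hvz : ∀ l, v l = v l 0 • affLift (camCoord n z l) := by
      intro l
      funext k
      rw [hz]
      refine Fin.cases ?_ (fun k => ?_) k
      · simp [affLift]
      · simp only [affLift, Pi.smul_apply, Fin.cons_succ, smul_eq_mul]
        rw [mul_div_cancel₀ _ (hv l)]
    refine ⟨z, ?_, ?_⟩
    · show _ + β 0 = 0
      rw [← gS_affLift]
      rw [funext hvz, gS_smul] at hG
      exact (mul_eq_zero.mp hG).resolve_left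
        (Finset.prod_ne_zero_iff.mpr fun l _ => pow_ne_zero 2 (hv l))
    · rw [chartMapN_eq_pt, pt_eq_pt_iff hC (fun l => affLift_ne_zero _)
        fun l h => hv l (congrFun h 0)]
      exact fun l => ⟨v l 0, hv l, hvz l⟩

theorem quadCondAt_pt_iff (hC : ∀ l, IsUnit (C l).det) (β : Fin (2 * n + 1) → ℂ)
    {w : Fin n → Fin 3 → ℂ} (hw : ∀ l, w l ≠ 0) (i : Fin n) :
    QuadCondAt C β i (pt C w i) ↔ nq (bOf β i) (w i) = 0 := by
  constructor
  · rintro ⟨v, hv, h, hN⟩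
    obtain ⟨c, hc, rfl⟩ := (mkP_mulVec_eq_iff (hC i) (hw i) hv).mp h
    have : nq (bOf β i) (c • w i) = 0 := hN
    rw [nq_smul] at this
    simpa [hc] using this
  · intro h
    exact ⟨w i, hw i, rfl, h⟩

theorem isClosed_setOf_quadCondAt (hC : ∀ l, IsUnit (C l).det) (β : Fin (2 * n + 1) → ℂ)
    (i : Fin n) : IsClosed {P : Fin n → P2 | QuadCondAt C β i (P i)} := by
  refine isClosed_of_pt hC (K := {w | nq (bOf β i) (w i) = 0}) ?_
    fun w hw => quadCondAt_pt_iff hC β hw i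
  refine isClosed_eq ?_ continuous_const
  simp only [nq]
  fun_prop

end Quadric

/-! Local parametrizations in the standard charts. -/

section LocalCharts

variable {n : ℕ} {C : Fin n → Matrix (Fin 3) (Fin 3) ℂ}

/-- The `m`-th homogeneous coordinate in the `l`-th factor, as a linear form. -/
def coordForm (C : Fin n → Matrix (Fin 3) (Fin 3) ℂ) (l : Fin n) (m : Fin 3) :
    (Fin n → Fin 3 → ℂ) →L[ℂ] ℂ :=
  (ContinuousLinearMap.proj (R := ℂ) (φ := fun _ : Fin 3 => ℂ) m).comp
    ((C l).mulVecLin.toContinuousLinearMap.comp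
      (ContinuousLinearMap.proj (R := ℂ) (φ := fun _ : Fin n => Fin 3 → ℂ) l))

theorem coordForm_apply (l : Fin n) (m : Fin 3) (w : Fin n → Fin 3 → ℂ) :
    coordForm C l m w = (C l).mulVec (w l) m := rfl

theorem exists_isLocParam_stdChart (hC : ∀ l, IsUnit (C l).det) {Y : Set (Fin n → P2)}
    {g : (Fin 3 → ℂ) → Fin n → Fin 3 → ℂ} (hg : ContDiffAt ℂ 1 g 0) (hg0 : ∀ l, g 0 l ≠ 0)
    (hinj : ∀ δ, (∀ l, Par (g 0 l) (fderiv ℂ g 0 δ l)) → δ = 0)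
    (hmem : ∀ᶠ s in 𝓝 0, pt C (g s) ∈ Y)
    (hsurj : ∀ U ∈ 𝓝 (0 : Fin 3 → ℂ), ∀ᶠ Q in 𝓝 (pt C (g 0)), Q ∈ Y →
      ∃ s ∈ U, Q = pt C (g s))
    {j : Fin n → Fin 3} {x₀ : Fin n → Fin 2 → ℂ} (hx : stdChart j x₀ = pt C (g 0)) :
    ∃ ψ : (Fin 3 → ℂ) → Fin n → Fin 2 → ℂ, IsLocParam ψ (stdChart j ⁻¹' Y) x₀ ∧
      ∀ᶠ s in 𝓝 0, stdChart j (ψ s) = pt C (g s) := by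
  let ψ : (Fin 3 → ℂ) → Fin n → Fin 2 → ℂ := fun s l k =>
    coordForm C l ((j l).succAbove k) (g s) / coordForm C l (j l) (g s)
  have hj : ∀ l, coordForm C l (j l) (g 0) ≠ 0 := by
    intro l
    have h1 : mkP _ = mkP _ := congrFun hx l
    obtain ⟨c, hc, hcv⟩ := (mkP_eq_mkP_iff (insertNth_one_ne_zero _ _)
      (mulVec_ne_zero (hC l) (hg0 l))).mp h1
    rw [coordForm_apply, hcv]
    simpa using hc
  have hφ : ∀ l m, ContDiffAt ℂ 1 (fun s => coordForm C l m (g s)) 0 := fun l m =>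
    (coordForm C l m).contDiff.contDiffAt.comp 0 hg
  have hne : ∀ᶠ s in 𝓝 0, ∀ l, coordForm C l (j l) (g s) ≠ 0 :=
    eventually_all.mpr fun l => (hφ l (j l)).continuousAt.eventually_ne (hj l)
  have hsm : ContDiffAt ℂ 1 ψ 0 :=
    contDiffAt_pi.mpr fun l => contDiffAt_pi.mpr fun k => (hφ l _).div (hφ l _) (hj l)
  have hchart : ∀ᶠ s in 𝓝 0, stdChart j (ψ s) = pt C (g s) := by
    filter_upwards [hne] with s hs
    exact funext fun l => (mkP_eq_insertNth (v := (C l).mulVec (g s l)) (j l) (hs l)).symm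
  have hψ0 : ψ 0 = x₀ := stdChart_injective j (hchart.self_of_nhds.trans hx.symm)
  refine ⟨ψ, ⟨hsm, hψ0, ?_, ?_⟩, hchart⟩
  · rw [injective_iff_map_eq_zero]
    intro δ hδ
    refine hinj δ fun l => ?_
    have hD := (hg.differentiableAt one_ne_zero).hasFDerivAt
    have hDψ := (hsm.differentiableAt one_ne_zero).hasFDerivAt
    have hDφ : ∀ m, HasFDerivAt (fun s => coordForm C l m (g s))
        ((coordForm C l m).comp (fderiv ℂ g 0)) 0 := fun m =>
      (coordForm C l m).hasFDerivAt.comp 0 hD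
    have key : ∀ k, coordForm C l ((j l).succAbove k) (fderiv ℂ g 0 δ) =
        ψ 0 l k * coordForm C l (j l) (fderiv ℂ g 0 δ) := by
      intro k
      have h1 : HasFDerivAt (fun s => ψ s l k) ((ContinuousLinearMap.proj (R := ℂ)
          (φ := fun _ : Fin 2 => ℂ) k).comp ((ContinuousLinearMap.proj (R := ℂ)
          (φ := fun _ : Fin n => Fin 2 → ℂ) l).comp (fderiv ℂ ψ 0))) 0 :=
        hasFDerivAt_pi'.mp (hasFDerivAt_pi'.mp hDψ l) k
      have h2 := h1.mul (hDφ (j l))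
      have h3 : (fun s => coordForm C l ((j l).succAbove k) (g s)) =ᶠ[𝓝 0]
          fun s => ψ s l k * coordForm C l (j l) (g s) := by
        filter_upwards [hne] with s hs
        exact (div_mul_cancel₀ _ (hs l)).symm
      have h4 := DFunLike.congr_fun ((hDφ _).unique (h2.congr_of_eventuallyEq h3)) δ
      simpa [hδ] using h4
    have hk0 : ∀ k, coordForm C l ((j l).succAbove k) (g 0) =
        ψ 0 l k * coordForm C l (j l) (g 0) := fun k => (div_mul_cancel₀ _ (hj l)).symm
    refine (par_iff (hg0 l)).mpr
      ⟨coordForm C l (j l) (fderiv ℂ g 0 δ) / coordForm C l (j l) (g 0), ?_⟩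
    have h5 : (C l).mulVec (fderiv ℂ g 0 δ l) = (C l).mulVec
        ((coordForm C l (j l) (fderiv ℂ g 0 δ) / coordForm C l (j l) (g 0)) • g 0 l) := by
      rw [Matrix.mulVec_smul]
      funext m
      have hj' := hj l
      refine Fin.succAboveCases (j l) ?_ (fun k => ?_) m
      · rw [Pi.smul_apply, smul_eq_mul, ← coordForm_apply, ← coordForm_apply,
          div_mul_cancel₀ _ hj']
      · rw [Pi.smul_apply, smul_eq_mul, ← coordForm_apply, ← coordForm_apply, key, hk0]
        field_simp
    rw [← inv_mulVec_mulVec (hC l) (fderiv ℂ g 0 δ l), h5, inv_mulVec_mulVec (hC l)]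
  · apply le_antisymm
    · refine tendsto_nhdsWithin_iff.mpr ⟨?_, ?_⟩
      · rw [← hψ0]
        exact hsm.continuousAt
      · filter_upwards [hchart, hmem] with s h1 h2
        rw [Set.mem_preimage, h1]
        exact h2
    · intro U hU
      have hU' := inter_mem (mem_map.mp hU) hchart
      have h1 := hsurj _ hU'
      rw [← hx] at h1
      have h2 := (continuous_stdChart j).continuousAt.eventually h1
      refine mem_nhdsWithin_iff_eventually.mpr ?_
      filter_upwards [h2] with x hx' hxY
      obtain ⟨s, ⟨hsU, hs⟩, hQ⟩ := hx' hxY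
      have : x = ψ s := stdChart_injective j (hQ.trans (Eq.symm hs))
      rw [this]
      exact hsU

end LocalCharts

/-! Parametrizations of the multiview variety. -/

section Frames

/-- An affine frame at `y₀`: `y₀ + u s` has coordinates `s` with respect to the linear forms
`ξ` and lies in the affine hyperplane `ξ₀ = 1`. -/
structure IsFrame (y₀ : Fin 4 → ℂ) (ξ : Fin 3 → (Fin 4 → ℂ) →L[ℂ] ℂ) (ξ₀ : (Fin 4 → ℂ) →L[ℂ] ℂ)
    (u : (Fin 3 → ℂ) →L[ℂ] (Fin 4 → ℂ)) : Prop where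
  base : ξ₀ y₀ = 1
  zero : ∀ a, ξ a y₀ = 0
  base_map : ∀ s, ξ₀ (u s) = 0
  map : ∀ s a, ξ a (u s) = s a
  decomp : ∀ v, v = ξ₀ v • y₀ + u fun a => ξ a v

theorem exists_isFrame {y₀ : Fin 4 → ℂ} (hy₀ : y₀ ≠ 0) (ξ : Fin 3 → (Fin 4 → ℂ) →L[ℂ] ℂ)
    (hξ : ∀ a, ξ a y₀ = 0) (hker : ∀ v, (∀ a, ξ a v = 0) → ∃ c : ℂ, v = c • y₀) :
    ∃ ξ₀ u, IsFrame y₀ ξ ξ₀ u := by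
  obtain ⟨m, hm⟩ := Function.ne_iff.mp hy₀
  have hm' : y₀ m ≠ 0 := hm
  let ξ₀ : (Fin 4 → ℂ) →L[ℂ] ℂ :=
    (y₀ m)⁻¹ • ContinuousLinearMap.proj (R := ℂ) (φ := fun _ : Fin 4 => ℂ) m
  have h₀ : ξ₀ y₀ = 1 := inv_mul_cancel₀ hm'
  let L : (Fin 4 → ℂ) →ₗ[ℂ] (Fin 4 → ℂ) :=
    LinearMap.pi (Fin.cons ξ₀.toLinearMap fun a => (ξ a).toLinearMap)
  have hL0 : ∀ v, L v 0 = ξ₀ v := fun v => rfl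
  have hLs : ∀ v a, L v (Fin.succ a) = ξ a v := fun v a => rfl
  have hinj : Function.Injective L := by
    rw [← LinearMap.ker_eq_bot, LinearMap.ker_eq_bot']
    intro v hv
    obtain ⟨c, rfl⟩ := hker v fun a => by rw [← hLs, hv]; rfl
    have h1 : ξ₀ (c • y₀) = 0 := by rw [← hL0, hv]; rfl
    rw [map_smul, h₀, smul_eq_mul, mul_one] at h1
    rw [h1, zero_smul]
  let e := LinearEquiv.ofInjectiveEndo L hinj
  have he : ∀ v, e v = L v := fun v => rfl
  let u : (Fin 3 → ℂ) →ₗ[ℂ] (Fin 4 → ℂ) := e.symm.toLinearMap.comp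
    (LinearMap.pi (Fin.cons 0 fun a => LinearMap.proj a))
  have hu : ∀ s, L (u s) = Fin.cons 0 s := by
    intro s
    rw [← he]
    have : u s = e.symm (Fin.cons 0 s) := by
      show e.symm _ = _
      congr 1
      funext k
      refine Fin.cases rfl (fun k => rfl) k
    rw [this, e.apply_symm_apply]
  have hu0 : ∀ s, ξ₀ (u s) = 0 := fun s => by rw [← hL0, hu]; rfl
  have hus : ∀ s a, ξ a (u s) = s a := fun s a => by rw [← hLs, hu]; rfl
  refine ⟨ξ₀, u.toContinuousLinearMap, h₀, hξ, hu0, hus, fun v => hinj ?_⟩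
  funext k
  refine Fin.cases ?_ (fun a => ?_) k
  · rw [hL0, hL0, map_add, map_smul, h₀]
    show _ = _ + ξ₀ (u _)
    rw [hu0, add_zero, smul_eq_mul, mul_one]
  · rw [hLs, hLs, map_add, map_smul, hξ]
    show _ = _ + ξ a (u _)
    rw [hus, smul_zero, zero_add]

theorem exists_isFrame_of_ne_zero {y₀ : Fin 4 → ℂ} (hy₀ : y₀ ≠ 0) :
    ∃ ξ ξ₀ u, IsFrame y₀ ξ ξ₀ u := by
  obtain ⟨m, hm⟩ := Function.ne_iff.mp hy₀
  have hm' : y₀ m ≠ 0 := hm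
  let p := ContinuousLinearMap.proj (R := ℂ) (φ := fun _ : Fin 4 => ℂ)
  refine ⟨fun a => y₀ m • p (m.succAbove a) - y₀ (m.succAbove a) • p m,
    exists_isFrame hy₀ _ (fun a => ?_) fun v hv => ⟨v m / y₀ m, funext fun k => ?_⟩⟩
  · show y₀ m * y₀ (m.succAbove a) - y₀ (m.succAbove a) * y₀ m = 0
    ring
  · have h2 : ∀ a, y₀ m * v (m.succAbove a) - y₀ (m.succAbove a) * v m = 0 := hv
    rw [Pi.smul_apply, smul_eq_mul]
    refine Fin.succAboveCases m ?_ (fun a => ?_) k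
    · rw [div_mul_cancel₀ _ hm']
    · rw [div_mul_eq_mul_div, eq_div_iff hm']
      linear_combination h2 a

end Frames

section MultiviewCharts

variable {n : ℕ} {A B : Fin n → Matrix (Fin 3) (Fin 4) ℂ} {C : Fin n → Matrix (Fin 3) (Fin 3) ℂ}

/-- The joint camera map as a continuous linear map. -/
def camL (B : Fin n → Matrix (Fin 3) (Fin 4) ℂ) : (Fin 4 → ℂ) →L[ℂ] (Fin n → Fin 3 → ℂ) :=
  ContinuousLinearMap.pi fun l => (B l).mulVecLin.toContinuousLinearMap

theorem camL_apply (y : Fin 4 → ℂ) (l : Fin n) : camL B y l = (B l).mulVec y := rfl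

theorem camL_smul (c : ℂ) (y : Fin 4 → ℂ) (l : Fin n) : camL B (c • y) l = c • camL B y l := by
  rw [map_smul]
  rfl

theorem pt_camL_smul (hC : ∀ l, IsUnit (C l).det) {c : ℂ} (hc : c ≠ 0) {y : Fin 4 → ℂ}
    (hy : ∀ l, camL B y l ≠ 0) : pt C (camL B (c • y)) = pt C (camL B y) := by
  refine ((pt_eq_pt_iff hC hy fun l => ?_).mpr fun l => ⟨c, hc, camL_smul _ _ _⟩).symm
  rw [camL_smul]
  exact smul_ne_zero hc (hy l)

theorem pt_camL_mem (hC : ∀ l, IsUnit (C l).det) (hA : ∀ l, A l = C l * B l) (hn : 0 < n)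
    {y : Fin 4 → ℂ} (hy : ∀ l, camL B y l ≠ 0) : pt C (camL B y) ∈ mvVariety A := by
  refine subset_closure (pt_mem_mvImage hC hA hy ?_)
  rintro rfl
  exact hy ⟨0, hn⟩ (by rw [map_zero]; rfl)

theorem isOpen_setOf_camL_ne_zero (S : Set (Fin n)) :
    IsOpen {y | ∀ l ∈ S, camL B y l ≠ 0} := by
  have : {y | ∀ l ∈ S, camL B y l ≠ 0} = ⋂ l : S, {y | camL B y l = 0}ᶜ := by
    ext y
    simp
  rw [this]
  refine isOpen_iInter_of_finite fun l => isOpen_compl_iff.mpr ?_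
  exact isClosed_eq ((continuous_apply _).comp (camL B).continuous) continuous_const

theorem IsFrame.exists_isLocParam {y₀ : Fin 4 → ℂ} {ξ : Fin 3 → (Fin 4 → ℂ) →L[ℂ] ℂ}
    {ξ₀ : (Fin 4 → ℂ) →L[ℂ] ℂ} {u : (Fin 3 → ℂ) →L[ℂ] (Fin 4 → ℂ)} (h : IsFrame y₀ ξ ξ₀ u)
    (hB : GenPos B) (hC : ∀ l, IsUnit (C l).det) (hA : ∀ l, A l = C l * B l) (hn : 2 ≤ n)
    (hy₀ : ∀ l, camL B y₀ l ≠ 0) {j : Fin n → Fin 3} {x₀ : Fin n → Fin 2 → ℂ}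
    (hx : stdChart j x₀ = pt C (camL B y₀)) :
    ∃ ψ : (Fin 3 → ℂ) → Fin n → Fin 2 → ℂ, IsLocParam ψ (stdChart j ⁻¹' mvVariety A) x₀ ∧
      ∀ᶠ s in 𝓝 0, stdChart j (ψ s) = pt C (camL B (y₀ + u s)) := by
  have hy₀0 : y₀ ≠ 0 := by
    rintro rfl
    have := h.base
    simp at this
  have hD : HasFDerivAt (fun s : Fin 3 → ℂ => camL B (y₀ + u s)) ((camL B).comp u) 0 :=
    (camL B).hasFDerivAt.comp 0 (u.hasFDerivAt.const_add y₀)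
  have hcont : Continuous fun s : Fin 3 → ℂ => camL B (y₀ + u s) := by fun_prop
  have hg0 : camL B (y₀ + u 0) = camL B y₀ := by rw [map_zero, add_zero]
  have hne : ∀ᶠ s in 𝓝 (0 : Fin 3 → ℂ), ∀ l, camL B (y₀ + u s) l ≠ 0 := by
    have h1 := hcont.tendsto 0
    rw [hg0] at h1
    exact h1.eventually (eventually_forall_ne_zero hy₀)
  refine exists_isLocParam_stdChart hC (g := fun s => camL B (y₀ + u s)) ?_ ?_ ?_ ?_ ?_ ?_
  · exact ((camL B).contDiff.comp (contDiff_const.add u.contDiff)).contDiffAt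
  · simp only [hg0]
    exact hy₀
  · intro δ hδ
    simp only [hg0, hD.fderiv] at hδ
    obtain ⟨c, hc⟩ := hB.fiber (camL B y₀) hy₀ y₀ (u δ) hy₀0 (incident_self y₀) hδ
    have h1 := h.base_map δ
    rw [hc, map_smul, h.base, smul_eq_mul, mul_one] at h1
    rw [h1, zero_smul] at hc
    funext a
    rw [← h.map δ a, hc, map_zero, Pi.zero_apply]
  · filter_upwards [hne] with s hs
    exact pt_camL_mem hC hA (by omega) hs
  · intro U hU
    simp only [hg0]
    obtain ⟨ε, hε, hεU⟩ := Metric.mem_nhds_iff.mp hU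
    refine (eventually_nhds_pt hC hy₀).mpr ?_
    let O : Set (Fin 4 → ℂ) :=
      {y | ∀ a, ‖ξ a y‖ < ε * ‖ξ₀ y‖} ∩ {y | ∀ l ∈ Set.univ, camL B y l ≠ 0}
    have hO : IsOpen O := by
      refine IsOpen.inter ?_ (isOpen_setOf_camL_ne_zero _)
      have : {y | ∀ a, ‖ξ a y‖ < ε * ‖ξ₀ y‖} = ⋂ a, {y | ‖ξ a y‖ < ε * ‖ξ₀ y‖} := by
        ext y
        simp
      rw [this]
      exact isOpen_iInter_of_finite fun a => isOpen_lt (by fun_prop) (by fun_prop)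
    have hcone : ∀ c : ℂ, c ≠ 0 → ∀ y ∈ O, c • y ∈ O := by
      rintro c hc y ⟨h1, h2⟩
      refine ⟨fun a => ?_, fun l hl => ?_⟩
      · rw [map_smul, map_smul, norm_smul, norm_smul, mul_left_comm]
        exact mul_lt_mul_of_pos_left (h1 a) (norm_pos_iff.mpr hc)
      · rw [camL_smul]
        exact smul_ne_zero hc (h2 l hl)
    have hy₀O : y₀ ∈ O := ⟨fun a => by simp [h.zero, h.base, hε], fun l _ => hy₀ l⟩
    filter_upwards [hB.eventually_incident hO hcone hy₀ hy₀0 (incident_self y₀) hy₀O,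
      eventually_forall_ne_zero hy₀] with v hv hv0 hvY
    obtain ⟨y, hy0, hyi⟩ := (pt_mem_mvVariety_iff hB hC hA hn hv0).mp hvY
    obtain ⟨h1, h2⟩ := hv y hy0 hyi
    have hξy : ξ₀ y ≠ 0 := by
      intro h0
      have := h1 0
      rw [h0, norm_zero, mul_zero] at this
      exact absurd this (norm_nonneg _).not_gt
    have hys : y₀ + u (fun a => (ξ₀ y)⁻¹ * ξ a y) = (ξ₀ y)⁻¹ • y := by
      conv_rhs => rw [h.decomp ((ξ₀ y)⁻¹ • y)]
      rw [map_smul, smul_eq_mul, inv_mul_cancel₀ hξy, one_smul]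
      simp only [map_smul, smul_eq_mul]
    refine ⟨fun a => (ξ₀ y)⁻¹ * ξ a y, hεU ?_, ?_⟩
    · rw [mem_ball_zero_iff, pi_norm_lt_iff hε]
      intro a
      rw [norm_mul, norm_inv, inv_mul_lt_iff₀ (norm_pos_iff.mpr hξy), mul_comm]
      exact h1 a
    · rw [hys, pt_camL_smul hC (inv_ne_zero hξy) fun l => h2 l trivial]
      refine (pt_eq_pt_iff hC hv0 fun l => h2 l trivial).mpr fun l => ?_
      obtain ⟨c, hc⟩ := (par_iff (hv0 l)).mp (hyi l)
      refine ⟨c, ?_, hc⟩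
      rintro rfl
      exact h2 l trivial (by rw [camL_apply, hc, zero_smul])
  · simp only [hg0]
    exact hx

end MultiviewCharts

/-! Parametrizations of the multiview variety along the exceptional divisors. -/

section CenterCharts

variable {n : ℕ} {A B : Fin n → Matrix (Fin 3) (Fin 4) ℂ} {C : Fin n → Matrix (Fin 3) (Fin 3) ℂ}

/-- The images of `y` in all factors but the `i`-th one, where the coordinates are `a`. -/
def cenL (B : Fin n → Matrix (Fin 3) (Fin 4) ℂ) (i : Fin n) (y : Fin 4 → ℂ) (a : Fin 3 → ℂ) :
    Fin n → Fin 3 → ℂ :=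
  camL (Function.update B i 0) y +
    ContinuousLinearMap.single (R := ℂ) (φ := fun _ : Fin n => Fin 3 → ℂ) i a

theorem cenL_same (i : Fin n) (y : Fin 4 → ℂ) (a : Fin 3 → ℂ) : cenL B i y a i = a := by
  simp [cenL, camL_apply]

theorem cenL_of_ne {i l : Fin n} (h : l ≠ i) (y : Fin 4 → ℂ) (a : Fin 3 → ℂ) :
    cenL B i y a l = camL B y l := by
  simp [cenL, camL_apply, h]

/-- The rows of the `i`-th camera as linear forms. -/
def rowForm (B : Fin n → Matrix (Fin 3) (Fin 4) ℂ) (i : Fin n) (r : Fin 3) :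
    (Fin 4 → ℂ) →L[ℂ] ℂ :=
  (ContinuousLinearMap.proj (R := ℂ) (φ := fun _ : Fin 3 => ℂ) r).comp
    (B i).mulVecLin.toContinuousLinearMap

theorem rowForm_apply (i : Fin n) (r : Fin 3) (y : Fin 4 → ℂ) :
    rowForm B i r y = camL B y i r := rfl

theorem GenPos.rowForm_center_ne_zero (hB : GenPos B) {i l : Fin n} (hl : l ≠ i)
    {c : Fin 4 → ℂ} (hc : c ≠ 0) (hic : ∀ r, rowForm B i r c = 0) : camL B c l 0 ≠ 0 :=
  fun h => hc (hB.center l i hl c h (funext hic))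

theorem GenPos.exists_isFrame_center (hB : GenPos B) {i l : Fin n} (hl : l ≠ i)
    {c : Fin 4 → ℂ} (hc : c ≠ 0) (hic : ∀ r, rowForm B i r c = 0) :
    ∃ ξ₀ u, IsFrame c (rowForm B i) ξ₀ u := by
  refine exists_isFrame hc _ hic fun v hv => ⟨rowForm B l 0 v / rowForm B l 0 c, ?_⟩
  have hne : rowForm B l 0 c ≠ 0 := hB.rowForm_center_ne_zero hl hc hic
  rw [← sub_eq_zero]
  refine hB.center l i hl _ ?_ (funext fun r => ?_)
  · change rowForm B l 0 _ = 0
    rw [map_sub, map_smul, smul_eq_mul, div_mul_cancel₀ _ hne, sub_self]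
  · change rowForm B i r _ = 0
    rw [map_sub, map_smul, hv, hic, smul_zero, sub_self]

/-- The projection of `ℂ³` forgetting the `m`-th coordinate. -/
def eraseL (m : Fin 3) : (Fin 3 → ℂ) →L[ℂ] (Fin 3 → ℂ) :=
  ContinuousLinearMap.pi fun a =>
    if a = m then 0 else ContinuousLinearMap.proj (R := ℂ) (φ := fun _ : Fin 3 => ℂ) a

theorem eraseL_same (m : Fin 3) (s : Fin 3 → ℂ) : eraseL m s m = 0 := by
  simp [eraseL]

theorem eraseL_of_ne {m a : Fin 3} (h : a ≠ m) (s : Fin 3 → ℂ) : eraseL m s a = s a := by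
  simp [eraseL, h]

/-- The chart of the multiview variety at a point over the `i`-th camera center `c`. -/
def cenChart (B : Fin n → Matrix (Fin 3) (Fin 4) ℂ) (i : Fin n) (c : Fin 4 → ℂ)
    (u : (Fin 3 → ℂ) →L[ℂ] (Fin 4 → ℂ)) (m : Fin 3) (w : Fin 3 → ℂ) (s : Fin 3 → ℂ) :
    Fin n → Fin 3 → ℂ :=
  cenL B i (c + s m • u (w + eraseL m s)) (w + eraseL m s)

theorem hasFDerivAt_cenChart (i : Fin n) (c : Fin 4 → ℂ) (u : (Fin 3 → ℂ) →L[ℂ] (Fin 4 → ℂ))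
    (m : Fin 3) (w : Fin 3 → ℂ) : ∃ L : (Fin 3 → ℂ) →L[ℂ] (Fin n → Fin 3 → ℂ),
    HasFDerivAt (cenChart B i c u m w) L 0 ∧
      ∀ δ, L δ = cenL B i (δ m • u w) (eraseL m δ) := by
  have h1 : HasFDerivAt (fun s : Fin 3 → ℂ => w + eraseL m s) (eraseL m) 0 :=
    (eraseL m).hasFDerivAt.const_add w
  have h2 := ((ContinuousLinearMap.proj (R := ℂ) (φ := fun _ : Fin 3 => ℂ) m).hasFDerivAt
    (x := (0 : Fin 3 → ℂ))).smul (u.hasFDerivAt.comp 0 h1)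
  have h3 := ((camL (Function.update B i 0)).hasFDerivAt.comp 0 (h2.const_add c)).add
    ((ContinuousLinearMap.single (R := ℂ) (φ := fun _ : Fin n => Fin 3 → ℂ) i).hasFDerivAt.comp
      0 h1)
  refine ⟨_, h3, fun δ => ?_⟩
  simp [cenL]

theorem contDiff_cenChart (i : Fin n) (c : Fin 4 → ℂ) (u : (Fin 3 → ℂ) →L[ℂ] (Fin 4 → ℂ))
    (m : Fin 3) (w : Fin 3 → ℂ) : ContDiff ℂ 1 (cenChart B i c u m w) := by
  unfold cenChart cenL
  fun_prop

theorem IsFrame.exists_isLocParam_center {i : Fin n} {c : Fin 4 → ℂ} {ξ₀ : (Fin 4 → ℂ) →L[ℂ] ℂ}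
    {u : (Fin 3 → ℂ) →L[ℂ] (Fin 4 → ℂ)} (h : IsFrame c (rowForm B i) ξ₀ u)
    (hB : GenPos B) (hC : ∀ l, IsUnit (C l).det) (hA : ∀ l, A l = C l * B l) (hn : 2 ≤ n)
    (hcl : ∀ l ≠ i, camL B c l ≠ 0) {m : Fin 3} {w : Fin 3 → ℂ} (hwm : w m = 1)
    {j : Fin n → Fin 3} {x₀ : Fin n → Fin 2 → ℂ} (hx : stdChart j x₀ = pt C (cenL B i c w)) :
    ∃ ψ : (Fin 3 → ℂ) → Fin n → Fin 2 → ℂ, IsLocParam ψ (stdChart j ⁻¹' mvVariety A) x₀ ∧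
      ∀ᶠ s in 𝓝 0, stdChart j (ψ s) = pt C (cenChart B i c u m w s) := by
  obtain ⟨L, hL, hLδ⟩ := hasFDerivAt_cenChart (B := B) i c u m w
  have hc0 : c ≠ 0 := by
    rintro rfl
    have := h.base
    simp at this
  have hw0 : w ≠ 0 := by
    rintro rfl
    simp at hwm
  have hg0 : cenChart B i c u m w 0 = cenL B i c w := by simp [cenChart]
  have hne0 : ∀ l, cenL B i c w l ≠ 0 := by
    intro l
    by_cases hl : l = i
    · subst hl
      rwa [cenL_same]
    · rw [cenL_of_ne hl]
      exact hcl l hl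
  have hBu : ∀ b, camL B (u b) i = b := fun b => funext fun r => h.map b r
  have hBc : camL B c i = 0 := funext fun r => h.zero r
  have hinc : ∀ (b : Fin 3 → ℂ) (t : ℂ), Incident B (cenL B i (c + t • u b) b) (c + t • u b) := by
    intro b t l
    by_cases hl : l = i
    · subst hl
      rw [cenL_same, ← camL_apply, map_add, map_smul, Pi.add_apply, Pi.smul_apply, hBu, hBc,
        zero_add]
      exact par_smul _ _
    · rw [cenL_of_ne hl]
      exact incident_self _ l
  have hne : ∀ᶠ s in 𝓝 (0 : Fin 3 → ℂ), ∀ l, cenChart B i c u m w s l ≠ 0 := by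
    have h1 := (contDiff_cenChart (B := B) i c u m w).continuous.tendsto 0
    rw [hg0] at h1
    exact h1.eventually (eventually_forall_ne_zero hne0)
  refine exists_isLocParam_stdChart hC (contDiff_cenChart (B := B) i c u m w).contDiffAt
    (by rwa [hg0]) ?_ ?_ ?_ (by rwa [hg0])
  · intro δ hδ
    rw [hg0, hL.fderiv, hLδ] at hδ
    have h1 := hδ i
    rw [cenL_same, cenL_same, par_iff hw0] at h1
    obtain ⟨t, ht⟩ := h1
    have h2 := congrFun ht m
    rw [eraseL_same, Pi.smul_apply, hwm, smul_eq_mul, mul_one] at h2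
    rw [← h2, zero_smul] at ht
    obtain ⟨t', ht'⟩ := hB.fiber (cenL B i c w) hne0 c (δ m • u w) hc0
      (by simpa using hinc w 0) (fun l => by
        by_cases hl : l = i
        · subst hl
          rw [cenL_same, ← camL_apply, map_smul, Pi.smul_apply, hBu]
          exact par_smul _ _
        · have := hδ l
          rw [cenL_of_ne hl, cenL_of_ne hl] at this
          rw [cenL_of_ne hl]
          exact this)
    have h3 := congrArg ξ₀ ht'
    rw [map_smul, map_smul, h.base_map, h.base, smul_zero, smul_eq_mul, mul_one] at h3
    rw [← h3, zero_smul] at ht'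
    have h4 := congrArg (fun y => camL B y i m) ht'
    simp only [map_smul, Pi.smul_apply, hBu, hwm, map_zero, Pi.zero_apply, smul_eq_mul,
      mul_one] at h4
    funext a
    by_cases ha : a = m
    · rw [ha, h4, Pi.zero_apply]
    · rw [← eraseL_of_ne ha δ, ht]
  · filter_upwards [hne] with s hs
    refine (pt_mem_mvVariety_iff hB hC hA hn hs).mpr ⟨_, ?_, hinc _ _⟩
    intro h0
    have := congrArg ξ₀ h0
    rw [map_add, map_smul, h.base, h.base_map, smul_zero, add_zero, map_zero] at this
    exact one_ne_zero this
  · intro U hU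
    obtain ⟨ε, hε, hεU⟩ := Metric.mem_nhds_iff.mp hU
    rw [hg0]
    refine (eventually_nhds_pt hC hne0).mpr ?_
    let O : Set (Fin 4 → ℂ) :=
      {y | ‖rowForm B i m y‖ < ε * ‖ξ₀ y‖} ∩ {y | ∀ l ∈ {l | l ≠ i}, camL B y l ≠ 0}
    have hO : IsOpen O :=
      (isOpen_lt (by fun_prop) (by fun_prop)).inter (isOpen_setOf_camL_ne_zero _)
    have hcone : ∀ t : ℂ, t ≠ 0 → ∀ y ∈ O, t • y ∈ O := by
      rintro t ht y ⟨h1, h2⟩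
      refine ⟨?_, fun l hl => ?_⟩
      · rw [Set.mem_ofPred_eq] at h1 ⊢
        rw [map_smul, map_smul, norm_smul, norm_smul, mul_left_comm]
        exact mul_lt_mul_of_pos_left h1 (norm_pos_iff.mpr ht)
      · rw [camL_smul]
        exact smul_ne_zero ht (h2 l hl)
    have hcO : c ∈ O := ⟨by simp [h.zero, h.base, hε], hcl⟩
    have hcoord : ∀ᶠ v : Fin n → Fin 3 → ℂ in 𝓝 (cenL B i c w),
        v i m ≠ 0 ∧ ∀ a, ‖v i a / v i m - w a‖ < ε := by
      have hwi : cenL B i c w i = w := cenL_same _ _ _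
      have hm : ContinuousAt (fun v : Fin n → Fin 3 → ℂ => v i m) (cenL B i c w) :=
        (continuous_apply_apply i m).continuousAt
      have hm0 : cenL B i c w i m ≠ 0 := by rw [hwi, hwm]; exact one_ne_zero
      refine (hm.eventually_ne hm0).and (eventually_all.mpr fun a => ?_)
      have ha : ContinuousAt (fun v : Fin n → Fin 3 → ℂ => ‖v i a / v i m - w a‖)
          (cenL B i c w) :=
        (((continuous_apply_apply i a).continuousAt.div hm hm0).sub continuousAt_const).norm
      refine ha.eventually_lt continuousAt_const ?_
      simp only [hwi, hwm, div_one, sub_self, norm_zero]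
      exact hε
    filter_upwards [hB.eventually_incident hO hcone hne0 hc0 (by simpa using hinc w 0) hcO,
      eventually_forall_ne_zero hne0, hcoord] with v hv hv0 hvc hvY
    obtain ⟨hvm, hva⟩ := hvc
    obtain ⟨y, hy0, hyi⟩ := (pt_mem_mvVariety_iff hB hC hA hn hv0).mp hvY
    obtain ⟨h1, h2⟩ := hv y hy0 hyi
    rw [Set.mem_ofPred_eq] at h1
    have hξy : ξ₀ y ≠ 0 := by
      intro h0
      rw [h0, norm_zero, mul_zero] at h1
      exact absurd h1 (norm_nonneg _).not_gt
    let s : Fin 3 → ℂ := fun a => if a = m then (ξ₀ y)⁻¹ * rowForm B i m y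
      else v i a / v i m - w a
    have hsm : s m = (ξ₀ y)⁻¹ * rowForm B i m y := if_pos rfl
    have hsa : w + eraseL m s = (v i m)⁻¹ • v i := by
      funext a
      by_cases ha : a = m
      · rw [ha, Pi.add_apply, eraseL_same, hwm, Pi.smul_apply, smul_eq_mul, add_zero,
          inv_mul_cancel₀ hvm]
      · rw [Pi.add_apply, eraseL_of_ne ha, Pi.smul_apply, smul_eq_mul]
        simp only [s, if_neg ha]
        ring
    have hys : c + s m • u (w + eraseL m s) = (ξ₀ y)⁻¹ • y := by
      conv_rhs => rw [h.decomp ((ξ₀ y)⁻¹ • y)]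
      rw [map_smul, smul_eq_mul, inv_mul_cancel₀ hξy, one_smul, ← map_smul]
      congr 2
      funext r
      rw [hsa, hsm, map_smul, Pi.smul_apply, Pi.smul_apply, smul_eq_mul, smul_eq_mul,
        smul_eq_mul, mul_assoc]
      congr 1
      have := hyi i m r
      rw [← mul_left_inj' hvm]
      change v i m * rowForm B i r y = v i r * rowForm B i m y at this
      field_simp
      linear_combination -this
    have hs0 : ∀ l, cenChart B i c u m w s l ≠ 0 ∧
        ∃ t ≠ (0 : ℂ), cenChart B i c u m w s l = t • v l := by
      intro l
      rw [cenChart, hys, hsa]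
      by_cases hl : l = i
      · subst hl
        rw [cenL_same]
        exact ⟨smul_ne_zero (inv_ne_zero hvm) (hv0 l), _, inv_ne_zero hvm, rfl⟩
      · rw [cenL_of_ne hl, camL_smul]
        refine ⟨smul_ne_zero (inv_ne_zero hξy) (h2 l hl), ?_⟩
        obtain ⟨t, ht⟩ := (par_iff (hv0 l)).mp (hyi l)
        have ht' : camL B y l = t • v l := ht
        refine ⟨(ξ₀ y)⁻¹ * t, mul_ne_zero (inv_ne_zero hξy) ?_, by rw [ht', smul_smul]⟩
        rintro rfl
        exact h2 l hl (by rw [ht', zero_smul])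
    refine ⟨s, hεU ?_, (pt_eq_pt_iff hC hv0 fun l => (hs0 l).1).mpr fun l => (hs0 l).2⟩
    rw [mem_ball_zero_iff, pi_norm_lt_iff hε]
    intro a
    by_cases ha : a = m
    · rw [ha, hsm, norm_mul, norm_inv, inv_mul_lt_iff₀ (norm_pos_iff.mpr hξy), mul_comm]
      exact h1
    · simp only [s, if_neg ha]
      exact hva a

end CenterCharts

/-! Smoothness of the quadric section away from the crossings at infinity. -/

section Nondegenerate

variable {n : ℕ} {B : Fin n → Matrix (Fin 3) (Fin 4) ℂ} {b : Fin n → Fin 2 → ℂ} {β₀ : ℂ}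

/-- Genericity of the quadric: its section of the affine part of the multiview variety is
smooth, and it does not meet the base points over the camera centers. -/
structure GenQuadric (B : Fin n → Matrix (Fin 3) (Fin 4) ℂ) (b : Fin n → Fin 2 → ℂ)
    (β₀ : ℂ) : Prop where
  smooth : ∀ y, (∀ l, camL B y l 0 ≠ 0) →
    ∑ l, ((camL B y l 1 / camL B y l 0 - b l 0) ^ 2 +
      (camL B y l 2 / camL B y l 0 - b l 1) ^ 2) + β₀ = 0 →
    ∃ δ, ∑ l, ((camL B y l 1 / camL B y l 0 - b l 0) *
        ((camL B δ l 1 * camL B y l 0 - camL B y l 1 * camL B δ l 0) / camL B y l 0 ^ 2) +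
      (camL B y l 2 / camL B y l 0 - b l 1) *
        ((camL B δ l 2 * camL B y l 0 - camL B y l 2 * camL B δ l 0) / camL B y l 0 ^ 2)) ≠ 0
  center : ∀ i c, c ≠ 0 → camL B c i = 0 → gS b β₀ (Finset.univ.erase i) (camL B c) ≠ 0

theorem fderiv_apply_eq_of_line {V : Type*} [NormedAddCommGroup V] [NormedSpace ℂ V] {f : V → ℂ}
    {x δ : V} (hf : DifferentiableAt ℂ f x) {φ : ℂ → ℂ} {d : ℂ}
    (h : ∀ᶠ t : ℂ in 𝓝 0, f (x + t • δ) = φ t) (hφ : HasDerivAt φ d 0) : fderiv ℂ f x δ = d := by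
  have h1 : HasDerivAt (fun t : ℂ => x + t • δ) δ 0 := by
    simpa using ((hasDerivAt_id (0 : ℂ)).smul_const δ).const_add x
  have h2 : HasDerivAt (fun t : ℂ => f (x + t • δ)) (fderiv ℂ f x δ) 0 := by
    refine HasFDerivAt.comp_hasDerivAt (0 : ℂ) ?_ h1
    rw [zero_smul, add_zero]
    exact hf.hasFDerivAt
  exact h2.unique (hφ.congr_of_eventuallyEq h)

/-- The equation of the quadric section on `ℂ⁴`. -/
def quadF (B : Fin n → Matrix (Fin 3) (Fin 4) ℂ) (b : Fin n → Fin 2 → ℂ) (β₀ : ℂ)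
    (y : Fin 4 → ℂ) : ℂ := gS b β₀ Finset.univ (camL B y)

theorem contDiff_quadF : ContDiff ℂ 1 (quadF B b β₀) :=
  (contDiff_gS b β₀ _).comp (camL B).contDiff

theorem fderiv_quadF_self {y : Fin 4 → ℂ} (h : quadF B b β₀ y = 0) :
    fderiv ℂ (quadF B b β₀) y y = 0 := by
  refine fderiv_apply_eq_of_line (φ := fun _ => 0)
    (contDiff_quadF.differentiable one_ne_zero _) (Eventually.of_forall fun t => ?_)
    (hasDerivAt_const _ _)
  have : camL B (y + t • y) = fun l => (1 + t) • camL B y l := by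
    funext l
    rw [← camL_smul, add_smul, one_smul]
  rw [quadF, this, gS_smul fun _ => 1 + t]
  exact mul_eq_zero_of_right _ h

theorem IsFrame.fderiv_quadF_ne_zero {y₀ : Fin 4 → ℂ} {ξ : Fin 3 → (Fin 4 → ℂ) →L[ℂ] ℂ}
    {ξ₀ : (Fin 4 → ℂ) →L[ℂ] ℂ} {u : (Fin 3 → ℂ) →L[ℂ] (Fin 4 → ℂ)} (h : IsFrame y₀ ξ ξ₀ u)
    {s : Fin 3 → ℂ} (h0 : quadF B b β₀ (y₀ + u s) = 0)
    (hd : fderiv ℂ (quadF B b β₀) (y₀ + u s) ≠ 0) :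
    fderiv ℂ (fun s => quadF B b β₀ (y₀ + u s)) s ≠ 0 := by
  have h1 : HasFDerivAt (fun s => quadF B b β₀ (y₀ + u s))
      ((fderiv ℂ (quadF B b β₀) (y₀ + u s)).comp u) s :=
    (contDiff_quadF.differentiable one_ne_zero _).hasFDerivAt.comp s
      (u.hasFDerivAt.const_add y₀)
  rw [h1.fderiv]
  intro hz
  have hz' : ∀ v, fderiv ℂ (quadF B b β₀) (y₀ + u s) (u v) = 0 := fun v =>
    DFunLike.congr_fun hz v
  refine hd (ContinuousLinearMap.ext fun v => ?_)
  have hy := fderiv_quadF_self h0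
  rw [map_add, hz', add_zero] at hy
  rw [h.decomp v, map_add, map_smul, hz', hy, smul_zero, add_zero]
  rfl

theorem GenQuadric.fderiv_quadF_ne_zero_of_affine (hQ : GenQuadric B b β₀) {y : Fin 4 → ℂ}
    (hy : ∀ l, camL B y l 0 ≠ 0) (h0 : quadF B b β₀ y = 0) : fderiv ℂ (quadF B b β₀) y ≠ 0 := by
  have hP : ∀ v : Fin 4 → ℂ, (∀ l, camL B v l 0 ≠ 0) → ∏ l, camL B v l 0 ^ 2 ≠ 0 := fun v hv =>
    Finset.prod_ne_zero_iff.mpr fun l _ => pow_ne_zero 2 (hv l)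
  have hE := h0
  rw [quadF, gS_eq_of_ne_zero fun l _ => hy l, mul_eq_zero, or_iff_right (hP y hy)] at hE
  obtain ⟨δ, hδ⟩ := hQ.smooth y hy hE
  have hlin : ∀ (t : ℂ) l k, camL B (y + t • δ) l k = camL B y l k + t * camL B δ l k := by
    intro t l k
    rw [map_add, map_smul]
    rfl
  have hder : ∀ l k, HasDerivAt (fun t : ℂ => camL B y l k + t * camL B δ l k)
      (camL B δ l k) 0 := fun l k => by
    simpa using ((hasDerivAt_id (0 : ℂ)).mul_const (camL B δ l k)).const_add (camL B y l k)
  have hcont : ∀ l, ContinuousAt (fun t : ℂ => camL B y l 0 + t * camL B δ l 0) 0 := fun l =>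
    (hder l 0).continuousAt
  have hne : ∀ᶠ t : ℂ in 𝓝 0, ∀ l, camL B y l 0 + t * camL B δ l 0 ≠ 0 :=
    eventually_all.mpr fun l => (hcont l).eventually_ne (by simpa using hy l)
  have hterm : ∀ l k (c : ℂ), HasDerivAt (fun t : ℂ =>
      ((camL B y l k + t * camL B δ l k) / (camL B y l 0 + t * camL B δ l 0) - c) ^ 2)
      (2 * ((camL B y l k / camL B y l 0 - c) *
        ((camL B δ l k * camL B y l 0 - camL B y l k * camL B δ l 0) / camL B y l 0 ^ 2))) 0 := by
    intro l k c
    have h1 := (((hder l k).div (hder l 0) (by simpa using hy l)).sub_const c).pow 2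
    simp only [zero_mul, add_zero] at h1
    refine h1.congr_deriv ?_
    simp
    ring
  have hsum : HasDerivAt (fun t : ℂ => ∑ l,
      (((camL B y l 1 + t * camL B δ l 1) / (camL B y l 0 + t * camL B δ l 0) - b l 0) ^ 2 +
        ((camL B y l 2 + t * camL B δ l 2) / (camL B y l 0 + t * camL B δ l 0) - b l 1) ^ 2) + β₀)
      _ 0 :=
    (HasDerivAt.fun_sum fun l (_ : l ∈ Finset.univ) =>
      (hterm l 1 (b l 0)).add (hterm l 2 (b l 1))).add_const β₀
  have hprod : DifferentiableAt ℂ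
      (fun t : ℂ => ∏ l, (camL B y l 0 + t * camL B δ l 0) ^ 2) 0 := by fun_prop
  have hφ := hprod.hasDerivAt.mul hsum
  intro hz
  have := fderiv_apply_eq_of_line (f := quadF B b β₀) (δ := δ)
    (contDiff_quadF.differentiable one_ne_zero y) (hne.mono fun t ht => ?_) hφ
  · simp only [zero_mul, add_zero, hE, mul_zero, hz, zero_apply, zero_add] at this
    have h2 := (mul_eq_zero.mp this.symm).resolve_left (hP y hy)
    simp only [← mul_add, ← Finset.mul_sum] at h2
    exact hδ ((mul_eq_zero.mp h2).resolve_left two_ne_zero)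
  · rw [quadF, gS_eq_of_ne_zero fun l _ => by rw [hlin]; exact ht l]
    simp only [hlin]
    rfl

theorem GenPos.fderiv_quadF_ne_zero_of_infinite (hB : GenPos B) {y : Fin 4 → ℂ} {i l : Fin n}
    (hl : l ≠ i) (hi : camL B y i 0 = 0) (hwi : camL B y i ≠ 0)
    (hy : ∀ l ≠ i, camL B y l 0 ≠ 0) (h0 : quadF B b β₀ y = 0) :
    fderiv ℂ (quadF B b β₀) y ≠ 0 := by
  have hP : ∏ m ∈ Finset.univ.erase i, camL B y m 0 ^ 2 ≠ 0 :=
    Finset.prod_ne_zero_iff.mpr fun m hm => pow_ne_zero 2 (hy m (Finset.ne_of_mem_erase hm))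
  have hN : camL B y i 1 ^ 2 + camL B y i 2 ^ 2 = 0 := by
    rw [quadF, gS_univ_eq i, hi, zero_pow two_ne_zero, zero_mul, add_zero, nq_of_zero hi,
      mul_eq_zero, or_iff_left hP] at h0
    exact h0
  intro hz
  have key : ∀ p q : ℂ, camL B y i 1 * p + camL B y i 2 * q = 0 := by
    intro p q
    obtain ⟨δ, -, hδ⟩ := hB.exists_preimage hl 0 ![0, p, q]
    have hδ' : camL B δ i = ![0, p, q] := hδ
    have hlin : ∀ (t : ℂ) l k, camL B (y + t • δ) l k = camL B y l k + t * camL B δ l k := by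
      intro t l k
      rw [map_add, map_smul]
      rfl
    have hn : HasDerivAt (fun t : ℂ => (camL B y i 1 + t * p) ^ 2 + (camL B y i 2 + t * q) ^ 2)
        (2 * (camL B y i 1 * p + camL B y i 2 * q)) 0 := by
      have h1 : ∀ a p : ℂ, HasDerivAt (fun t : ℂ => (a + t * p) ^ 2) (2 * (a * p)) 0 := by
        intro a p
        refine ((((hasDerivAt_id (0 : ℂ)).mul_const p).const_add a).pow 2).congr_deriv ?_
        simp
        ring
      exact ((h1 _ _).add (h1 _ _)).congr_deriv (by ring)
    have hprod : DifferentiableAt ℂ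
        (fun t : ℂ => ∏ m ∈ Finset.univ.erase i, (camL B y m 0 + t * camL B δ m 0) ^ 2) 0 := by
      fun_prop
    have := fderiv_apply_eq_of_line (f := quadF B b β₀) (δ := δ)
      (contDiff_quadF.differentiable one_ne_zero y) (Eventually.of_forall fun t => ?_) (hn.mul hprod.hasDerivAt)
    · simp only [zero_mul, add_zero, hN, hz, zero_apply] at this
      exact (mul_eq_zero.mp ((mul_eq_zero.mp this.symm).resolve_right hP)).resolve_left
        two_ne_zero
    · have hzero : camL B (y + t • δ) i 0 = 0 := by rw [hlin, hi, hδ']; simp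
      rw [quadF, gS_univ_eq i, hzero, nq_of_zero hzero]
      simp [hlin, hδ']
  refine hwi (funext fun k => ?_)
  have h1 := key 1 0
  have h2 := key 0 1
  simp only [mul_one, mul_zero, add_zero, zero_add] at h1 h2
  fin_cases k
  · exact hi
  · exact h1
  · exact h2

theorem GenQuadric.fderiv_quadF_ne_zero (hQ : GenQuadric B b β₀) (hB : GenPos B) (hn : 2 ≤ n)
    {y : Fin 4 → ℂ} (hne : ∀ l, camL B y l ≠ 0)
    (hy : ∀ i j, i ≠ j → camL B y i 0 = 0 → camL B y j 0 ≠ 0) (h0 : quadF B b β₀ y = 0) :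
    fderiv ℂ (quadF B b β₀) y ≠ 0 := by
  by_cases h : ∀ l, camL B y l 0 ≠ 0
  · exact hQ.fderiv_quadF_ne_zero_of_affine h h0
  · push Not at h
    obtain ⟨i, hi⟩ := h
    have : Nontrivial (Fin n) := Fin.nontrivial_iff_two_le.mpr hn
    obtain ⟨l, hl⟩ := exists_ne i
    exact hB.fderiv_quadF_ne_zero_of_infinite hl hi (hne i) (fun l hl => hy i l hl.symm hi) h0

theorem GenQuadric.fderiv_cenChart_ne_zero (hQ : GenQuadric B b β₀) (hB : GenPos B) {i : Fin n}
    {c : Fin 4 → ℂ} (hc : c ≠ 0) (hic : ∀ r, rowForm B i r c = 0)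
    (u : (Fin 3 → ℂ) →L[ℂ] (Fin 4 → ℂ)) {m : Fin 3} {w : Fin 3 → ℂ} (hwm : w m = 1)
    (h0 : gS b β₀ Finset.univ (cenL B i c w) = 0) :
    fderiv ℂ (fun s => gS b β₀ Finset.univ (cenChart B i c u m w s)) 0 ≠ 0 := by
  have hR : gS b β₀ (Finset.univ.erase i) (camL B c) ≠ 0 := hQ.center i c hc (funext hic)
  have hP : ∏ l ∈ Finset.univ.erase i, camL B c l 0 ^ 2 ≠ 0 :=
    Finset.prod_ne_zero_iff.mpr fun l hl => pow_ne_zero 2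
      (hB.rowForm_center_ne_zero (Finset.ne_of_mem_erase hl) hc hic)
  set P := ∏ l ∈ Finset.univ.erase i, camL B c l 0 ^ 2 with hPdef
  set R := gS b β₀ (Finset.univ.erase i) (camL B c) with hRdef
  have hval : ∀ a, gS b β₀ Finset.univ (cenL B i c a) = nq (b i) a * P + a 0 ^ 2 * R := by
    intro a
    rw [gS_univ_eq i, cenL_same, hPdef, hRdef]
    congr 2
    · exact Finset.prod_congr rfl fun l hl => by rw [cenL_of_ne (Finset.ne_of_mem_erase hl)]
    · exact gS_congr fun l hl => by rw [cenL_of_ne (Finset.ne_of_mem_erase hl)]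
  rw [hval] at h0
  intro hz
  let Φ : (Fin 3 → ℂ) → ℂ := fun e => ((w 1 - b i 0 * w 0) * (e 1 - b i 0 * e 0) +
    (w 2 - b i 1 * w 0) * (e 2 - b i 1 * e 0)) * P + w 0 * e 0 * R
  have key : ∀ e : Fin 3 → ℂ, e m = 0 → Φ e = 0 := by
    intro e he
    have hφ : HasDerivAt (fun t : ℂ => nq (b i) (w + t • e) * P + (w + t • e) 0 ^ 2 * R)
        (2 * Φ e) 0 := by
      have : (fun t : ℂ => nq (b i) (w + t • e) * P + (w + t • e) 0 ^ 2 * R) = fun t =>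
          2 * Φ e * t + (nq (b i) e * P + e 0 ^ 2 * R) * t ^ 2 := by
        funext t
        simp only [nq, Φ, Pi.add_apply, Pi.smul_apply, smul_eq_mul] at h0 ⊢
        linear_combination h0
      rw [this]
      refine (((hasDerivAt_id (0 : ℂ)).const_mul (2 * Φ e)).add
        (((hasDerivAt_id (0 : ℂ)).pow 2).const_mul _)).congr_deriv ?_
      simp
    have hF : ContDiff ℂ 1 fun s => gS b β₀ Finset.univ (cenChart B i c u m w s) :=
      (contDiff_gS b β₀ _).comp (contDiff_cenChart i c u m w)
    have := fderiv_apply_eq_of_line (δ := e) (hF.differentiable one_ne_zero 0)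
      (Eventually.of_forall fun t => ?_) hφ
    · rw [hz, zero_apply] at this
      exact (mul_eq_zero.mp this.symm).resolve_left two_ne_zero
    · rw [← hval, cenChart]
      have h1 : eraseL m (t • e) = t • e := by
        funext a
        by_cases ha : a = m
        · rw [ha, eraseL_same, Pi.smul_apply, he, smul_zero]
        · exact eraseL_of_ne ha _
      simp [h1, he]
  have hall : ∀ e : Fin 3 → ℂ, Φ e = 0 := by
    intro e
    have h1 := key (e - e m • w) (by simp [hwm])
    have h2 : Φ w = 0 := by
      simp only [Φ, nq] at h0 ⊢
      linear_combination h0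
    simp only [Φ, Pi.sub_apply, Pi.smul_apply, smul_eq_mul] at h1 h2 ⊢
    linear_combination h1 + e m * h2
  have h1 := hall ![0, 1, 0]
  have h2 := hall ![0, 0, 1]
  have h3 := hall ![1, 0, 0]
  simp [Φ, hP] at h1 h2
  rw [sub_eq_zero] at h1 h2
  simp [Φ, h1, h2, hR] at h3
  have : w = 0 := by
    funext k
    fin_cases k
    · exact h3
    · simpa [h3] using h1
    · simpa [h3] using h2
  rw [this] at hwm
  simp at hwm

end Nondegenerate

/-! Polynomial functions and genericity. -/

section IsPoly

variable {K : Type} [Field K] {σ : Type}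

/-- Polynomial functions of several variables. -/
def IsPoly (f : (σ → K) → K) : Prop := ∃ p : MvPolynomial σ K, ∀ x, MvPolynomial.eval x p = f x

theorem IsPoly.const (c : K) : IsPoly fun _ : σ → K => c :=
  ⟨MvPolynomial.C c, fun _ => MvPolynomial.eval_C _⟩

theorem IsPoly.coord (i : σ) : IsPoly fun x : σ → K => x i :=
  ⟨MvPolynomial.X i, fun _ => MvPolynomial.eval_X _⟩

theorem IsPoly.add {f g : (σ → K) → K} (hf : IsPoly f) (hg : IsPoly g) :
    IsPoly fun x => f x + g x := by
  obtain ⟨p, hp⟩ := hf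
  obtain ⟨q, hq⟩ := hg
  exact ⟨p + q, fun x => by rw [map_add, hp, hq]⟩

theorem IsPoly.mul {f g : (σ → K) → K} (hf : IsPoly f) (hg : IsPoly g) :
    IsPoly fun x => f x * g x := by
  obtain ⟨p, hp⟩ := hf
  obtain ⟨q, hq⟩ := hg
  exact ⟨p * q, fun x => by rw [map_mul, hp, hq]⟩

theorem IsPoly.neg {f : (σ → K) → K} (hf : IsPoly f) : IsPoly fun x => -f x := by
  obtain ⟨p, hp⟩ := hf
  exact ⟨-p, fun x => by rw [map_neg, hp]⟩

theorem IsPoly.sub {f g : (σ → K) → K} (hf : IsPoly f) (hg : IsPoly g) :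
    IsPoly fun x => f x - g x := by
  simpa only [sub_eq_add_neg] using hf.add hg.neg

theorem IsPoly.pow {f : (σ → K) → K} (hf : IsPoly f) (k : ℕ) : IsPoly fun x => f x ^ k := by
  obtain ⟨p, hp⟩ := hf
  exact ⟨p ^ k, fun x => by rw [map_pow, hp]⟩

theorem IsPoly.sum {ι : Type} (s : Finset ι) {f : ι → (σ → K) → K} (hf : ∀ i, IsPoly (f i)) :
    IsPoly fun x => ∑ i ∈ s, f i x := by
  choose p hp using hf
  exact ⟨∑ i ∈ s, p i, fun x => by simp only [map_sum, hp]⟩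

theorem IsPoly.prod {ι : Type} (s : Finset ι) {f : ι → (σ → K) → K} (hf : ∀ i, IsPoly (f i)) :
    IsPoly fun x => ∏ i ∈ s, f i x := by
  choose p hp using hf
  exact ⟨∏ i ∈ s, p i, fun x => by simp only [map_prod, hp]⟩

theorem IsPoly.det {ι : Type} [Fintype ι] [DecidableEq ι] {M : (σ → K) → Matrix ι ι K}
    (hM : ∀ a b, IsPoly fun x => M x a b) : IsPoly fun x => (M x).det := by
  simp only [Matrix.det_apply']
  exact IsPoly.sum _ fun τ => (IsPoly.const _).mul (IsPoly.prod _ fun a => hM _ _)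

theorem IsPoly.adjugate {ι : Type} [Fintype ι] [DecidableEq ι] {M : (σ → K) → Matrix ι ι K}
    (hM : ∀ a b, IsPoly fun x => M x a b) (a b : ι) : IsPoly fun x => (M x).adjugate a b := by
  simp only [Matrix.adjugate_apply]
  refine IsPoly.det fun a' b' => ?_
  by_cases h : a' = b
  · subst h
    simp only [Matrix.updateRow_self]
    exact IsPoly.const _
  · simp only [Matrix.updateRow_ne h]
    exact hM _ _

theorem IsPoly.generically {f : (σ → K) → K} (hf : IsPoly f) {x₀ : σ → K} (h : f x₀ ≠ 0) :
    Generically fun x => f x ≠ 0 := by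
  obtain ⟨p, hp⟩ := hf
  refine ⟨p, ?_, fun x hx => by rwa [hp] at hx⟩
  rintro rfl
  exact h (by rw [← hp, map_zero])

theorem Generically.comp_equiv {τ : Type} (e : σ ≃ τ) {P : (σ → K) → Prop} (hP : Generically P) :
    Generically fun a : τ → K => P fun i => a (e i) := by
  obtain ⟨q, hq, h⟩ := hP
  refine ⟨MvPolynomial.rename e q, ?_, fun a ha => h _ ?_⟩
  · rwa [Ne, map_eq_zero_iff _ (MvPolynomial.rename_injective _ e.injective)]
  · rwa [MvPolynomial.eval_rename] at ha

theorem generically_forall_not_eq_div {τ : Type} [Fintype σ] [Fintype τ]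
    (h : Fintype.card σ < Fintype.card τ) {f : τ → (σ → K) → K} {d : (σ → K) → K}
    (hf : ∀ k, IsPoly (f k)) (hd : IsPoly d) :
    Generically fun β : τ → K => ∀ t, d t ≠ 0 → ¬ ∀ k, β k * d t = f k t := by
  choose p hp using hf
  obtain ⟨q, hq⟩ := hd
  obtain ⟨Q, hQ, hQ'⟩ := exists_hypersurface_of_card_lt h p q
  refine ⟨Q, hQ, fun β hβ t ht hk => hβ (hQ' t β (by rwa [hq]) fun k => ?_)⟩
  rw [hq, hp]
  exact hk k

theorem exists_submatrix_det_ne_zero {κ : Type} [Fintype κ] {r : ℕ} (M : Matrix κ (Fin r) K)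
    (hM : ∀ v, M.mulVec v = 0 → v = 0) : ∃ e : Fin r → κ, (M.submatrix e id).det ≠ 0 := by
  have hcol : LinearIndependent K M.col := Matrix.mulVec_injective_iff.mp <|
    (injective_iff_map_eq_zero M.mulVecLin).mpr hM
  have hrank : Module.finrank K (Submodule.span K (Set.range M.row)) = r := by
    rw [← Matrix.rank_eq_finrank_span_row, Matrix.rank_eq_finrank_span_cols,
      finrank_span_eq_card hcol, Fintype.card_fin]
  obtain ⟨f, hf, -, hfi⟩ := Submodule.exists_fun_fin_finrank_span_eq K (Set.range M.row)
  choose e he using hf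
  refine ⟨fun a => e (Fin.cast hrank.symm a), ?_⟩
  rw [← isUnit_iff_ne_zero, ← Matrix.isUnit_iff_isUnit_det,
    ← Matrix.linearIndependent_rows_iff_isUnit]
  have hrow : (M.submatrix (fun a => e (Fin.cast hrank.symm a)) id).row =
      f ∘ Fin.cast hrank.symm := funext fun a => he _
  rw [hrow]
  exact hfi.comp _ (Fin.cast_injective hrank.symm)

end IsPoly

section QuadricGenericity

variable {n : ℕ} {B : Fin n → Matrix (Fin 3) (Fin 4) ℂ}

/-- The indexing of the coefficients of the quadric by the image coordinates. -/
def coeffEquiv (n : ℕ) : Option (Fin n × Fin 2) ≃ Fin (2 * n + 1) :=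
  (Equiv.optionCongr (finProdFinEquiv.trans (finCongr (mul_comm n 2)))).trans
    (finSuccEquiv (2 * n)).symm

theorem coeffEquiv_none : coeffEquiv n none = 0 := rfl

theorem bOf_eq_coeffEquiv (β : Fin (2 * n + 1) → ℂ) (l : Fin n) (k : Fin 2) :
    bOf β l k = β (coeffEquiv n (some (l, k))) := by
  rw [bOf]
  congr 1
  ext
  simp [coeffEquiv, finProdFinEquiv, add_comm]

theorem isPoly_gS (w : Fin n → Fin 3 → ℂ) (S : Finset (Fin n)) :
    IsPoly fun β : Fin (2 * n + 1) → ℂ => gS (bOf β) (β 0) S w := by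
  simp only [gS, nq, bOf]
  refine IsPoly.add (IsPoly.sum _ fun l => IsPoly.mul (IsPoly.add (IsPoly.pow ?_ 2)
    (IsPoly.pow ?_ 2)) (IsPoly.const _)) ((IsPoly.coord _).mul (IsPoly.const _))
  · exact (IsPoly.const _).sub ((IsPoly.coord _).mul (IsPoly.const _))
  · exact (IsPoly.const _).sub ((IsPoly.coord _).mul (IsPoly.const _))

theorem generically_gS_center_ne_zero (hB : GenPos B) (hn : 2 ≤ n) :
    Generically fun β : Fin (2 * n + 1) → ℂ => ∀ i c, c ≠ 0 → camL B c i = 0 →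
      gS (bOf β) (β 0) (Finset.univ.erase i) (camL B c) ≠ 0 := by
  refine Generically.all fun i => ?_
  by_cases hi : ∃ c, c ≠ 0 ∧ camL B c i = 0
  swap
  · push Not at hi
    exact Generically.of_forall fun β c hc hic => absurd hic (hi c hc)
  obtain ⟨c₀, hc₀, hic₀⟩ := hi
  have : Nontrivial (Fin n) := Fin.nontrivial_iff_two_le.mpr hn
  obtain ⟨l, hl⟩ := exists_ne i
  obtain ⟨ξ₀, u, hF⟩ := hB.exists_isFrame_center hl hc₀ (congrFun hic₀)
  have hne : ∀ l ∈ Finset.univ.erase i, camL B c₀ l 0 ≠ 0 := fun l hl =>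
    hB.rowForm_center_ne_zero (Finset.ne_of_mem_erase hl) hc₀ (congrFun hic₀)
  let β₁ : Fin (2 * n + 1) → ℂ := fun k => ((coeffEquiv n).symm k).elim 1 fun κ =>
    camL B c₀ κ.1 κ.2.succ / camL B c₀ κ.1 0
  have hβ₁ : gS (bOf β₁) (β₁ 0) (Finset.univ.erase i) (camL B c₀) ≠ 0 := by
    have h0 : β₁ 0 = 1 := by
      simp [β₁, ← coeffEquiv_none]
    have hb : ∀ l k, bOf β₁ l k = camL B c₀ l k.succ / camL B c₀ l 0 := fun l k => by
      rw [bOf_eq_coeffEquiv]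
      simp [β₁]
    rw [gS_eq_of_ne_zero hne, h0]
    refine mul_ne_zero (Finset.prod_ne_zero_iff.mpr fun l hl => pow_ne_zero 2 (hne l hl)) ?_
    simp [hb]
  refine ((isPoly_gS (camL B c₀) (Finset.univ.erase i)).generically hβ₁).mono
    fun β hβ c hc hic => ?_
  have hcc : c = ξ₀ c • c₀ := by
    have hz : (fun a => rowForm B i a c) = 0 := funext fun a => congrFun hic a
    have := hF.decomp c
    rwa [hz, map_zero, add_zero] at this
  have ht : ξ₀ c ≠ 0 := by
    intro h
    rw [h, zero_smul] at hcc
    exact hc hcc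
  have : camL B c = fun l => ξ₀ c • camL B c₀ l := funext fun l => by
    rw [← camL_smul, ← hcc]
  rw [this, gS_smul fun _ => ξ₀ c]
  exact mul_ne_zero (Finset.prod_ne_zero_iff.mpr fun l _ => pow_ne_zero 2 ht) hβ

/-- The numerators of the differentials at `y` of the affine image coordinates. -/
def diffL (B : Fin n → Matrix (Fin 3) (Fin 4) ℂ) (y : Fin 4 → ℂ) (κ : Fin n × Fin 2) :
    (Fin 4 → ℂ) →L[ℂ] ℂ :=
  camL B y κ.1 0 • rowForm B κ.1 κ.2.succ - camL B y κ.1 κ.2.succ • rowForm B κ.1 0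

theorem diffL_apply (y δ : Fin 4 → ℂ) (κ : Fin n × Fin 2) : diffL B y κ δ =
    camL B y κ.1 0 * camL B δ κ.1 κ.2.succ - camL B y κ.1 κ.2.succ * camL B δ κ.1 0 := rfl

/-- The matrix of `diffL` on the coordinates other than the `m`-th one. -/
def diffMat (B : Fin n → Matrix (Fin 3) (Fin 4) ℂ) (m : Fin 4) (y : Fin 4 → ℂ) :
    Matrix (Fin n × Fin 2) (Fin 3) ℂ :=
  Matrix.of fun κ d => diffL B y κ fun j => if m.succAbove d = j then 1 else 0

theorem diffMat_mulVec (m : Fin 4) (y : Fin 4 → ℂ) (v : Fin 3 → ℂ) (κ : Fin n × Fin 2) :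
    (diffMat B m y).mulVec v κ = diffL B y κ (Fin.insertNth m 0 v) := by
  have := LinearMap.pi_apply_eq_sum_univ (diffL B y κ).toLinearMap (Fin.insertNth m 0 v)
  rw [ContinuousLinearMap.coe_coe] at this
  rw [this, Fin.sum_univ_succAbove _ m]
  simp [Matrix.mulVec, dotProduct, diffMat, mul_comm]

theorem GenPos.diffMat_injective (hB : GenPos B) {m : Fin 4} {y : Fin 4 → ℂ} (hm : y m = 1)
    (hy : ∀ l, camL B y l 0 ≠ 0) (v : Fin 3 → ℂ) (hv : (diffMat B m y).mulVec v = 0) : v = 0 := by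
  have hne : ∀ l, camL B y l ≠ 0 := fun l h => hy l (by rw [h]; rfl)
  have hy0 : y ≠ 0 := by
    rintro rfl
    simp at hm
  obtain ⟨c, hc⟩ := hB.fiber (camL B y) hne y (Fin.insertNth m 0 v) hy0 (incident_self y)
    fun l => by
      refine (par_iff (hne l)).mpr ⟨camL B (Fin.insertNth m 0 v) l 0 / camL B y l 0,
        funext fun k => ?_⟩
      rw [Pi.smul_apply, smul_eq_mul, div_mul_eq_mul_div, eq_div_iff (hy l), ← camL_apply]
      refine Fin.cases (mul_comm _ _ |>.trans (mul_comm _ _)) (fun k => ?_) k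
      have h1 := congrFun hv (l, k)
      rw [diffMat_mulVec, diffL_apply, Pi.zero_apply] at h1
      linear_combination h1
  have h0 := congrFun hc m
  rw [Fin.insertNth_apply_same, Pi.smul_apply, hm, smul_eq_mul, mul_one] at h0
  funext d
  have h1 := congrFun hc (m.succAbove d)
  rwa [Fin.insertNth_apply_succAbove, ← h0, zero_smul] at h1

theorem isPoly_camL {σ : Type} {y : (σ → ℂ) → Fin 4 → ℂ} (hy : ∀ c, IsPoly fun x => y x c)
    (l : Fin n) (k : Fin 3) : IsPoly fun x => camL B (y x) l k := by
  change IsPoly fun x => ∑ c, B l k c * y x c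
  exact IsPoly.sum Finset.univ fun c => (IsPoly.const _).mul (hy c)

theorem isPoly_diffMat {σ : Type} {y : (σ → ℂ) → Fin 4 → ℂ} (hy : ∀ c, IsPoly fun x => y x c)
    (m : Fin 4) (κ : Fin n × Fin 2) (d : Fin 3) : IsPoly fun x => diffMat B m (y x) κ d :=
  ((isPoly_camL hy _ _).mul (IsPoly.const _)).sub ((isPoly_camL hy _ _).mul (IsPoly.const _))

/-- The points `y` and the quadrics (with coefficients `b`, `β₀`) whose affine sections are
singular at `y`. -/
def IsSingularAt (B : Fin n → Matrix (Fin 3) (Fin 4) ℂ) (β : Option (Fin n × Fin 2) → ℂ)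
    (y : Fin 4 → ℂ) : Prop :=
  (∑ κ : Fin n × Fin 2, (camL B y κ.1 κ.2.succ / camL B y κ.1 0 - β (some κ)) ^ 2) +
      β none = 0 ∧
    ∀ δ, ∑ κ : Fin n × Fin 2, (camL B y κ.1 κ.2.succ / camL B y κ.1 0 - β (some κ)) /
      camL B y κ.1 0 ^ 2 * diffL B y κ δ = 0

theorem generically_not_isSingularAt_of_det_ne_zero (m : Fin 4) (e : Fin 3 → Fin n × Fin 2) :
    Generically fun β : Option (Fin n × Fin 2) → ℂ => ∀ y, y m = 1 →
      (∀ l, camL B y l 0 ≠ 0) → ((diffMat B m y).submatrix e id).det ≠ 0 →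
      ¬ IsSingularAt B β y := by
  classical
  by_cases he : Function.Injective e
  swap
  · simp only [Function.Injective, not_forall] at he
    obtain ⟨a, a', haa, hne⟩ := he
    refine Generically.of_forall fun β y _ _ hdet => absurd ?_ hdet
    exact Matrix.det_zero_of_row_eq hne (funext fun d => by simp [haa])
  let σ := Fin 3 ⊕ {κ // κ ∉ Set.range e}
  have hcard : Fintype.card σ < Fintype.card (Option (Fin n × Fin 2)) := by
    have h1 : Fintype.card {κ // κ ∈ Set.range e} = 3 :=
      (Fintype.card_congr (Equiv.ofInjective e he)).symm.trans (Fintype.card_fin 3)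
    have h2 := Fintype.card_subtype_compl (fun κ => κ ∈ Set.range e)
    have h3 := Fintype.card_subtype_le (fun κ => κ ∈ Set.range e)
    rw [Fintype.card_option, Fintype.card_sum, Fintype.card_fin, h2, h1]
    omega
  let Y : (σ → ℂ) → Fin 4 → ℂ := fun t => Fin.insertNth m 1 fun d => t (Sum.inl d)
  have hY : ∀ c, IsPoly fun t => Y t c := by
    intro c
    refine Fin.succAboveCases m ?_ (fun d => ?_) c
    · simp only [Y, Fin.insertNth_apply_same]
      exact IsPoly.const _
    · simp only [Y, Fin.insertNth_apply_succAbove]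
      exact IsPoly.coord _
  let N : (Fin 4 → ℂ) → Matrix (Fin 3) (Fin 3) ℂ := fun y => (diffMat B m y).submatrix e id
  have hN : ∀ a d, IsPoly fun t => N (Y t) a d := fun a d => isPoly_diffMat hY m _ _
  let W : (σ → ℂ) → Fin n × Fin 2 → ℂ := fun t κ =>
    if h : κ ∉ Set.range e then (N (Y t)).det * t (Sum.inr ⟨κ, h⟩)
    else -∑ d, (∑ κ' : {κ // κ ∉ Set.range e}, t (Sum.inr κ') * diffMat B m (Y t) κ' d) *
      (N (Y t)).adjugate d (not_not.mp h).choose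
  have hW : ∀ κ, IsPoly fun t => W t κ := by
    intro κ
    by_cases h : κ ∉ Set.range e
    · simp only [W, dif_pos h]
      exact (IsPoly.det hN).mul (IsPoly.coord _)
    · simp only [W, dif_neg h]
      exact (IsPoly.sum _ fun d => (IsPoly.sum _ fun κ' => (IsPoly.coord _).mul
        (isPoly_diffMat hY m _ _)).mul (IsPoly.adjugate hN _ _)).neg
  have hh : ∀ l, IsPoly fun t => camL B (Y t) l 0 := fun l => isPoly_camL hY l 0
  let P : (σ → ℂ) → ℂ := fun t => ∏ l, camL B (Y t) l 0
  have hP : IsPoly P := IsPoly.prod _ hh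
  let f₀ : (σ → ℂ) → ℂ := fun t =>
    -(∑ κ : Fin n × Fin 2, (camL B (Y t) κ.1 0 ^ 2 * W t κ) ^ 2) * P t
  let f₁ : Fin n × Fin 2 → (σ → ℂ) → ℂ := fun κ t =>
    (∏ l ∈ Finset.univ.erase κ.1, camL B (Y t) l 0) * camL B (Y t) κ.1 κ.2.succ -
      camL B (Y t) κ.1 0 ^ 2 * W t κ * P t
  let f : Option (Fin n × Fin 2) → (σ → ℂ) → ℂ := fun k t => k.elim (f₀ t) fun κ => f₁ κ t
  have hW₂ : ∀ κ : Fin n × Fin 2, IsPoly fun t => camL B (Y t) κ.1 0 ^ 2 * W t κ := fun κ =>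
    ((hh κ.1).pow 2).mul (hW κ)
  have hf₀ : IsPoly f₀ := by
    have h : IsPoly fun t => ∑ κ : Fin n × Fin 2, (camL B (Y t) κ.1 0 ^ 2 * W t κ) ^ 2 :=
      IsPoly.sum Finset.univ fun κ => (hW₂ κ).pow 2
    exact h.neg.mul hP
  have hf₁ : ∀ κ, IsPoly (f₁ κ) := by
    intro κ
    have h : IsPoly fun t => ∏ l ∈ Finset.univ.erase κ.1, camL B (Y t) l 0 :=
      IsPoly.prod (Finset.univ.erase κ.1) hh
    exact (h.mul (isPoly_camL hY κ.1 κ.2.succ)).sub ((hW₂ κ).mul hP)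
  have hf : ∀ k, IsPoly (f k) := by
    intro k
    cases k with
    | none => exact hf₀
    | some κ => exact hf₁ κ
  refine (generically_forall_not_eq_div hcard hf hP).mono fun β hβ y hm hy hdet hs => ?_
  obtain ⟨hE, hlin⟩ := hs
  let w : Fin n × Fin 2 → ℂ := fun κ =>
    (camL B y κ.1 κ.2.succ / camL B y κ.1 0 - β (some κ)) / camL B y κ.1 0 ^ 2
  have hw : ∀ κ, camL B y κ.1 0 ^ 2 * w κ =
      camL B y κ.1 κ.2.succ / camL B y κ.1 0 - β (some κ) := fun κ =>
    mul_div_cancel₀ _ (pow_ne_zero 2 (hy κ.1))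
  have hlin' : ∀ d, ∑ a, w (e a) * N y a d +
      ∑ κ' : {κ // κ ∉ Set.range e}, w κ' * diffMat B m y κ' d = 0 := by
    intro d
    have h1 : ∑ κ, w κ * diffMat B m y κ d = 0 := hlin fun j => if m.succAbove d = j then 1 else 0
    rw [← h1, ← Fintype.sum_subtype_add_sum_subtype (fun κ => κ ∈ Set.range e)
      fun κ => w κ * diffMat B m y κ d]
    have h2 : ∑ a, w (e a) * N y a d =
        ∑ κ : {κ // κ ∈ Set.range e}, w κ * diffMat B m y κ d :=
      Fintype.sum_equiv (Equiv.ofInjective e he) _ _ fun a => rfl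
    rw [h2]
    congr!
  let t : σ → ℂ := Sum.elim (fun d => y (m.succAbove d)) fun κ' => (N y).det⁻¹ * w κ'
  have hYt : Y t = y := by
    funext c
    refine Fin.succAboveCases m ?_ (fun d => ?_) c
    · simp only [Y, Fin.insertNth_apply_same, hm]
    · simp only [Y, Fin.insertNth_apply_succAbove]
      rfl
  have hWt : ∀ κ, W t κ = w κ := by
    intro κ
    by_cases h : κ ∉ Set.range e
    · simp only [W, dif_pos h, hYt]
      exact mul_inv_cancel_left₀ hdet _
    · simp only [W, dif_neg h, hYt]
      have hk := (not_not.mp h).choose_spec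
      set a := (not_not.mp h).choose
      have h1 : ∀ d, ∑ κ' : {κ // κ ∉ Set.range e}, t (Sum.inr κ') * diffMat B m y κ' d =
          -((N y).det⁻¹ * ∑ a, w (e a) * N y a d) := by
        intro d
        have h2 : ∑ κ' : {κ // κ ∉ Set.range e}, t (Sum.inr κ') * diffMat B m y κ' d =
            (N y).det⁻¹ * ∑ κ' : {κ // κ ∉ Set.range e}, w κ' * diffMat B m y κ' d := by
          rw [Finset.mul_sum]
          exact Finset.sum_congr rfl fun κ' _ => mul_assoc _ _ _
        rw [h2]
        linear_combination (N y).det⁻¹ * hlin' d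
      have h3 : ∑ d, (∑ a', w (e a') * N y a' d) * (N y).adjugate d a = (N y).det * w (e a) := by
        simp only [Finset.sum_mul, mul_assoc]
        rw [Finset.sum_comm]
        simp only [← Finset.mul_sum, ← Matrix.mul_apply, Matrix.mul_adjugate, Matrix.smul_apply,
          Matrix.one_apply, smul_eq_mul]
        simp [mul_comm]
      simp only [h1, neg_mul, mul_assoc, Finset.sum_neg_distrib, neg_neg, ← Finset.mul_sum, h3]
      rw [inv_mul_cancel_left₀ hdet, hk]
  refine hβ t ?_ fun k => ?_
  · change ∏ l, camL B (Y t) l 0 ≠ 0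
    rw [hYt]
    exact Finset.prod_ne_zero_iff.mpr fun l _ => hy l
  · match k with
    | none =>
      change _ = -(∑ κ : Fin n × Fin 2, (camL B (Y t) κ.1 0 ^ 2 * W t κ) ^ 2) * P t
      congr 1
      simp only [hYt, hWt, hw]
      linear_combination hE
    | some κ =>
      change _ * ∏ l, camL B (Y t) l 0 = (∏ l ∈ Finset.univ.erase κ.1, camL B (Y t) l 0) *
        camL B (Y t) κ.1 κ.2.succ - camL B (Y t) κ.1 0 ^ 2 * W t κ * ∏ l, camL B (Y t) l 0
      rw [hYt, hWt, hw, ← Finset.mul_prod_erase _ _ (Finset.mem_univ κ.1)]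
      have := hy κ.1
      field_simp
      ring

theorem generically_genQuadric (hB : GenPos B) (hn : 2 ≤ n) :
    Generically fun β : Fin (2 * n + 1) → ℂ => GenQuadric B (bOf β) (β 0) := by
  have h1 : Generically fun β : Option (Fin n × Fin 2) → ℂ => ∀ m e, ∀ y, y m = 1 →
      (∀ l, camL B y l 0 ≠ 0) → ((diffMat B m y).submatrix e id).det ≠ 0 →
      ¬ IsSingularAt B β y :=
    Generically.all fun m => Generically.all fun e =>
      generically_not_isSingularAt_of_det_ne_zero m e
  refine ((generically_gS_center_ne_zero hB hn).and (h1.comp_equiv (coeffEquiv n))).mono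
    fun β hβ => ⟨fun y hy hE => ?_, hβ.1⟩
  by_contra! hδ
  have hy0 : y ≠ 0 := by
    rintro rfl
    exact hy ⟨0, by omega⟩ (by rw [map_zero]; rfl)
  obtain ⟨m, hm⟩ := Function.ne_iff.mp hy0
  have hm' : y m ≠ 0 := hm
  set c := (y m)⁻¹ with hc
  have hc0 : c ≠ 0 := inv_ne_zero hm'
  have hcy : ∀ l k, camL B (c • y) l k = c * camL B y l k := fun l k => by
    rw [camL_smul]
    rfl
  have hy' : ∀ l, camL B (c • y) l 0 ≠ 0 := fun l => by
    rw [hcy]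
    exact mul_ne_zero hc0 (hy l)
  have hmy : (c • y) m = 1 := inv_mul_cancel₀ hm'
  obtain ⟨e, he⟩ := exists_submatrix_det_ne_zero _ (hB.diffMat_injective hmy hy')
  refine hβ.2 m e (c • y) hmy hy' he ⟨?_, fun δ => ?_⟩
  · simp only [coeffEquiv_none]
    rw [Fintype.sum_prod_type, ← hE]
    simp only [Fin.sum_univ_two, ← bOf_eq_coeffEquiv, hcy, mul_div_mul_left _ _ hc0]
    rfl
  · rw [← mul_zero (c ^ 2)⁻¹, ← mul_zero c, ← hδ δ, Fintype.sum_prod_type, Finset.mul_sum,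
      Finset.mul_sum]
    refine Finset.sum_congr rfl fun l _ => ?_
    have := hy l
    simp only [Fin.sum_univ_two, ← bOf_eq_coeffEquiv, diffL_apply, hcy,
      mul_div_mul_left _ _ hc0]
    simp only [Fin.succ_zero_eq_one, Fin.succ_one_eq_two]
    field_simp

end QuadricGenericity

/-! Genericity of the position conditions. -/

section CameraGenericity

/-- `P a c` holds for general `a`, and then for general `c`. -/
def Generically₂ {K σ τ : Type} [Field K] (P : (σ → K) → (τ → K) → Prop) : Prop :=
  Generically fun a => Generically fun c => P a c

section

variable {K σ τ : Type} [Field K]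

theorem Generically₂.mono {P Q : (σ → K) → (τ → K) → Prop} (hP : Generically₂ P)
    (h : ∀ a c, P a c → Q a c) : Generically₂ Q :=
  Generically.mono hP fun a ha => ha.mono (h a)

theorem Generically₂.and {P Q : (σ → K) → (τ → K) → Prop} (hP : Generically₂ P)
    (hQ : Generically₂ Q) : Generically₂ fun a c => P a c ∧ Q a c :=
  (Generically.and hP hQ).mono fun _ ha => ha.1.and ha.2

theorem Generically₂.all {ι : Type} [Finite ι] {P : ι → (σ → K) → (τ → K) → Prop}
    (h : ∀ i, Generically₂ (P i)) : Generically₂ fun a c => ∀ i, P i a c :=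
  (Generically.all h).mono fun _ ha => Generically.all ha

theorem Generically₂.imp {p : Prop} {P : (σ → K) → (τ → K) → Prop}
    (h : p → Generically₂ P) : Generically₂ fun a c => p → P a c :=
  (Generically.imp h).mono fun _ ha => Generically.imp ha

theorem generically₂_mulVec_eq_zero {ι : Type} [Fintype ι] [DecidableEq ι]
    {M : (σ ⊕ τ → K) → Matrix ι ι K} (hM : ∀ p q, IsPoly fun z => M z p q) {z₀ : σ ⊕ τ → K}
    (h : ∀ v, (M z₀).mulVec v = 0 → v = 0) :
    Generically₂ fun a c => ∀ v, (M (Sum.elim a c)).mulVec v = 0 → v = 0 := by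
  obtain ⟨Q, hQ⟩ := IsPoly.det hM
  have hQ0 : Q ≠ 0 := by
    rintro rfl
    have hdet : (M z₀).det = 0 := (hQ z₀).symm.trans (map_zero _)
    obtain ⟨v, hv, hMv⟩ := Matrix.exists_mulVec_eq_zero_iff.mpr hdet
    exact hv (h v hMv)
  refine Generically.mono (generically_eval_sumElim_ne_zero hQ0) fun a ha =>
    ha.mono fun c hc v hv => ?_
  rw [hQ] at hc
  exact Matrix.eq_zero_of_mulVec_eq_zero hc hv

end

variable {n : ℕ}

/-- The camera matrices in the coordinates of the charts, up to scaling. -/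
def adjCam (z : (Fin n × Fin 3 × Fin 4) ⊕ (Fin n × Fin 3 × Fin 3) → ℂ) (i : Fin n) :
    Matrix (Fin 3) (Fin 4) ℂ :=
  (chartOf (fun k => z (Sum.inr k)) i).adjugate * camOfC (fun k => z (Sum.inl k)) i

theorem isPoly_adjCam (i : Fin n) (r : Fin 3) (c : Fin 4) : IsPoly fun z => adjCam z i r c := by
  simp only [adjCam, Matrix.mul_apply]
  exact IsPoly.sum _ fun s => (IsPoly.adjugate (fun a b => IsPoly.coord _) r s).mul
    (IsPoly.coord _)

/-- The parameters of the cameras `W` with standard charts. -/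
def witness (W : Fin n → Matrix (Fin 3) (Fin 4) ℂ) :
    (Fin n × Fin 3 × Fin 4) ⊕ (Fin n × Fin 3 × Fin 3) → ℂ :=
  Sum.elim (fun k => W k.1 k.2.1 k.2.2) fun k => (1 : Matrix (Fin 3) (Fin 3) ℂ) k.2.1 k.2.2

theorem adjCam_witness (W : Fin n → Matrix (Fin 3) (Fin 4) ℂ) (i : Fin n) :
    adjCam (witness W) i = W i := by
  have h : chartOf (fun k => witness W (Sum.inr k)) i = 1 := rfl
  rw [adjCam, h, Matrix.adjugate_one, Matrix.one_mul]
  rfl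

theorem generically₂_four_forms (cam : Fin 4 → Fin n) (ρ : Fin 4 → Fin 3) (κ : Fin 4 → Fin 3 → ℂ)
    (h : ∀ m m', cam m' = cam m → κ m (ρ m') = if m' = m then 1 else 0) :
    Generically₂ fun a c => ∀ y, (∀ m, κ m ⬝ᵥ (adjCam (Sum.elim a c) (cam m)).mulVec y = 0) →
      y = 0 := by
  let M : ((Fin n × Fin 3 × Fin 4) ⊕ (Fin n × Fin 3 × Fin 3) → ℂ) → Matrix (Fin 4) (Fin 4) ℂ :=
    fun z => Matrix.of fun m => Matrix.vecMul (κ m) (adjCam z (cam m))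
  have hMv : ∀ z y m, (M z).mulVec y m = κ m ⬝ᵥ (adjCam z (cam m)).mulVec y := fun z y m =>
    (Matrix.dotProduct_mulVec (κ m) (adjCam z (cam m)) y).symm
  have hM : ∀ p q, IsPoly fun z => M z p q := fun p q => by
    change IsPoly fun z => ∑ r, κ p r * adjCam z (cam p) r q
    exact IsPoly.sum Finset.univ fun r => (IsPoly.const _).mul (isPoly_adjCam _ _ _)
  let W : Fin n → Matrix (Fin 3) (Fin 4) ℂ := fun i =>
    Matrix.of fun r m => if cam m = i ∧ ρ m = r then 1 else 0
  have hW : M (witness W) = 1 := by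
    ext m m'
    change ∑ r, κ m r * adjCam (witness W) (cam m) r m' = _
    simp only [adjCam_witness, W, Matrix.of_apply, Matrix.one_apply]
    by_cases hc : cam m' = cam m
    · simp [hc, h m m' hc, eq_comm]
    · have : m ≠ m' := fun e => hc (by rw [e])
      simp [hc, this]
  refine (generically₂_mulVec_eq_zero hM (z₀ := witness W) fun v hv => ?_).mono
    fun a c hac y hy => hac y (funext fun m => ?_)
  · rwa [hW, Matrix.one_mulVec] at hv
  · rw [hMv, hy]
    rfl

/-- The matrix with the last row `r` added to `N`. -/
def addRow (N : Matrix (Fin 3) (Fin 4) ℂ) (r : Fin 4 → ℂ) : Matrix (Fin 4) (Fin 4) ℂ :=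
  Matrix.of fun p q => Fin.lastCases (r q) (fun p => N p q) p

theorem addRow_last (N : Matrix (Fin 3) (Fin 4) ℂ) (r : Fin 4 → ℂ) (q : Fin 4) :
    addRow N r (Fin.last 3) q = r q := by
  rw [addRow, Matrix.of_apply, Fin.lastCases_last]

theorem addRow_castSucc (N : Matrix (Fin 3) (Fin 4) ℂ) (r : Fin 4 → ℂ) (p : Fin 3) (q : Fin 4) :
    addRow N r p.castSucc q = N p q := by
  simp [addRow]

theorem generically₂_kernels {i j k : Fin n} (hij : i ≠ j) (hik : i ≠ k) (hjk : j ≠ k) :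
    Generically₂ fun a c => ∀ u v, (adjCam (Sum.elim a c) i).mulVec u = 0 →
      (adjCam (Sum.elim a c) j).mulVec v = 0 →
      (adjCam (Sum.elim a c) k).mulVec (u + v) = 0 → u = 0 ∧ v = 0 := by
  let M : ((Fin n × Fin 3 × Fin 4) ⊕ (Fin n × Fin 3 × Fin 3) → ℂ) →
      Matrix (Fin 4 ⊕ Fin 4) (Fin 4 ⊕ Fin 4) ℂ := fun z => Matrix.fromBlocks
    (addRow (adjCam z i) (adjCam z k 0)) (addRow 0 (adjCam z k 0))
    (addRow 0 (adjCam z k 1)) (addRow (adjCam z j) (adjCam z k 1))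
  have hblock : ∀ (N : ((Fin n × Fin 3 × Fin 4) ⊕ (Fin n × Fin 3 × Fin 3) → ℂ) →
      Matrix (Fin 3) (Fin 4) ℂ) (r : Fin 3), (∀ p q, IsPoly fun z => N z p q) → ∀ p q,
      IsPoly fun z => addRow (N z) (adjCam z k r) p q := by
    intro N r hN p q
    refine Fin.lastCases ?_ (fun p => ?_) p
    · simp only [addRow_last]
      exact isPoly_adjCam _ _ _
    · simp only [addRow_castSucc]
      exact hN _ _
  have hM : ∀ p q, IsPoly fun z => M z p q := by
    rintro (p | p) (q | q)
    · exact hblock _ 0 (isPoly_adjCam i) p q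
    · exact hblock (fun _ => 0) 0 (fun _ _ => IsPoly.const _) p q
    · exact hblock (fun _ => 0) 1 (fun _ _ => IsPoly.const _) p q
    · exact hblock _ 1 (isPoly_adjCam j) p q
  have hMv : ∀ z u v, (M z).mulVec (Sum.elim u v) = 0 ↔ (adjCam z i).mulVec u = 0 ∧
      (adjCam z j).mulVec v = 0 ∧ (adjCam z k).mulVec (u + v) 0 = 0 ∧
      (adjCam z k).mulVec (u + v) 1 = 0 := by
    intro z u v
    have hadd : ∀ (N N' : Matrix (Fin 3) (Fin 4) ℂ) (r : Fin 4 → ℂ),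
        (addRow N r).mulVec u + (addRow N' r).mulVec v = 0 ↔
          N.mulVec u + N'.mulVec v = 0 ∧ r ⬝ᵥ (u + v) = 0 := by
      intro N N' r
      simp only [funext_iff, Fin.forall_fin_succ', Matrix.mulVec, Pi.add_apply,
        Pi.zero_apply, dotProduct, addRow_castSucc, addRow_last, mul_add, Finset.sum_add_distrib]
    have hsum : ∀ f g : Fin 4 → ℂ, Sum.elim f g = 0 ↔ f = 0 ∧ g = 0 := by
      simp [funext_iff]
    rw [Matrix.fromBlocks_mulVec, hsum]
    simp only [Sum.elim_comp_inl, Sum.elim_comp_inr, hadd, Matrix.zero_mulVec, add_zero, zero_add]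
    exact and_and_and_comm.trans and_assoc
  let W : Fin n → Matrix (Fin 3) (Fin 4) ℂ := fun l =>
    if l = i then !![0, 1, 0, 0; 0, 0, 1, 0; 0, 0, 0, 1]
    else if l = j then !![1, 0, 0, 0; 0, 0, 1, 0; 0, 0, 0, 1]
    else !![1, 0, 0, 0; 0, 1, 0, 0; 0, 0, 0, 0]
  refine (generically₂_mulVec_eq_zero hM (z₀ := witness W) fun v hv => ?_).mono
    fun a c hac u v hu hv huv => ?_
  · rw [← Sum.elim_comp_inl_inr v] at hv ⊢
    rw [hMv] at hv
    simp only [adjCam_witness] at hv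
    have hWi : W i = !![0, 1, 0, 0; 0, 0, 1, 0; 0, 0, 0, 1] := if_pos rfl
    have hWj : W j = !![1, 0, 0, 0; 0, 0, 1, 0; 0, 0, 0, 1] := by simp [W, hij.symm]
    have hWk : W k = !![1, 0, 0, 0; 0, 1, 0, 0; 0, 0, 0, 0] := by simp [W, hik.symm, hjk.symm]
    rw [hWi, hWj, hWk] at hv
    simp [funext_iff, Fin.forall_fin_succ, Matrix.mulVec, dotProduct, Fin.sum_univ_succ] at hv
    obtain ⟨⟨h1, h2, h3⟩, ⟨h4, h5, h6⟩, h7, h8⟩ := hv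
    funext p
    rcases p with p | p <;> fin_cases p <;> simp_all
  · have := hac (Sum.elim u v) ((hMv _ _ _).mpr ⟨hu, hv, congrFun huv 0, congrFun huv 1⟩)
    exact ⟨funext fun p => congrFun this (Sum.inl p), funext fun p => congrFun this (Sum.inr p)⟩

theorem finite_setOf_sq_eq_neg_one : Finite {ε : ℂ // ε ^ 2 = -1} := by
  refine Set.Finite.subset (Set.toFinite {Complex.I, -Complex.I}) fun ε hε => ?_
  have h : ε ^ 2 = Complex.I ^ 2 := by rw [Complex.I_sq]; exact hε
  exact sq_eq_sq_iff_eq_or_eq_neg.mp h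

theorem GenPos.smul {B : Fin n → Matrix (Fin 3) (Fin 4) ℂ} (hB : GenPos B) {d : Fin n → ℂ}
    (hd : ∀ l, d l ≠ 0) : GenPos fun l => d l • B l := by
  have h0 : ∀ l r y, ((d l • B l).mulVec y) r = 0 ↔ (B l).mulVec y r = 0 := fun l r y => by
    rw [Matrix.smul_mulVec, Pi.smul_apply, smul_eq_mul, mul_eq_zero, or_iff_right (hd l)]
  have hc : ∀ l y, (d l • B l).mulVec y = 0 ↔ (B l).mulVec y = 0 := fun l y => by
    simp only [funext_iff, Pi.zero_apply, h0]
  have hε : ∀ l (ε : ℂ) y, (d l • B l).mulVec y 1 + ε * (d l • B l).mulVec y 2 = 0 ↔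
      (B l).mulVec y 1 + ε * (B l).mulVec y 2 = 0 := fun l ε y => by
    simp only [Matrix.smul_mulVec, Pi.smul_apply, smul_eq_mul]
    rw [← mul_eq_zero_iff_left (hd l) (b := (B l).mulVec y 1 + ε * (B l).mulVec y 2)]
    ring_nf
  have hI : ∀ w y, Incident (fun l => d l • B l) w y → Incident B w y := fun w y h l => by
    have := (h l).const_smul (d l)⁻¹
    rwa [Matrix.smul_mulVec, inv_smul_smul₀ (hd l)] at this
  refine ⟨?_, ?_, ?_, ?_, fun w hw y y' hy h h' => hB.fiber w hw y y' hy (hI _ _ h) (hI _ _ h')⟩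
  · simpa only [h0] using hB.four
  · simpa only [h0, hc] using hB.center
  · simpa only [h0, hε] using hB.quad
  · simpa only [h0, hε] using hB.triple

theorem exists_mem_span_pair_mulVec_eq_zero {M : Matrix (Fin 3) (Fin 4) ℂ} {w : Fin 3 → ℂ}
    (hw : w ≠ 0) {y y' : Fin 4 → ℂ} (h : Par w (M.mulVec y)) (h' : Par w (M.mulVec y')) :
    ∃ s t : ℂ, (s ≠ 0 ∨ t ≠ 0) ∧ M.mulVec (s • y + t • y') = 0 := by
  obtain ⟨c, hc⟩ := (par_iff hw).mp h
  obtain ⟨c', hc'⟩ := (par_iff hw).mp h'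
  by_cases h0 : c = 0
  · exact ⟨1, 0, Or.inl one_ne_zero, by rw [zero_smul, add_zero, one_smul, hc, h0, zero_smul]⟩
  · refine ⟨c', -c, Or.inr (neg_ne_zero.mpr h0), ?_⟩
    rw [Matrix.mulVec_add, Matrix.mulVec_smul, Matrix.mulVec_smul, hc, hc', smul_smul, smul_smul,
      ← add_smul, mul_comm, neg_mul, add_neg_cancel, zero_smul]

theorem fiber_of_kernels {B : Fin n → Matrix (Fin 3) (Fin 4) ℂ} {i j k : Fin n}
    (hik : ∀ y, (B i).mulVec y = 0 → (B k).mulVec y = 0 → y = 0)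
    (hk : ∀ u v, (B i).mulVec u = 0 → (B j).mulVec v = 0 → (B k).mulVec (u + v) = 0 →
      u = 0 ∧ v = 0) {w : Fin n → Fin 3 → ℂ} (hw : ∀ l, w l ≠ 0) {y y' : Fin 4 → ℂ} (hy : y ≠ 0)
    (h : Incident B w y) (h' : Incident B w y') : ∃ c : ℂ, y' = c • y := by
  by_contra! hc
  have hli : ∀ s t : ℂ, s • y + t • y' = 0 → s = 0 ∧ t = 0 := by
    intro s t hst
    have ht : t = 0 := by
      by_contra ht
      refine hc (-(t⁻¹ * s)) ?_
      rw [neg_smul, mul_smul, ← smul_neg, ← eq_neg_of_add_eq_zero_right hst, inv_smul_smul₀ ht]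
    rw [ht, zero_smul, add_zero] at hst
    exact ⟨(smul_eq_zero.mp hst).resolve_right hy, ht⟩
  obtain ⟨s₀, t₀, hne₀, h₀⟩ := exists_mem_span_pair_mulVec_eq_zero (hw i) (h i) (h' i)
  obtain ⟨s₁, t₁, hne₁, h₁⟩ := exists_mem_span_pair_mulVec_eq_zero (hw j) (h j) (h' j)
  obtain ⟨s₂, t₂, hne₂, h₂⟩ := exists_mem_span_pair_mulVec_eq_zero (hw k) (h k) (h' k)
  obtain ⟨-, hv⟩ := hk ((s₁ * t₂ - s₂ * t₁) • (s₀ • y + t₀ • y'))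
    ((s₂ * t₀ - s₀ * t₂) • (s₁ • y + t₁ • y')) (by rw [Matrix.mulVec_smul, h₀, smul_zero])
    (by rw [Matrix.mulVec_smul, h₁, smul_zero]) (by
      have : (s₁ * t₂ - s₂ * t₁) • (s₀ • y + t₀ • y') + (s₂ * t₀ - s₀ * t₂) • (s₁ • y + t₁ • y') =
          -((s₀ * t₁ - s₁ * t₀) • (s₂ • y + t₂ • y')) := by
        module
      rw [this, Matrix.mulVec_neg, Matrix.mulVec_smul, h₂, smul_zero, neg_zero])
  have hz₁ : s₁ • y + t₁ • y' ≠ 0 := fun h => by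
    obtain ⟨hs, ht⟩ := hli _ _ h
    exact hne₁.elim (· hs) (· ht)
  have hdet := (smul_eq_zero.mp hv).resolve_right hz₁
  have key : ∀ r : ℂ, r ≠ 0 → ∀ r' : ℂ,
      r • (s₀ • y + t₀ • y') = r' • (s₂ • y + t₂ • y') → False := by
    intro r hr r' h
    have h0 := hik (r • (s₀ • y + t₀ • y')) (by rw [Matrix.mulVec_smul, h₀, smul_zero])
      (by rw [h, Matrix.mulVec_smul, h₂, smul_zero])
    obtain ⟨hs, ht⟩ := hli _ _ ((smul_eq_zero.mp h0).resolve_left hr)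
    exact hne₀.elim (· hs) (· ht)
  rcases hne₂ with hs | ht
  · refine key s₂ hs s₀ ?_
    have : t₀ * s₂ = s₀ * t₂ := by linear_combination hdet
    rw [smul_add, smul_add, smul_smul, smul_smul, smul_smul, smul_smul, mul_comm s₂ s₀,
      mul_comm s₂ t₀, this]
  · refine key t₂ ht t₀ ?_
    have : t₂ * s₀ = t₀ * s₂ := by linear_combination -hdet
    rw [smul_add, smul_add, smul_smul, smul_smul, smul_smul, smul_smul, this, mul_comm t₂ t₀]

theorem generically₂_genPos_adjCam (hn : 3 ≤ n) :
    Generically₂ fun a c => GenPos fun i : Fin n => adjCam (Sum.elim a c) i := by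
  have := finite_setOf_sq_eq_neg_one
  have four : Generically₂ fun a c => ∀ i j k l : Fin n, i ≠ j → i ≠ k → i ≠ l → j ≠ k → j ≠ l →
      k ≠ l → _ :=
    Generically₂.all fun i => .all fun j => .all fun k => .all fun l => .imp fun hij =>
      .imp fun hik => .imp fun hil => .imp fun hjk => .imp fun hjl => .imp fun hkl =>
        generically₂_four_forms ![i, j, k, l] 0 (fun _ => ![1, 0, 0]) (by
          simp [Fin.forall_fin_succ, hij, hik, hil, hjk, hjl, hkl, hij.symm, hik.symm, hil.symm,
            hjk.symm, hjl.symm, hkl.symm])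
  have center : Generically₂ fun a c => ∀ i j : Fin n, i ≠ j → _ :=
    Generically₂.all fun i => .all fun j => .imp fun hij =>
      generically₂_four_forms ![i, j, j, j] ![0, 0, 1, 2]
        ![![1, 0, 0], ![1, 0, 0], ![0, 1, 0], ![0, 0, 1]] (by
          simp [Fin.forall_fin_succ, hij, hij.symm])
  have quad : Generically₂ fun a c => ∀ i j : Fin n, i ≠ j → ∀ ε ε' : {ε : ℂ // ε ^ 2 = -1}, _ :=
    Generically₂.all fun i => .all fun j => .imp fun hij => .all fun ε => .all fun ε' =>
      generically₂_four_forms ![i, j, i, j] ![0, 0, 1, 1]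
        ![![1, 0, 0], ![1, 0, 0], ![0, 1, ε], ![0, 1, ε']] (by
          simp [Fin.forall_fin_succ, hij, hij.symm])
  have triple : Generically₂ fun a c => ∀ i j k : Fin n, i ≠ j → i ≠ k → j ≠ k →
      ∀ ε : {ε : ℂ // ε ^ 2 = -1}, _ :=
    Generically₂.all fun i => .all fun j => .all fun k => .imp fun hij => .imp fun hik =>
      .imp fun hjk => .all fun ε =>
        generically₂_four_forms ![i, j, k, i] ![0, 0, 0, 1]
          ![![1, 0, 0], ![1, 0, 0], ![1, 0, 0], ![0, 1, ε]] (by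
            simp [Fin.forall_fin_succ, hij, hij.symm, hik, hik.symm, hjk, hjk.symm])
  have kernels := generically₂_kernels (n := n) (i := ⟨0, by omega⟩) (j := ⟨1, by omega⟩)
    (k := ⟨2, by omega⟩) (by simp) (by simp) (by simp)
  refine ((four.and center).and ((quad.and triple).and kernels)).mono fun a c h => ?_
  obtain ⟨⟨h4, hc⟩, ⟨hq, h3⟩, hk⟩ := h
  have center' : ∀ i j : Fin n, i ≠ j → ∀ y, (adjCam (Sum.elim a c) i).mulVec y 0 = 0 →
      (adjCam (Sum.elim a c) j).mulVec y = 0 → y = 0 := fun i j hij y h1 h2 =>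
    hc i j hij y (by
      simp [Fin.forall_fin_succ, Matrix.vecHead, h1, h2])
  refine ⟨fun i j k l hij hik hil hjk hjl hkl y h1 h2 h3 h4' => ?_, center',
    fun i j hij ε ε' hε hε' y h1 h2 h3 h4 => ?_, fun i j k hij hik hjk ε hε y h1 h2 h3' h4 => ?_,
    fun w hw y y' hy h h' => ?_⟩
  · exact h4 i j k l hij hik hil hjk hjl hkl y (by
      simp [Fin.forall_fin_succ, Matrix.vecHead, h1, h2, h3, h4'])
  · exact hq i j hij ⟨ε, hε⟩ ⟨ε', hε'⟩ y (by
      simp [Fin.forall_fin_succ, dotProduct, Fin.sum_univ_three, h1, h2, h3, h4])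
  · exact h3 i j k hij hik hjk ⟨ε, hε⟩ y (by
      simp [Fin.forall_fin_succ, dotProduct, Fin.sum_univ_three, h1, h2, h3', h4])
  · exact fiber_of_kernels (fun y h1 h2 => center' _ _ (by simp) y (congrFun h1 0) h2) hk hw hy h h'

theorem generically₂_genPos (hn : 3 ≤ n) : Generically₂ fun a c =>
    (∀ i, IsUnit (chartOf c i).det) →
      GenPos fun i : Fin n => (chartOf c i)⁻¹ * camOfC a i := by
  refine (generically₂_genPos_adjCam hn).mono fun a c h hdet => ?_
  have : (fun i => (chartOf c i)⁻¹ * camOfC a i) =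
      fun i => Ring.inverse (chartOf c i).det • adjCam (Sum.elim a c) i := funext fun i => by
    rw [Matrix.inv_def, Matrix.smul_mul]
    rfl
  rw [this]
  exact h.smul fun l => by
    rw [Ring.inverse_eq_inv']
    exact inv_ne_zero (hdet l).ne_zero

end CameraGenericity

section Strata

variable {n : ℕ} {A B : Fin n → Matrix (Fin 3) (Fin 4) ℂ} {C : Fin n → Matrix (Fin 3) (Fin 3) ℂ}
  {β : Fin (2 * n + 1) → ℂ}

/-- The genericity conditions on the cameras `A`, the charts `C` and the quadric `β` under which
the stratification is studied; `B` are the cameras in chart coordinates. -/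
structure Config (A B : Fin n → Matrix (Fin 3) (Fin 4) ℂ) (C : Fin n → Matrix (Fin 3) (Fin 3) ℂ)
    (β : Fin (2 * n + 1) → ℂ) : Prop where
  three_le : 3 ≤ n
  det : ∀ l, IsUnit (C l).det
  mul : ∀ l, A l = C l * B l
  pos : GenPos B
  quadric : GenQuadric B (bOf β) (β 0)

/-- A nonzero vector of `ℂ⁴` mapped to infinity by the cameras `i` and `j`. -/
structure Cross (B : Fin n → Matrix (Fin 3) (Fin 4) ℂ) (i j : Fin n) (y : Fin 4 → ℂ) : Prop where
  index_ne : i ≠ j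
  ne_zero : y ≠ 0
  left : camL B y i 0 = 0
  right : camL B y j 0 = 0

theorem Cross.symm {i j : Fin n} {y : Fin 4 → ℂ} (h : Cross B i j y) : Cross B j i y :=
  ⟨h.index_ne.symm, h.ne_zero, h.right, h.left⟩

theorem Cross.camL_ne_zero {i j : Fin n} {y : Fin 4 → ℂ} (h : Cross B i j y) (hB : GenPos B)
    (l : Fin n) : camL B y l ≠ 0 := by
  intro hl
  rcases eq_or_ne i l with rfl | hil
  · exact h.ne_zero (hB.center j i h.index_ne.symm y h.right hl)
  · exact h.ne_zero (hB.center i l hil y h.left hl)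

theorem Cross.eq_or_eq_or_eq {i j k l : Fin n} {y : Fin 4 → ℂ} (h : Cross B i j y) (hB : GenPos B)
    (hik : i ≠ k) (hjk : j ≠ k) (hk : camL B y k 0 = 0) (hl : camL B y l 0 = 0) :
    l = i ∨ l = j ∨ l = k := by
  by_contra! hne
  exact h.ne_zero (hB.four i j k l h.index_ne hik hne.1.symm hjk hne.2.1.symm hne.2.2.symm y
    h.left h.right hk hl)

theorem Config.pt_camL_mem_mvVariety (h : Config A B C β) {y : Fin 4 → ℂ}
    (hy : ∀ l, camL B y l ≠ 0) : pt C (camL B y) ∈ mvVariety A :=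
  pt_camL_mem h.det h.mul (by have := h.three_le; omega) hy

theorem Config.pt_camL_mem_Dinf_iff (h : Config A B C β) {y : Fin 4 → ℂ}
    (hy : ∀ l, camL B y l ≠ 0) (m : Fin n) :
    pt C (camL B y) ∈ Dinf A C m ↔ camL B y m 0 = 0 := by
  rw [pt_mem_Dinf_iff h.det hy]
  exact and_iff_right (h.pt_camL_mem_mvVariety hy)

theorem Config.exists_incident (h : Config A B C β) {P : Fin n → P2} (hP : P ∈ mvVariety A) :
    ∃ w y, (∀ l, w l ≠ 0) ∧ y ≠ 0 ∧ pt C w = P ∧ ∀ l, ∃ c : ℂ, camL B y l = c • w l := by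
  obtain ⟨w, hw, rfl⟩ := exists_pt_eq h.det P
  obtain ⟨y, hy, hin⟩ := (pt_mem_mvVariety_iff h.pos h.det h.mul (by have := h.three_le; omega)
    hw).1 hP
  exact ⟨w, y, hw, hy, rfl, fun l => (par_iff (hw l)).1 (hin l)⟩

theorem Config.pt_camL_eq (h : Config A B C β) {w : Fin n → Fin 3 → ℂ} {y : Fin 4 → ℂ}
    (hw : ∀ l, w l ≠ 0) (hy : ∀ l, camL B y l ≠ 0) (hin : ∀ l, ∃ c : ℂ, camL B y l = c • w l) :
    pt C w = pt C (camL B y) := by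
  refine (pt_eq_pt_iff h.det hw hy).2 fun l => ?_
  obtain ⟨c, hc⟩ := hin l
  refine ⟨c, ?_, hc⟩
  rintro rfl
  exact hy l (by rw [hc, zero_smul])

theorem Config.exists_cross (h : Config A B C β) {i j : Fin n} (hij : i ≠ j) {P : Fin n → P2}
    (hi : P ∈ Dinf A C i) (hj : P ∈ Dinf A C j) :
    ∃ y, Cross B i j y ∧ (∀ l, camL B y l ≠ 0) ∧ P = pt C (camL B y) := by
  obtain ⟨w, y, hw, hy, rfl, hin⟩ := h.exists_incident hi.1
  have hz : ∀ m, pt C w ∈ Dinf A C m → camL B y m 0 = 0 := fun m hm => by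
    obtain ⟨c, hc⟩ := hin m
    rw [hc, Pi.smul_apply, ((pt_mem_Dinf_iff h.det hw m).1 hm).2, smul_zero]
  have hcr : Cross B i j y := ⟨hij, hy, hz i hi, hz j hj⟩
  exact ⟨y, hcr, hcr.camL_ne_zero h.pos, h.pt_camL_eq hw (hcr.camL_ne_zero h.pos) hin⟩

theorem Config.mem_Dinf_three (h : Config A B C β) {i j k l : Fin n} (hij : i ≠ j) (hik : i ≠ k)
    (hjk : j ≠ k) {P : Fin n → P2} (hi : P ∈ Dinf A C i) (hj : P ∈ Dinf A C j)
    (hk : P ∈ Dinf A C k) (hl : P ∈ Dinf A C l) : l = i ∨ l = j ∨ l = k := by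
  obtain ⟨y, hcr, hy, rfl⟩ := h.exists_cross hij hi hj
  exact hcr.eq_or_eq_or_eq h.pos hik hjk ((h.pt_camL_mem_Dinf_iff hy k).1 hk)
    ((h.pt_camL_mem_Dinf_iff hy l).1 hl)

theorem gS_eq_zero_of_cross {b : Fin n → Fin 2 → ℂ} {β₀ : ℂ} {i j : Fin n} (hij : i ≠ j)
    {w : Fin n → Fin 3 → ℂ} (hi : w i 0 = 0) (hj : w j 0 = 0) : gS b β₀ Finset.univ w = 0 := by
  rw [gS_univ_eq i, hi, Finset.prod_eq_zero (i := j) (by simp [hij.symm]) (by simp [hj])]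
  simp

theorem Config.mem_HQ_of_cross (h : Config A B C β) {i j : Fin n} (hij : i ≠ j) {P : Fin n → P2}
    (hi : P ∈ Dinf A C i) (hj : P ∈ Dinf A C j) : P ∈ HQ C β := by
  obtain ⟨y, hcr, hy, rfl⟩ := h.exists_cross hij hi hj
  exact (pt_mem_HQ_iff h.det β hy).2 (gS_eq_zero_of_cross hij hcr.left hcr.right)

theorem edgeCore_eq (i j : Fin n) (hij : i ≠ j) :
    edgeCore A C i j = {P | ∀ m, P ∈ Dinf A C m ↔ m = i ∨ m = j} := by
  ext P
  simp only [edgeCore, Set.mem_sdiff, Set.mem_inter_iff, Set.mem_iUnion, not_exists,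
    Set.mem_ofPred_eq]
  constructor
  · rintro ⟨⟨hi, hj⟩, hk⟩ m
    refine ⟨fun hm => ?_, ?_⟩
    · by_contra! hne
      exact hk m hne hm
    · rintro (rfl | rfl) <;> assumption
  · intro hP
    refine ⟨⟨(hP i).2 (Or.inl rfl), (hP j).2 (Or.inr rfl)⟩, fun k hk hm => ?_⟩
    rcases (hP k).1 hm with h' | h'
    exacts [hk.1 h', hk.2 h']

theorem strat1_eq (i j : Fin n) (hij : i ≠ j) :
    strat1 A C β i j = {P | (∀ m, P ∈ Dinf A C m ↔ m = i ∨ m = j) ∧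
      ∃ m, (m = i ∨ m = j) ∧ QuadCondAt C β m (P m)} := by
  rw [strat1, edgeCore_eq i j hij]
  ext P
  simp [or_and_right, exists_or]

theorem strat0_eq (i j : Fin n) (hij : i ≠ j) :
    strat0 A C β i j = {P | (∀ m, P ∈ Dinf A C m ↔ m = i ∨ m = j) ∧
      ¬ ∃ m, (m = i ∨ m = j) ∧ QuadCondAt C β m (P m)} := by
  rw [strat0, strat1_eq i j hij, edgeCore_eq i j hij]
  ext P
  simp only [Set.mem_sdiff, Set.mem_ofPred_eq]
  exact ⟨fun h => ⟨h.1, fun h' => h.2 ⟨h.1, h'⟩⟩, fun h => ⟨h.1, fun h' => h.2 h'.2⟩⟩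

theorem Config.strat3_eq (h : Config A B C β) {i j k : Fin n} (hij : i ≠ j) (hik : i ≠ k)
    (hjk : j ≠ k) :
    strat3 A C i j k = {P | ∀ m, P ∈ Dinf A C m ↔ m = i ∨ m = j ∨ m = k} := by
  ext P
  simp only [strat3, Set.mem_inter_iff, Set.mem_ofPred_eq]
  constructor
  · rintro ⟨⟨hi, hj⟩, hk⟩ m
    refine ⟨h.mem_Dinf_three hij hik hjk hi hj hk, ?_⟩
    rintro (rfl | rfl | rfl) <;> assumption
  · intro hP
    simp [hP]

theorem mem_stratSm_iff {P : Fin n → P2} : P ∈ stratSm A C β ↔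
    P ∈ DQ A C β ∧ ∀ i j, i ≠ j → P ∈ Dinf A C i → P ∉ Dinf A C j := by
  simp only [stratSm, Set.mem_sdiff, Set.mem_iUnion, Set.mem_inter_iff, not_exists, not_and]

theorem Config.iUnion_strata (h : Config A B C β) :
    (⋃ S ∈ {S | IsStratumOf A C β S}, S) = DQ A C β := by
  ext P
  simp only [Set.mem_iUnion, Set.mem_ofPred_eq, exists_prop]
  constructor
  · rintro ⟨S, rfl | ⟨i, j, hij, rfl⟩ | ⟨i, j, hij, rfl⟩ | ⟨i, j, k, hij, -, -, rfl⟩, hP⟩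
    · exact hP.1
    · exact ⟨hP.1.1.1.1, h.mem_HQ_of_cross hij hP.1.1.1 hP.1.1.2⟩
    · exact ⟨hP.1.1.1.1, h.mem_HQ_of_cross hij hP.1.1.1 hP.1.1.2⟩
    · exact ⟨hP.1.1.1, h.mem_HQ_of_cross hij hP.1.1 hP.1.2⟩
  · intro hP
    by_cases hSm : P ∈ stratSm A C β
    · exact ⟨_, Or.inl rfl, hSm⟩
    rw [mem_stratSm_iff] at hSm
    push Not at hSm
    obtain ⟨i, j, hij, hi, hj⟩ := hSm hP
    by_cases h3 : ∃ k, (k ≠ i ∧ k ≠ j) ∧ P ∈ Dinf A C k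
    · obtain ⟨k, ⟨hki, hkj⟩, hk⟩ := h3
      exact ⟨_, Or.inr (Or.inr (Or.inr ⟨i, j, k, hij, hki.symm, hkj.symm, rfl⟩)), ⟨hi, hj⟩, hk⟩
    have hE : P ∈ edgeCore A C i j := ⟨⟨hi, hj⟩, by simpa using h3⟩
    by_cases h1 : P ∈ strat1 A C β i j
    · exact ⟨_, Or.inr (Or.inr (Or.inl ⟨i, j, hij, rfl⟩)), h1⟩
    · exact ⟨_, Or.inr (Or.inl ⟨i, j, hij, rfl⟩), hE, h1⟩

theorem pair_ne_triple {i j k l m : Fin n} (hkl : k ≠ l) (hkm : k ≠ m) (hlm : l ≠ m)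
    (h : ∀ a, (a = i ∨ a = j) ↔ (a = k ∨ a = l ∨ a = m)) : False := by
  have hk := (h k).2 (by simp)
  have hl := (h l).2 (by simp)
  have hm := (h m).2 (by simp)
  grind

theorem Config.eq_of_mem_of_mem (h : Config A B C β) {S T : Set (Fin n → P2)}
    (hS : IsStratumOf A C β S) (hT : IsStratumOf A C β T) {P : Fin n → P2} (hPS : P ∈ S)
    (hPT : P ∈ T) : S = T := by
  rcases hS with rfl | ⟨i, j, hij, rfl⟩ | ⟨i, j, hij, rfl⟩ | ⟨i, j, k, hij, hik, hjk, rfl⟩ <;>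
  rcases hT with rfl | ⟨i', j', hij', rfl⟩ | ⟨i', j', hij', rfl⟩ |
    ⟨i', j', k', hij', hik', hjk', rfl⟩
  · rfl
  · exact absurd hPT.1.1.2 ((mem_stratSm_iff.1 hPS).2 _ _ hij' hPT.1.1.1)
  · exact absurd hPT.1.1.2 ((mem_stratSm_iff.1 hPS).2 _ _ hij' hPT.1.1.1)
  · exact absurd hPT.1.2 ((mem_stratSm_iff.1 hPS).2 _ _ hij' hPT.1.1)
  · exact absurd hPS.1.1.2 ((mem_stratSm_iff.1 hPT).2 _ _ hij hPS.1.1.1)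
  · rw [strat0_eq i j hij] at hPS ⊢
    rw [strat0_eq i' j' hij'] at hPT ⊢
    have he : ∀ a, (a = i ∨ a = j) ↔ (a = i' ∨ a = j') := fun a =>
      (hPS.1 a).symm.trans (hPT.1 a)
    simp_rw [he]
  · rw [strat0_eq i j hij] at hPS
    rw [strat1_eq i' j' hij'] at hPT
    have he : ∀ a, (a = i ∨ a = j) ↔ (a = i' ∨ a = j') := fun a =>
      (hPS.1 a).symm.trans (hPT.1 a)
    simp_rw [Set.mem_ofPred_eq, he] at hPS
    exact absurd hPT.2 hPS.2
  · rw [strat0_eq i j hij] at hPS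
    rw [h.strat3_eq hij' hik' hjk'] at hPT
    exact (pair_ne_triple hij' hik' hjk' fun a => (hPS.1 a).symm.trans (hPT a)).elim
  · exact absurd hPS.1.1.2 ((mem_stratSm_iff.1 hPT).2 _ _ hij hPS.1.1.1)
  · rw [strat1_eq i j hij] at hPS
    rw [strat0_eq i' j' hij'] at hPT
    have he : ∀ a, (a = i ∨ a = j) ↔ (a = i' ∨ a = j') := fun a =>
      (hPS.1 a).symm.trans (hPT.1 a)
    simp_rw [Set.mem_ofPred_eq, he] at hPS
    exact absurd hPS.2 hPT.2
  · rw [strat1_eq i j hij] at hPS ⊢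
    rw [strat1_eq i' j' hij'] at hPT ⊢
    have he : ∀ a, (a = i ∨ a = j) ↔ (a = i' ∨ a = j') := fun a =>
      (hPS.1 a).symm.trans (hPT.1 a)
    simp_rw [he]
  · rw [strat1_eq i j hij] at hPS
    rw [h.strat3_eq hij' hik' hjk'] at hPT
    exact (pair_ne_triple hij' hik' hjk' fun a => (hPS.1 a).symm.trans (hPT a)).elim
  · exact absurd hPS.1.2 ((mem_stratSm_iff.1 hPT).2 _ _ hij hPS.1.1)
  · rw [h.strat3_eq hij hik hjk] at hPS
    rw [strat0_eq i' j' hij'] at hPT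
    exact (pair_ne_triple hij hik hjk fun a => (hPT.1 a).symm.trans (hPS a)).elim
  · rw [h.strat3_eq hij hik hjk] at hPS
    rw [strat1_eq i' j' hij'] at hPT
    exact (pair_ne_triple hij hik hjk fun a => (hPT.1 a).symm.trans (hPS a)).elim
  · rw [h.strat3_eq hij hik hjk] at hPS ⊢
    rw [h.strat3_eq hij' hik' hjk'] at hPT ⊢
    have he : ∀ a, (a = i ∨ a = j ∨ a = k) ↔ (a = i' ∨ a = j' ∨ a = k') := fun a =>
      (hPS a).symm.trans (hPT a)
    simp_rw [he]

theorem isLocClosed_sdiff {X : Type} [TopologicalSpace X] {S T : Set X} (hS : IsClosed S)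
    (hT : IsClosed T) : IsLocClosed (S \ T) :=
  ⟨Tᶜ, S, hT.isOpen_compl, hS, by rw [Set.inter_comm]; rfl⟩

theorem isClosed_DQ : IsClosed (DQ A C β) := isClosed_closure.inter isClosed_closure

theorem isClosed_iUnion_Dinf (hC : ∀ l, IsUnit (C l).det) :
    IsClosed (⋃ (i : Fin n), ⋃ (j : Fin n), ⋃ (_ : i ≠ j), (Dinf A C i ∩ Dinf A C j)) :=
  isClosed_iUnion_of_finite fun i => isClosed_iUnion_of_finite fun j =>
    isClosed_iUnion_of_finite fun _ => (isClosed_Dinf hC i).inter (isClosed_Dinf hC j)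

theorem isClosed_iUnion_Dinf_of_ne (hC : ∀ l, IsUnit (C l).det) (i j : Fin n) :
    IsClosed (⋃ (k : Fin n), ⋃ (_ : k ≠ i ∧ k ≠ j), Dinf A C k) :=
  isClosed_iUnion_of_finite fun k => isClosed_iUnion_of_finite fun _ => isClosed_Dinf hC k

theorem isClosed_quadCond (hC : ∀ l, IsUnit (C l).det) (i j : Fin n) :
    IsClosed {P : Fin n → P2 | QuadCondAt C β i (P i) ∨ QuadCondAt C β j (P j)} :=
  (isClosed_setOf_quadCondAt hC β i).union (isClosed_setOf_quadCondAt hC β j)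

theorem strat0_eq_sdiff (i j : Fin n) : strat0 A C β i j = (Dinf A C i ∩ Dinf A C j) \
    ((⋃ (k : Fin n), ⋃ (_ : k ≠ i ∧ k ≠ j), Dinf A C k) ∪
      {P : Fin n → P2 | QuadCondAt C β i (P i) ∨ QuadCondAt C β j (P j)}) := by
  ext P
  simp only [strat0, strat1, edgeCore, Set.mem_sdiff, Set.mem_union, Set.mem_ofPred_eq]
  tauto

theorem Config.isLocClosed (h : Config A B C β) {S : Set (Fin n → P2)}
    (hS : IsStratumOf A C β S) : IsLocClosed S := by
  rcases hS with rfl | ⟨i, j, hij, rfl⟩ | ⟨i, j, hij, rfl⟩ | ⟨i, j, k, hij, hik, hjk, rfl⟩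
  · exact isLocClosed_sdiff isClosed_DQ (isClosed_iUnion_Dinf h.det)
  · rw [strat0_eq_sdiff]
    exact isLocClosed_sdiff ((isClosed_Dinf h.det i).inter (isClosed_Dinf h.det j))
      ((isClosed_iUnion_Dinf_of_ne h.det i j).union (isClosed_quadCond h.det i j))
  · have : strat1 A C β i j = ((Dinf A C i ∩ Dinf A C j) ∩
        {P : Fin n → P2 | QuadCondAt C β i (P i) ∨ QuadCondAt C β j (P j)}) \
        ⋃ (k : Fin n), ⋃ (_ : k ≠ i ∧ k ≠ j), Dinf A C k := by
      ext P
      simp only [strat1, edgeCore, Set.mem_sdiff, Set.mem_inter_iff, Set.mem_ofPred_eq]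
      tauto
    rw [this]
    exact isLocClosed_sdiff (((isClosed_Dinf h.det i).inter (isClosed_Dinf h.det j)).inter
      (isClosed_quadCond h.det i j)) (isClosed_iUnion_Dinf_of_ne h.det i j)
  · rw [← Set.sdiff_empty (s := strat3 A C i j k)]
    exact isLocClosed_sdiff (((isClosed_Dinf h.det i).inter (isClosed_Dinf h.det j)).inter
      (isClosed_Dinf h.det k)) isClosed_empty

end Strata

section FiniteStrata

variable {n : ℕ} {A B : Fin n → Matrix (Fin 3) (Fin 4) ℂ} {C : Fin n → Matrix (Fin 3) (Fin 3) ℂ}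
  {β : Fin (2 * n + 1) → ℂ}

theorem exists_ne_zero_of_three_forms (ξ : Fin 3 → (Fin 4 → ℂ) →L[ℂ] ℂ) :
    ∃ y : Fin 4 → ℂ, y ≠ 0 ∧ ∀ a, ξ a y = 0 := by
  have hlt : Module.finrank ℂ (Fin 3 → ℂ) < Module.finrank ℂ (Fin 4 → ℂ) := by simp
  obtain ⟨y, hy, hy0⟩ := Submodule.exists_mem_ne_zero_of_ne_bot
    (LinearMap.ker_ne_bot_of_finrank_lt
      (f := LinearMap.pi fun a => (ξ a : (Fin 4 → ℂ) →ₗ[ℂ] ℂ)) hlt)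
  exact ⟨y, hy0, fun a => congrFun (LinearMap.mem_ker.1 hy) a⟩

theorem exists_eq_smul_of_forms {m : ℕ} {ξ : Fin m → (Fin 4 → ℂ) →L[ℂ] ℂ}
    {g : (Fin 4 → ℂ) →L[ℂ] ℂ} (h : ∀ v, (∀ a, ξ a v = 0) → g v = 0 → v = 0) {y v : Fin 4 → ℂ}
    (hy0 : y ≠ 0) (hy : ∀ a, ξ a y = 0) (hv : ∀ a, ξ a v = 0) : ∃ c : ℂ, v = c • y := by
  have hg : g y ≠ 0 := fun h0 => hy0 (h y hy h0)
  refine ⟨g v / g y, sub_eq_zero.1 (h _ (fun a => ?_) ?_)⟩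
  · simp [hy a, hv a]
  · simp [hg]

/-- The linear form `y ↦ (Bᵢy)₁ + ε (Bᵢy)₂`. -/
def isoForm (B : Fin n → Matrix (Fin 3) (Fin 4) ℂ) (i : Fin n) (ε : ℂ) : (Fin 4 → ℂ) →L[ℂ] ℂ :=
  rowForm B i 1 + ε • rowForm B i 2

theorem isoForm_apply (i : Fin n) (ε : ℂ) (y : Fin 4 → ℂ) :
    isoForm B i ε y = camL B y i 1 + ε * camL B y i 2 := rfl

theorem nq_eq_isoForm_mul (b : Fin 2 → ℂ) {i : Fin n} {y : Fin 4 → ℂ} (h : camL B y i 0 = 0)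
    {ε : ℂ} (hε : ε ^ 2 = -1) :
    nq b (camL B y i) = isoForm B i ε y * isoForm B i (-ε) y := by
  rw [nq_of_zero h, isoForm_apply, isoForm_apply]
  linear_combination (camL B y i 2) ^ 2 * hε

theorem GenPos.eq_zero_of_quad (hB : GenPos B) {i j : Fin n} (hij : i ≠ j) {ε ε' : ℂ}
    (hε : ε ^ 2 = -1) (hε' : ε' ^ 2 = -1) {y : Fin 4 → ℂ} (hi : camL B y i 0 = 0)
    (hj : camL B y j 0 = 0) (h : isoForm B i ε y = 0) (h' : isoForm B j ε' y = 0) : y = 0 :=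
  hB.quad i j hij ε ε' hε hε' y hi hj h h'

theorem GenPos.eq_zero_of_triple (hB : GenPos B) {i j k : Fin n} (hij : i ≠ j) (hik : i ≠ k)
    (hjk : j ≠ k) {ε : ℂ} (hε : ε ^ 2 = -1) {y : Fin 4 → ℂ} (hi : camL B y i 0 = 0)
    (hj : camL B y j 0 = 0) (hk : camL B y k 0 = 0) (h : isoForm B i ε y = 0) : y = 0 :=
  hB.triple i j k hij hik hjk ε hε y hi hj hk h

theorem Config.strat3_eq_singleton (h : Config A B C β) {i j k : Fin n} (hij : i ≠ j)
    (hik : i ≠ k) (hjk : j ≠ k) : ∃ P, strat3 A C i j k = {P} := by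
  obtain ⟨y, hy0, hy⟩ := exists_ne_zero_of_three_forms
    ![rowForm B i 0, rowForm B j 0, rowForm B k 0]
  have hi : camL B y i 0 = 0 := hy 0
  have hj : camL B y j 0 = 0 := hy 1
  have hk : camL B y k 0 = 0 := hy 2
  have hc := (Cross.mk hij hy0 hi hj).camL_ne_zero h.pos
  refine ⟨pt C (camL B y), Set.Subset.antisymm ?_ ?_⟩
  · rintro P ⟨⟨hPi, hPj⟩, hPk⟩
    obtain ⟨v, hv, hvc, rfl⟩ := h.exists_cross hij hPi hPj
    have hvk := (h.pt_camL_mem_Dinf_iff hvc k).1 hPk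
    obtain ⟨c, rfl⟩ := exists_eq_smul_of_forms
      (ξ := ![rowForm B i 0, rowForm B j 0, rowForm B k 0]) (g := isoForm B i Complex.I)
      (fun v hv hg => h.pos.eq_zero_of_triple hij hik hjk Complex.I_sq (hv 0) (hv 1) (hv 2) hg)
      hy0 hy (v := v) (by
        intro a
        fin_cases a
        exacts [hv.left, hv.right, hvk])
    have hc0 : c ≠ 0 := by
      rintro rfl
      exact hv.ne_zero (zero_smul _ _)
    exact pt_camL_smul h.det hc0 hc
  · rintro _ rfl
    exact ⟨⟨(h.pt_camL_mem_Dinf_iff hc i).2 hi, (h.pt_camL_mem_Dinf_iff hc j).2 hj⟩,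
      (h.pt_camL_mem_Dinf_iff hc k).2 hk⟩

theorem strat1_comm (i j : Fin n) : strat1 A C β i j = strat1 A C β j i := by
  ext P
  simp only [strat1, edgeCore, Set.mem_ofPred_eq, Set.mem_sdiff, and_comm (b := _ ≠ j),
    Set.inter_comm (Dinf A C i), or_comm (a := QuadCondAt C β i (P i))]

theorem Config.quadCondAt_iff (h : Config A B C β) {i j : Fin n} {y : Fin 4 → ℂ}
    (hy : Cross B i j y) {ε : ℂ} (hε : ε ^ 2 = -1) :
    QuadCondAt C β i (pt C (camL B y) i) ↔ isoForm B i ε y = 0 ∨ isoForm B i (-ε) y = 0 := by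
  rw [quadCondAt_pt_iff h.det β (hy.camL_ne_zero h.pos), nq_eq_isoForm_mul _ hy.left hε,
    mul_eq_zero]

theorem Config.exists_isoPoint (h : Config A B C β) {i j : Fin n} (hij : i ≠ j) {ε : ℂ}
    (hε : ε ^ 2 = -1) : ∃ y, Cross B i j y ∧ isoForm B i ε y = 0 ∧
      pt C (camL B y) ∈ strat1 A C β i j ∧ ∀ v, Cross B i j v → isoForm B i ε v = 0 →
        pt C (camL B v) = pt C (camL B y) := by
  obtain ⟨y, hy0, hy⟩ := exists_ne_zero_of_three_forms
    ![rowForm B i 0, rowForm B j 0, isoForm B i ε]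
  have hi : camL B y i 0 = 0 := hy 0
  have hj : camL B y j 0 = 0 := hy 1
  have hq : isoForm B i ε y = 0 := hy 2
  have hcr : Cross B i j y := ⟨hij, hy0, hi, hj⟩
  have hc := hcr.camL_ne_zero h.pos
  refine ⟨y, hcr, hq, ⟨⟨⟨(h.pt_camL_mem_Dinf_iff hc i).2 hi,
    (h.pt_camL_mem_Dinf_iff hc j).2 hj⟩, ?_⟩, Or.inl ((h.quadCondAt_iff hcr hε).2 (Or.inl hq))⟩,
    fun v hv hvq => ?_⟩
  · simp only [Set.mem_iUnion, not_exists]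
    rintro k ⟨hki, hkj⟩ hk
    exact hy0 (h.pos.eq_zero_of_triple hij hki.symm hkj.symm hε hi hj
      ((h.pt_camL_mem_Dinf_iff hc k).1 hk) hq)
  · obtain ⟨c, rfl⟩ := exists_eq_smul_of_forms
      (ξ := ![rowForm B i 0, rowForm B j 0, isoForm B i ε]) (g := isoForm B j Complex.I)
      (fun v hv hg => h.pos.eq_zero_of_quad hij hε Complex.I_sq (hv 0) (hv 1) (hv 2) hg)
      hy0 hy (v := v) (by
        intro a
        fin_cases a
        exacts [hv.left, hv.right, hvq])
    have hc0 : c ≠ 0 := by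
      rintro rfl
      exact hv.ne_zero (zero_smul _ _)
    exact pt_camL_smul h.det hc0 hc

theorem Config.isoForm_eq_zero_of_pt_eq (h : Config A B C β) {i j : Fin n} {y v : Fin 4 → ℂ}
    (hy : Cross B i j y) (hv : Cross B i j v) (he : pt C (camL B y) = pt C (camL B v)) {l : Fin n}
    {ε : ℂ} (hl : isoForm B l ε v = 0) : isoForm B l ε y = 0 := by
  obtain ⟨c, hc, hcl⟩ := (pt_eq_pt_iff h.det (hy.camL_ne_zero h.pos) (hv.camL_ne_zero h.pos)).1 he l
  rw [isoForm_apply, hcl, Pi.smul_apply, Pi.smul_apply, smul_eq_mul, smul_eq_mul] at hl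
  rw [isoForm_apply]
  refine (mul_eq_zero.1 ?_).resolve_left hc
  linear_combination hl

theorem Cross.isoForm_neg_ne_zero {i j : Fin n} {y : Fin 4 → ℂ} (hy : Cross B i j y)
    (hB : GenPos B) {ε : ℂ} (hε : ε ^ 2 = -1) (h : isoForm B i ε y = 0) :
    isoForm B i (-ε) y ≠ 0 := by
  intro h'
  rw [isoForm_apply] at h h'
  have hε0 : ε ≠ 0 := by
    rintro rfl
    norm_num at hε
  refine hy.camL_ne_zero hB i ?_
  ext a
  fin_cases a
  · exact hy.left
  · change camL B y i 1 = 0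
    linear_combination (h + h') / 2
  · change camL B y i 2 = 0
    refine (mul_eq_zero.1 ?_).resolve_left hε0
    linear_combination (h - h') / 2

theorem Config.ncard_strat1 (h : Config A B C β) {i j : Fin n} (hij : i ≠ j) :
    (strat1 A C β i j).ncard = 4 := by
  have hI : Complex.I ^ 2 = -1 := Complex.I_sq
  have hI' : (-Complex.I) ^ 2 = -1 := by rw [neg_sq, hI]
  obtain ⟨y₁, hy₁, hq₁, hm₁, hu₁⟩ := h.exists_isoPoint hij hI
  obtain ⟨y₂, hy₂, hq₂, hm₂, hu₂⟩ := h.exists_isoPoint hij hI'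
  obtain ⟨y₃, hy₃, hq₃, hm₃, hu₃⟩ := h.exists_isoPoint hij.symm hI
  obtain ⟨y₄, hy₄, hq₄, hm₄, hu₄⟩ := h.exists_isoPoint hij.symm hI'
  rw [strat1_comm] at hm₃ hm₄
  have hself : ∀ {i j : Fin n} {y v : Fin 4 → ℂ}, Cross B i j y → Cross B i j v →
      isoForm B i Complex.I y = 0 → isoForm B i (-Complex.I) v = 0 →
      pt C (camL B y) ≠ pt C (camL B v) := fun hy hv hq hq' he =>
    hy.isoForm_neg_ne_zero h.pos hI hq (h.isoForm_eq_zero_of_pt_eq hy hv he hq')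
  have hcross : ∀ {ε ε' : ℂ} {y v : Fin 4 → ℂ}, ε ^ 2 = -1 → ε' ^ 2 = -1 → Cross B i j y →
      Cross B j i v → isoForm B i ε y = 0 → isoForm B j ε' v = 0 →
      pt C (camL B y) ≠ pt C (camL B v) := fun hε hε' hy hv hq hq' he =>
    hy.ne_zero (h.pos.eq_zero_of_quad hij hε hε' hy.left hy.right hq
      (h.isoForm_eq_zero_of_pt_eq hy hv.symm he hq'))
  have heq : strat1 A C β i j = {pt C (camL B y₁), pt C (camL B y₂), pt C (camL B y₃),
      pt C (camL B y₄)} := by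
    refine Set.Subset.antisymm ?_ ?_
    · rintro P ⟨⟨⟨hPi, hPj⟩, -⟩, hq⟩
      obtain ⟨v, hv, hvc, rfl⟩ := h.exists_cross hij hPi hPj
      rw [h.quadCondAt_iff hv hI, h.quadCondAt_iff hv.symm hI] at hq
      simp only [Set.mem_insert_iff, Set.mem_singleton_iff]
      rcases hq with (hq | hq) | hq | hq
      · exact Or.inl (hu₁ v hv hq)
      · exact Or.inr (Or.inl (hu₂ v hv hq))
      · exact Or.inr (Or.inr (Or.inl (hu₃ v hv.symm hq)))
      · exact Or.inr (Or.inr (Or.inr (hu₄ v hv.symm hq)))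
    · rintro P (rfl | rfl | rfl | rfl) <;> assumption
  rw [heq, Set.ncard_insert_of_notMem, Set.ncard_insert_of_notMem, Set.ncard_pair]
  · exact hself hy₃ hy₄ hq₃ hq₄
  · simp only [Set.mem_insert_iff, Set.mem_singleton_iff, not_or]
    exact ⟨hcross hI' hI hy₂ hy₃ hq₂ hq₃, hcross hI' hI' hy₂ hy₄ hq₂ hq₄⟩
  · simp only [Set.mem_insert_iff, Set.mem_singleton_iff, not_or]
    exact ⟨hself hy₁ hy₂ hq₁ hq₂, hcross hI hI hy₁ hy₃ hq₁ hq₃, hcross hI hI' hy₁ hy₄ hq₁ hq₄⟩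

end FiniteStrata

section SmoothStratum

variable {n : ℕ} {A B : Fin n → Matrix (Fin 3) (Fin 4) ℂ} {C : Fin n → Matrix (Fin 3) (Fin 3) ℂ}
  {β : Fin (2 * n + 1) → ℂ} {j : Fin n → Fin 3} {x₀ : Fin n → Fin 2 → ℂ}
  {ψ : (Fin 3 → ℂ) → Fin n → Fin 2 → ℂ} {W : (Fin 3 → ℂ) → Fin n → Fin 3 → ℂ}

theorem eventually_forall_apply_ne_zero (hW : ContinuousAt W 0) (hW0 : ∀ l, W 0 l ≠ 0) :
    ∀ᶠ s in 𝓝 0, ∀ l, W s l ≠ 0 :=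
  hW.eventually (eventually_forall_ne_zero hW0)

theorem Config.eventually_mem_stratSm_iff (h : Config A B C β)
    (hψ : IsLocParam ψ (stdChart j ⁻¹' mvVariety A) x₀) (hW : ContinuousAt W 0)
    (hW0 : ∀ l, W 0 l ≠ 0) (hev : ∀ᶠ s in 𝓝 0, stdChart j (ψ s) = pt C (W s)) :
    ∀ᶠ s in 𝓝 0, stdChart j (ψ s) ∈ stratSm A C β ↔
      gS (bOf β) (β 0) Finset.univ (W s) = 0 ∧ ∀ k l, k ≠ l → W s k 0 = 0 → W s l 0 ≠ 0 := by
  filter_upwards [hψ.eventually_mem, eventually_forall_apply_ne_zero hW hW0, hev] with s h1 h2 h3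
  rw [Set.mem_preimage, h3] at h1
  rw [h3, mem_stratSm_iff, DQ, Set.mem_inter_iff, and_iff_right h1, pt_mem_HQ_iff h.det β h2]
  simp only [pt_mem_Dinf_iff h.det h2, and_iff_right h1, ne_eq]

theorem eventually_not_cross (hW : Continuous W) {s₀ : Fin 3 → ℂ}
    (hs₀ : ∀ k l, k ≠ l → W s₀ k 0 = 0 → W s₀ l 0 ≠ 0) :
    ∀ᶠ s in 𝓝 s₀, ∀ k l, k ≠ l → W s k 0 = 0 → W s l 0 ≠ 0 := by
  have hWc : ∀ l, Continuous fun s => W s l 0 := fun l => (continuous_apply_apply l 0).comp hW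
  refine eventually_all.2 fun k => eventually_all.2 fun l => ?_
  by_cases hkl : k = l
  · exact Eventually.of_forall fun s hne => absurd hkl hne
  by_cases hk : W s₀ k 0 = 0
  · filter_upwards [(hWc l).continuousAt.eventually_ne (hs₀ k l hkl hk)] with s hs _ _
    exact hs
  · filter_upwards [(hWc k).continuousAt.eventually_ne hk] with s hs _ hs'
    exact absurd hs' hs

theorem Config.exists_isLocParam_of_chart (h : Config A B C β)
    (hψ : IsLocParam ψ (stdChart j ⁻¹' mvVariety A) x₀) (hW : ContDiff ℂ 1 W)
    (hW0 : ∀ l, W 0 l ≠ 0) (hev : ∀ᶠ s in 𝓝 0, stdChart j (ψ s) = pt C (W s))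
    (hd : gS (bOf β) (β 0) Finset.univ (W 0) = 0 →
      fderiv ℂ (fun s => gS (bOf β) (β 0) Finset.univ (W s)) 0 ≠ 0)
    (hx : stdChart j x₀ ∈ stratSm A C β) :
    ∃ χ : (Fin 2 → ℂ) → Fin n → Fin 2 → ℂ, IsLocParam χ (stdChart j ⁻¹' stratSm A C β) x₀ := by
  have hiff := h.eventually_mem_stratSm_iff hψ hW.continuous.continuousAt hW0 hev
  have h0 := hiff.self_of_nhds
  rw [hψ.zero] at h0
  obtain ⟨hf0, hcr⟩ := h0.1 hx
  obtain ⟨φ, hφ⟩ := exists_isLocParam_level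
    (f := fun s => gS (bOf β) (β 0) Finset.univ (W s))
    ((contDiff_gS (bOf β) (β 0) Finset.univ).comp hW).contDiffAt hf0 (hd hf0)
  have hcl := eventually_not_cross hW.continuous hcr
  have hS : 𝓝[{s | gS (bOf β) (β 0) Finset.univ (W s) = 0}] (0 : Fin 3 → ℂ) =
      𝓝[ψ ⁻¹' (stdChart j ⁻¹' stratSm A C β)] 0 := by
    refine nhdsWithin_eq_iff_eventuallyEq.2 ?_
    filter_upwards [hiff, hcl] with s h1 h2
    exact propext ⟨fun hs => h1.2 ⟨hs, h2⟩, fun hs => (h1.1 hs).1⟩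
  refine ⟨ψ ∘ φ, ?_⟩
  have := hψ.comp (hφ.congr hS)
  rwa [Set.inter_eq_self_of_subset_right (Set.preimage_mono fun P hP => hP.1.1)] at this

theorem Config.exists_rep (h : Config A B C β) {P : Fin n → P2} (hP : P ∈ mvVariety A) :
    (∃ y, (∀ l, camL B y l ≠ 0) ∧ P = pt C (camL B y)) ∨
      ∃ i c w m, c ≠ 0 ∧ (∀ r, rowForm B i r c = 0) ∧ w m = 1 ∧ P = pt C (cenL B i c w) := by
  obtain ⟨w, y, hw, hy, rfl, hin⟩ := h.exists_incident hP
  by_cases hc : ∀ l, camL B y l ≠ 0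
  · exact Or.inl ⟨y, hc, h.pt_camL_eq hw hc hin⟩
  push Not at hc
  obtain ⟨i, hi⟩ := hc
  obtain ⟨m, hm⟩ : ∃ m, w i m ≠ 0 := by
    by_contra! h0
    exact hw i (funext h0)
  have hic : ∀ r, rowForm B i r y = 0 := fun r => congrFun hi r
  refine Or.inr ⟨i, y, (w i m)⁻¹ • w i, m, hy, hic, by simp [hm], ?_⟩
  have hl0 : ∀ l, l ≠ i → camL B y l ≠ 0 := fun l hl h0 =>
    h.pos.rowForm_center_ne_zero hl hy hic (congrFun h0 0)
  refine (pt_eq_pt_iff h.det hw fun l => ?_).2 fun l => ?_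
  · rcases eq_or_ne l i with rfl | hl
    · rw [cenL_same]
      exact smul_ne_zero (inv_ne_zero hm) (hw l)
    · rw [cenL_of_ne hl]
      exact hl0 l hl
  · rcases eq_or_ne l i with rfl | hl
    · exact ⟨_, inv_ne_zero hm, cenL_same ..⟩
    · obtain ⟨c, hc⟩ := hin l
      refine ⟨c, ?_, (cenL_of_ne hl ..).trans hc⟩
      rintro rfl
      exact hl0 l hl (by rw [hc, zero_smul])

theorem Config.exists_isLocParam_stratSm (h : Config A B C β)
    (hx : stdChart j x₀ ∈ stratSm A C β) :
    ∃ χ : (Fin 2 → ℂ) → Fin n → Fin 2 → ℂ, IsLocParam χ (stdChart j ⁻¹' stratSm A C β) x₀ := by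
  have hn : 2 ≤ n := by have := h.three_le; omega
  rcases h.exists_rep hx.1.1 with ⟨y, hy, hP⟩ | ⟨i, c, w, m, hc, hic, hwm, hP⟩
  · have hy0 : y ≠ 0 := by
      rintro rfl
      exact hy ⟨0, by omega⟩ (by rw [map_zero]; rfl)
    obtain ⟨ξ, ξ₀, u, hfr⟩ := exists_isFrame_of_ne_zero hy0
    obtain ⟨ψ, hψ, hev⟩ := hfr.exists_isLocParam h.pos h.det h.mul hn hy hP
    refine h.exists_isLocParam_of_chart hψ (W := fun s => camL B (y + u s)) (by fun_prop)
      (by simpa using hy) hev (fun hf0 => ?_) hx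
    refine hfr.fderiv_quadF_ne_zero hf0 ?_
    rw [map_zero, add_zero] at hf0 ⊢
    refine h.quadric.fderiv_quadF_ne_zero h.pos hn hy (fun k l hkl hk hl => ?_) hf0
    rw [hP, mem_stratSm_iff] at hx
    exact hx.2 k l hkl ((h.pt_camL_mem_Dinf_iff hy k).2 hk) ((h.pt_camL_mem_Dinf_iff hy l).2 hl)
  · obtain ⟨l, hl⟩ : ∃ l : Fin n, l ≠ i := by
      have : Nontrivial (Fin n) := Fin.nontrivial_iff_two_le.2 hn
      exact exists_ne i
    obtain ⟨ξ₀, u, hfr⟩ := h.pos.exists_isFrame_center hl hc hic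
    have hcl : ∀ l ≠ i, camL B c l ≠ 0 := fun l hl h0 =>
      h.pos.rowForm_center_ne_zero hl hc hic (congrFun h0 0)
    obtain ⟨ψ, hψ, hev⟩ := hfr.exists_isLocParam_center h.pos h.det h.mul hn hcl hwm hP
    have h0 : cenChart B i c u m w 0 = cenL B i c w := by
      simp [cenChart]
    refine h.exists_isLocParam_of_chart hψ (W := cenChart B i c u m w)
      (contDiff_cenChart i c u m w) ?_ hev (fun hf0 => ?_) hx
    · intro l
      rw [h0]
      rcases eq_or_ne l i with rfl | hl
      · rw [cenL_same]
        rintro rfl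
        simp at hwm
      · rw [cenL_of_ne hl]
        exact hcl l hl
    · rw [h0] at hf0
      exact h.quadric.fderiv_cenChart_ne_zero h.pos hc hic u hwm hf0

theorem Config.isSmoothPtP_stratSm (h : Config A B C β) {P : Fin n → P2}
    (hP : P ∈ stratSm A C β) : IsSmoothPtP (stratSm A C β) P 2 := by
  obtain ⟨j, x, rfl⟩ := exists_stdChart_eq P
  obtain ⟨χ, hχ⟩ := h.exists_isLocParam_stratSm hP
  exact ⟨j, x, rfl, hχ.isSmoothGermAt⟩

end SmoothStratum

section EdgeStrata

variable {n : ℕ} {A B : Fin n → Matrix (Fin 3) (Fin 4) ℂ} {C : Fin n → Matrix (Fin 3) (Fin 3) ℂ}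
  {β : Fin (2 * n + 1) → ℂ} {j : Fin n → Fin 3} {x₀ : Fin n → Fin 2 → ℂ}

theorem Cross.exists_isoForm_ne_zero {k l : Fin n} {y : Fin 4 → ℂ} (hy : Cross B k l y)
    (hB : GenPos B) : ∃ ε : ℂ, ε ^ 2 = -1 ∧ isoForm B k ε y ≠ 0 := by
  by_cases h : isoForm B k Complex.I y = 0
  · exact ⟨-Complex.I, by rw [neg_sq, Complex.I_sq],
      hy.isoForm_neg_ne_zero hB Complex.I_sq h⟩
  · exact ⟨_, Complex.I_sq, h⟩

theorem Cross.exists_edgeFrame {k l : Fin n} {y : Fin 4 → ℂ} (hy : Cross B k l y) (hB : GenPos B) :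
    ∃ η ξ₀ u, IsFrame y ![rowForm B k 0, rowForm B l 0, η] ξ₀ u := by
  obtain ⟨ε, hε, hg⟩ := hy.exists_isoForm_ne_zero hB
  let η := isoForm B l Complex.I y • isoForm B k ε - isoForm B k ε y • isoForm B l Complex.I
  have hη : ∀ v, η v = isoForm B l Complex.I y * isoForm B k ε v -
    isoForm B k ε y * isoForm B l Complex.I v := fun v => rfl
  have hy' : ∀ a, (![rowForm B k 0, rowForm B l 0, η] : Fin 3 → (Fin 4 → ℂ) →L[ℂ] ℂ) a y = 0 := by
    intro a
    fin_cases a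
    exacts [hy.left, hy.right, by change η y = 0; rw [hη]; ring]
  obtain ⟨ξ₀, u, h⟩ := exists_isFrame hy.ne_zero ![rowForm B k 0, rowForm B l 0, η] hy'
    fun v hv => exists_eq_smul_of_forms (g := isoForm B k ε) (fun v hv hgv => by
      have h2 := hv 2
      change η v = 0 at h2
      rw [hη, hgv, mul_zero, zero_sub, neg_eq_zero, mul_eq_zero] at h2
      exact hB.eq_zero_of_quad hy.index_ne hε Complex.I_sq (hv 0) (hv 1) hgv
        (h2.resolve_left hg)) hy.ne_zero hy' hv
  exact ⟨η, ξ₀, u, h⟩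

theorem IsFrame.camL_add_apply {y : Fin 4 → ℂ} {ξ : Fin 3 → (Fin 4 → ℂ) →L[ℂ] ℂ}
    {ξ₀ : (Fin 4 → ℂ) →L[ℂ] ℂ} {u : (Fin 3 → ℂ) →L[ℂ] (Fin 4 → ℂ)} (h : IsFrame y ξ ξ₀ u)
    {a : Fin 3} {l : Fin n} {r : Fin 3} (ha : ξ a = rowForm B l r) (s : Fin 3 → ℂ) :
    camL B (y + u s) l r = s a := by
  rw [← rowForm_apply, ← ha, map_add, h.zero, h.map, zero_add]

theorem IsFrame.eventually_camL_ne_zero {y : Fin 4 → ℂ} (hy : ∀ l, camL B y l ≠ 0)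
    (u : (Fin 3 → ℂ) →L[ℂ] (Fin 4 → ℂ)) : ∀ᶠ s in 𝓝 0, ∀ l, camL B (y + u s) l ≠ 0 :=
  eventually_forall_apply_ne_zero (W := fun s => camL B (y + u s))
    (Continuous.continuousAt (by fun_prop)) (by simpa using hy)

theorem isLocParam_of_leftInverse {V W : Type} [NormedAddCommGroup V] [NormedSpace ℂ V]
    [NormedAddCommGroup W] [NormedSpace ℂ W] (φ : W →L[ℂ] V) (π : V →L[ℂ] W)
    (h : Function.LeftInverse π φ) : IsLocParam φ (Set.range φ) 0 where
  smooth := φ.contDiff.contDiffAt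
  zero := map_zero φ
  inj := by
    rw [φ.fderiv]
    exact h.injective
  nhds := by
    rw [(h.isEmbedding π.continuous φ.continuous).map_nhds_eq, map_zero]

/-- The inclusion of the third coordinate axis of `ℂ³`. -/
def axisL : (Fin 1 → ℂ) →L[ℂ] (Fin 3 → ℂ) :=
  ContinuousLinearMap.pi ![0, 0, ContinuousLinearMap.proj (R := ℂ) (φ := fun _ : Fin 1 => ℂ) 0]

theorem isLocParam_axisL : IsLocParam axisL {s | s 0 = 0 ∧ s 1 = 0} 0 := by
  have hr : Set.range axisL = {s | s 0 = 0 ∧ s 1 = 0} := by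
    ext s
    constructor
    · rintro ⟨t, rfl⟩
      exact ⟨rfl, rfl⟩
    · rintro ⟨h0, h1⟩
      refine ⟨fun _ => s 2, funext fun a => ?_⟩
      fin_cases a
      exacts [h0.symm, h1.symm, rfl]
  rw [← hr]
  refine isLocParam_of_leftInverse axisL (ContinuousLinearMap.pi fun _ =>
    ContinuousLinearMap.proj (R := ℂ) (φ := fun _ : Fin 3 => ℂ) 2) fun t => funext fun a => ?_
  rw [Subsingleton.elim a 0]
  rfl

theorem Config.exists_isLocParam_edge (h : Config A B C β) {k l : Fin n} (hkl : k ≠ l)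
    (hx : stdChart j x₀ ∈ Dinf A C k ∩ Dinf A C l) :
    ∃ χ : (Fin 1 → ℂ) → Fin n → Fin 2 → ℂ,
      IsLocParam χ (stdChart j ⁻¹' (Dinf A C k ∩ Dinf A C l)) x₀ := by
  obtain ⟨y, hy, hyc, hP⟩ := h.exists_cross hkl hx.1 hx.2
  obtain ⟨η, ξ₀, u, hfr⟩ := hy.exists_edgeFrame h.pos
  obtain ⟨ψ, hψ, hev⟩ := hfr.exists_isLocParam h.pos h.det h.mul
    (by have := h.three_le; omega) hyc hP
  have hS : 𝓝[{s | s 0 = 0 ∧ s 1 = 0}] (0 : Fin 3 → ℂ) =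
      𝓝[ψ ⁻¹' (stdChart j ⁻¹' (Dinf A C k ∩ Dinf A C l))] 0 := by
    refine nhdsWithin_eq_iff_eventuallyEq.2 ?_
    filter_upwards [hev, IsFrame.eventually_camL_ne_zero hyc u] with s h1 h2
    refine propext ?_
    change s 0 = 0 ∧ s 1 = 0 ↔ stdChart j (ψ s) ∈ Dinf A C k ∩ Dinf A C l
    rw [h1, Set.mem_inter_iff, h.pt_camL_mem_Dinf_iff h2, h.pt_camL_mem_Dinf_iff h2,
      hfr.camL_add_apply (a := 0) rfl, hfr.camL_add_apply (a := 1) rfl]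
  have := hψ.comp (isLocParam_axisL.congr hS)
  rw [Set.inter_eq_self_of_subset_right (Set.preimage_mono fun P hP => hP.1.1)] at this
  exact ⟨_, this⟩

/-- The points removed from `D_{∞,i} ∩ D_{∞,j}` to obtain the open stratum. -/
def edgeBad (A : Fin n → Matrix (Fin 3) (Fin 4) ℂ) (C : Fin n → Matrix (Fin 3) (Fin 3) ℂ)
    (β : Fin (2 * n + 1) → ℂ) (i j : Fin n) : Set (Fin n → P2) :=
  (⋃ (k : Fin n), ⋃ (_ : k ≠ i ∧ k ≠ j), Dinf A C k) ∪
    {P : Fin n → P2 | QuadCondAt C β i (P i) ∨ QuadCondAt C β j (P j)}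

theorem isClosed_edgeBad (hC : ∀ l, IsUnit (C l).det) (i j : Fin n) :
    IsClosed (edgeBad A C β i j) :=
  (isClosed_iUnion_Dinf_of_ne hC i j).union (isClosed_quadCond hC i j)

theorem preimage_strat0 (j : Fin n → Fin 3) (k l : Fin n) : stdChart j ⁻¹' strat0 A C β k l =
    stdChart j ⁻¹' (Dinf A C k ∩ Dinf A C l) ∩ stdChart j ⁻¹' (edgeBad A C β k l)ᶜ := by
  rw [strat0_eq_sdiff]
  rfl

theorem isOpen_preimage_edgeBad_compl (hC : ∀ l, IsUnit (C l).det) (j : Fin n → Fin 3)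
    (k l : Fin n) : IsOpen (stdChart j ⁻¹' (edgeBad A C β k l)ᶜ) :=
  (isClosed_edgeBad hC k l).isOpen_compl.preimage (continuous_stdChart j)

theorem Config.isSmoothPtP_strat0 (h : Config A B C β) {k l : Fin n} (hkl : k ≠ l)
    {P : Fin n → P2} (hP : P ∈ strat0 A C β k l) : IsSmoothPtP (strat0 A C β k l) P 1 := by
  obtain ⟨j, x, rfl⟩ := exists_stdChart_eq P
  obtain ⟨χ, hχ⟩ := h.exists_isLocParam_edge hkl hP.1.1
  have hP' : x ∈ stdChart j ⁻¹' strat0 A C β k l := hP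
  refine ⟨j, x, rfl, (hχ.congr ?_).isSmoothGermAt⟩
  rw [preimage_strat0] at hP' ⊢
  exact (nhdsWithin_inter_of_mem' (mem_nhdsWithin_of_mem_nhds
    ((isOpen_preimage_edgeBad_compl h.det j k l).mem_nhds hP'.2))).symm

theorem whitneyB_of_notMem {E : Type} [NormedAddCommGroup E] [NormedSpace ℂ E] {T R Z : Set E}
    {p : E} (hZ : IsClosed Z) (hT : T ⊆ Z) (hp : p ∉ Z) : WhitneyB T R p := by
  intro x y c v hx _ hxp _ _
  exact absurd (hZ.mem_of_tendsto hxp (hx.mono fun k hk => hT hk)) hp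

theorem Config.exists_index (h : Config A B C β) {S : Set (Fin n → P2)}
    (hS : IsStratumOf A C β S) :
    S = stratSm A C β ∨ ∃ I : Fin n → Prop, ∀ P ∈ S, ∀ m, P ∈ Dinf A C m ↔ I m := by
  rcases hS with rfl | ⟨i, j, hij, rfl⟩ | ⟨i, j, hij, rfl⟩ | ⟨i, j, k, hij, hik, hjk, rfl⟩
  · exact Or.inl rfl
  · rw [strat0_eq i j hij]
    exact Or.inr ⟨_, fun P hP => hP.1⟩
  · rw [strat1_eq i j hij]
    exact Or.inr ⟨_, fun P hP => hP.1⟩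
  · rw [h.strat3_eq hij hik hjk]
    exact Or.inr ⟨_, fun P hP => hP⟩

theorem Config.whitneyCondAB_strat0 (h : Config A B C β) {R : Set (Fin n → P2)}
    (hR : IsStratumOf A C β R) {k l : Fin n} (hkl : k ≠ l) :
    WhitneyCondAB R (strat0 A C β k l) := by
  refine whitneyCondAB_of_whitneyB fun j p hp => ?_
  rw [preimage_strat0]
  by_cases hpD : stdChart j p ∈ Dinf A C k ∩ Dinf A C l
  · have hRD : R ⊆ Dinf A C k ∩ Dinf A C l := by
      rcases h.exists_index hR with rfl | ⟨I, hI⟩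
      · exact absurd hpD.2 ((mem_stratSm_iff.1 hp).2 k l hkl hpD.1)
      · exact fun P hP => ⟨(hI P hP k).2 ((hI _ hp k).1 hpD.1), (hI P hP l).2 ((hI _ hp l).1 hpD.2)⟩
    obtain ⟨χ, hχ⟩ := h.exists_isLocParam_edge hkl hpD
    exact hχ.whitneyB_of_isOpen (isOpen_preimage_edgeBad_compl h.det j k l)
      (Set.preimage_mono hRD)
  · exact whitneyB_of_notMem (((isClosed_Dinf h.det k).inter (isClosed_Dinf h.det l)).preimage
      (continuous_stdChart j)) Set.inter_subset_left hpD

theorem Config.whitneyCondAB_of_finite (h : Config A B C β) {R T : Set (Fin n → P2)}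
    (hR : IsStratumOf A C β R) (hT : IsStratumOf A C β T) (hf : T.Finite) :
    WhitneyCondAB R T :=
  whitneyCondAB_of_whitneyB fun j _ hp => whitneyB_of_finite
    (hf.preimage (stdChart_injective j).injOn) fun hpT =>
      Set.preimage_mono (h.eq_of_mem_of_mem hR hT hp hpT).subset

end EdgeStrata

section Estimates

variable {n : ℕ} {A B : Fin n → Matrix (Fin 3) (Fin 4) ℂ} {C : Fin n → Matrix (Fin 3) (Fin 3) ℂ}
  {β : Fin (2 * n + 1) → ℂ} {b : Fin n → Fin 2 → ℂ} {β₀ : ℂ} {jc : Fin n → Fin 3}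
  {x₀ : Fin n → Fin 2 → ℂ} {y : Fin 4 → ℂ} {ξ : Fin 3 → (Fin 4 → ℂ) →L[ℂ] ℂ}
  {ξ₀ : (Fin 4 → ℂ) →L[ℂ] ℂ} {u : (Fin 3 → ℂ) →L[ℂ] (Fin 4 → ℂ)}

theorem gS_erase {S : Finset (Fin n)} {i : Fin n} (hi : i ∈ S) (w : Fin n → Fin 3 → ℂ) :
    gS b β₀ S w = nq (b i) (w i) * ∏ m ∈ S.erase i, w m 0 ^ 2 +
      w i 0 ^ 2 * gS b β₀ (S.erase i) w := by
  rw [← gS_insert (Finset.notMem_erase i S), Finset.insert_erase hi]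

theorem contDiff_camL_apply (y : Fin 4 → ℂ) (u : (Fin 3 → ℂ) →L[ℂ] (Fin 4 → ℂ)) (l : Fin n)
    (r : Fin 3) : ContDiff ℂ 1 fun s => camL B (y + u s) l r :=
  (rowForm B l r).contDiff.comp (contDiff_const.add u.contDiff)

theorem contDiff_prod_camL (y : Fin 4 → ℂ) (u : (Fin 3 → ℂ) →L[ℂ] (Fin 4 → ℂ))
    (S : Finset (Fin n)) : ContDiff ℂ 1 fun s => ∏ m ∈ S, camL B (y + u s) m 0 ^ 2 :=
  contDiff_prod fun m _ => (contDiff_camL_apply y u m 0).pow 2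

theorem contDiff_nq_camL (c : Fin 2 → ℂ) (y : Fin 4 → ℂ) (u : (Fin 3 → ℂ) →L[ℂ] (Fin 4 → ℂ))
    (l : Fin n) : ContDiff ℂ 1 fun s => nq c (camL B (y + u s) l) :=
  (((contDiff_camL_apply y u l 1).sub (contDiff_const.mul (contDiff_camL_apply y u l 0))).pow
    2).add (((contDiff_camL_apply y u l 2).sub
      (contDiff_const.mul (contDiff_camL_apply y u l 0))).pow 2)

theorem contDiff_gS_camL (y : Fin 4 → ℂ) (u : (Fin 3 → ℂ) →L[ℂ] (Fin 4 → ℂ))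
    (S : Finset (Fin n)) : ContDiff ℂ 1 fun s => gS b β₀ S (camL B (y + u s)) :=
  (contDiff_gS b β₀ S).comp ((camL B).contDiff.comp (contDiff_const.add u.contDiff))

/-- Whitney's condition (b) for the smooth locus over a set `R`, reduced to an estimate for the
differential of the equation of the hypersurface in a chart. -/
theorem Config.whitneyB_stratSm (h : Config A B C β) (hfr : IsFrame y ξ ξ₀ u)
    (hyc : ∀ l, camL B y l ≠ 0) (hx : stdChart jc x₀ = pt C (camL B y)) {R : Set (Fin n → P2)}
    (hR : R ⊆ mvVariety A) {K : (Fin 3 → ℂ) → Prop}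
    (hK : ∀ᶠ t in 𝓝 0, pt C (camL B (y + u t)) ∈ R → K t) {f : (Fin 3 → ℂ) → ℂ}
    (hf : ∀ s, gS (bOf β) (β 0) Finset.univ (camL B (y + u s)) = f s)
    (hest : ∀ ε > 0, ∀ᶠ s in 𝓝 0, f s = 0 → fderiv ℂ f s ≠ 0 → ∀ t, K t → ∃ a, ‖a‖ ≤ 1 ∧
      fderiv ℂ f s a ≠ 0 ∧ ‖fderiv ℂ f s (s - t)‖ ≤ ε * ‖fderiv ℂ f s a‖ * ‖s - t‖) :
    WhitneyB (stdChart jc ⁻¹' stratSm A C β) (stdChart jc ⁻¹' R) x₀ := by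
  have hn : 2 ≤ n := by have := h.three_le; omega
  obtain rfl : (fun s => quadF B (bOf β) (β 0) (y + u s)) = f := funext hf
  obtain ⟨ψ, hψ, hev⟩ := hfr.exists_isLocParam h.pos h.det h.mul hn hyc hx
  have hWc : Continuous fun s => camL B (y + u s) := by fun_prop
  have hiff := h.eventually_mem_stratSm_iff hψ (W := fun s => camL B (y + u s))
    hWc.continuousAt (by simpa using hyc) hev
  have hne := IsFrame.eventually_camL_ne_zero hyc u
  have hd : ∀ᶠ s in 𝓝 0, ψ s ∈ stdChart jc ⁻¹' stratSm A C β →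
      quadF B (bOf β) (β 0) (y + u s) = 0 ∧
        fderiv ℂ (fun s => quadF B (bOf β) (β 0) (y + u s)) s ≠ 0 := by
    filter_upwards [hiff, hne] with s h1 h2 hs
    obtain ⟨h3, h4⟩ := h1.1 hs
    exact ⟨h3, hfr.fderiv_quadF_ne_zero h3 (h.quadric.fderiv_quadF_ne_zero h.pos hn h2 h4 h3)⟩
  refine hψ.whitneyB (Set.preimage_mono fun P hP => hP.1.1) (Set.preimage_mono hR)
    (whitneyB_of_hypersurface (f := fun s => quadF B (bOf β) (β 0) (y + u s)) ?_ ?_)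
  · filter_upwards [hiff.eventually_nhds, hd] with s h1 h2 hs ν hν
    obtain ⟨h3, h4⟩ := h2 hs
    have hcr := (h1.self_of_nhds.1 hs).2
    refine mem_tanSp_of_fderiv_eq_zero (contDiff_gS_camL y u Finset.univ).contDiffAt h3 h4 hs
      ?_ hν
    rw [mem_nhdsWithin_iff_eventually]
    filter_upwards [h1, eventually_not_cross hWc hcr] with s' h5 h6 hs'
    exact h5.2 ⟨hs', h6⟩
  · intro ε hε
    filter_upwards [((hest ε hε).and hd).prod_nhds (hK.and hev)] with q hq hq1 hq2
    obtain ⟨⟨he, hd'⟩, hK', hev'⟩ := hq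
    obtain ⟨h3, h4⟩ := hd' hq1
    refine he h3 h4 _ (hK' ?_)
    rw [← hev']
    exact hq2

theorem Config.whitneyB_strat0 (h : Config A B C β) {i j : Fin n} (hij : i ≠ j)
    (hx : stdChart jc x₀ ∈ strat0 A C β i j) :
    WhitneyB (stdChart jc ⁻¹' stratSm A C β) (stdChart jc ⁻¹' strat0 A C β i j) x₀ := by
  obtain ⟨y, hy, hyc, hP⟩ := h.exists_cross hij hx.1.1.1 hx.1.1.2
  rw [hP, strat0_eq i j hij] at hx
  obtain ⟨η, ξ₀, u, hfr⟩ := hy.exists_edgeFrame h.pos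
  have h0 := hfr.camL_add_apply (a := 0) (l := i) (r := 0) rfl
  have h1 := hfr.camL_add_apply (a := 1) (l := j) (r := 0) rfl
  have hq : ∀ m, m = i ∨ m = j → nq (bOf β m) (camL B y m) ≠ 0 := fun m hm h0 =>
    hx.2 ⟨m, hm, (quadCondAt_pt_iff h.det β hyc m).2 h0⟩
  have hprod : ∏ m ∈ (Finset.univ.erase i).erase j, camL B y m 0 ^ 2 ≠ 0 :=
    Finset.prod_ne_zero_iff.2 fun m hm => pow_ne_zero 2 fun h0 => by
      rcases (hx.1 m).1 ((h.pt_camL_mem_Dinf_iff hyc m).2 h0) with rfl | rfl <;> simp at hm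
  have hj : j ∈ Finset.univ.erase i := by simp [hij.symm]
  refine h.whitneyB_stratSm hfr hyc hP (fun P hP => hP.1.1.1.1) (K := fun t => t 0 = 0 ∧ t 1 = 0)
    ?_ (f := fun s => (nq (bOf β i) (camL B (y + u s) i) *
        ∏ m ∈ (Finset.univ.erase i).erase j, camL B (y + u s) m 0 ^ 2) * s 1 ^ 2 +
        gS (bOf β) (β 0) (Finset.univ.erase i) (camL B (y + u s)) * s 0 ^ 2) (fun s => ?_) ?_
  · filter_upwards [IsFrame.eventually_camL_ne_zero hyc u] with t ht hR
    rw [← h0 t, ← h1 t]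
    exact ⟨((pt_mem_Dinf_iff h.det ht i).1 hR.1.1.1).2, ((pt_mem_Dinf_iff h.det ht j).1 hR.1.1.2).2⟩
  · rw [gS_univ_eq i, ← Finset.mul_prod_erase _ _ hj, h0, h1]
    ring
  · intro ε hε
    refine (estimate_double ((contDiff_nq_camL (bOf β i) y u i).mul
      (contDiff_prod_camL y u ((Finset.univ.erase i).erase j)))
      (contDiff_gS_camL y u (Finset.univ.erase i)) ?_ ?_ rfl hε).mono
      fun s hs hs0 hsd t ht => hs hs0 hsd t ht.1 ht.2
    · rw [map_zero, add_zero]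
      exact mul_ne_zero (hq i (Or.inl rfl)) hprod
    · rw [map_zero, add_zero, gS_erase hj, hy.right, zero_pow two_ne_zero, zero_mul, add_zero]
      exact mul_ne_zero (hq j (Or.inr rfl)) hprod

theorem Config.whitneyB_strat3 (h : Config A B C β) {i j k : Fin n} (hij : i ≠ j) (hik : i ≠ k)
    (hjk : j ≠ k) (hx : stdChart jc x₀ ∈ strat3 A C i j k) :
    WhitneyB (stdChart jc ⁻¹' stratSm A C β) (stdChart jc ⁻¹' strat3 A C i j k) x₀ := by
  obtain ⟨y, hy, hyc, hP⟩ := h.exists_cross hij hx.1.1 hx.1.2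
  rw [hP] at hx
  have hyk : camL B y k 0 = 0 := (h.pt_camL_mem_Dinf_iff hyc k).1 hx.2
  have hker : ∀ a, (![rowForm B i 0, rowForm B j 0, rowForm B k 0] :
      Fin 3 → (Fin 4 → ℂ) →L[ℂ] ℂ) a y = 0 := by
    intro a
    fin_cases a
    exacts [hy.left, hy.right, hyk]
  obtain ⟨ξ₀, u, hfr⟩ := exists_isFrame hy.ne_zero _ hker fun v hv =>
    exists_eq_smul_of_forms (g := isoForm B i Complex.I) (fun v hv hg =>
      h.pos.eq_zero_of_triple hij hik hjk Complex.I_sq (hv 0) (hv 1) (hv 2) hg) hy.ne_zero hker hv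
  have h0 := hfr.camL_add_apply (a := 0) (l := i) (r := 0) rfl
  have h1 := hfr.camL_add_apply (a := 1) (l := j) (r := 0) rfl
  have h2 := hfr.camL_add_apply (a := 2) (l := k) (r := 0) rfl
  have hI : (-Complex.I) ^ 2 = -1 := by rw [neg_sq, Complex.I_sq]
  have hqi : nq (bOf β i) (camL B y i) ≠ 0 := by
    rw [nq_eq_isoForm_mul _ hy.left Complex.I_sq]
    exact mul_ne_zero
      (fun h0 => hy.ne_zero (h.pos.eq_zero_of_triple hij hik hjk Complex.I_sq hy.left hy.right
        hyk h0))
      (fun h0 => hy.ne_zero (h.pos.eq_zero_of_triple hij hik hjk hI hy.left hy.right hyk h0))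
  have hqj : nq (bOf β j) (camL B y j) ≠ 0 := by
    rw [nq_eq_isoForm_mul _ hy.right Complex.I_sq]
    exact mul_ne_zero
      (fun h0 => hy.ne_zero (h.pos.eq_zero_of_triple hij.symm hjk hik Complex.I_sq hy.right
        hy.left hyk h0))
      (fun h0 => hy.ne_zero (h.pos.eq_zero_of_triple hij.symm hjk hik hI hy.right hy.left hyk h0))
  have hqk : nq (bOf β k) (camL B y k) ≠ 0 := by
    rw [nq_eq_isoForm_mul _ hyk Complex.I_sq]
    exact mul_ne_zero
      (fun h0 => hy.ne_zero (h.pos.eq_zero_of_triple hik.symm hjk.symm hij Complex.I_sq hyk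
        hy.left hy.right h0))
      (fun h0 => hy.ne_zero (h.pos.eq_zero_of_triple hik.symm hjk.symm hij hI hyk hy.left
        hy.right h0))
  have hj : j ∈ Finset.univ.erase i := by simp [hij.symm]
  have hk : k ∈ (Finset.univ.erase i).erase j := by simp [hik.symm, hjk.symm]
  have hprod : ∏ m ∈ ((Finset.univ.erase i).erase j).erase k, camL B y m 0 ^ 2 ≠ 0 :=
    Finset.prod_ne_zero_iff.2 fun m hm => pow_ne_zero 2 fun h0 => by
      rcases hy.eq_or_eq_or_eq h.pos hik hjk hyk h0 with rfl | rfl | rfl <;> simp at hm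
  refine h.whitneyB_stratSm hfr hyc hP (fun P hP => hP.1.1.1) (K := fun t => t = 0)
    ?_ (f := fun s => (nq (bOf β i) (camL B (y + u s) i) *
        ∏ m ∈ ((Finset.univ.erase i).erase j).erase k, camL B (y + u s) m 0 ^ 2) *
          (s 1 ^ 2 * s 2 ^ 2) + (nq (bOf β j) (camL B (y + u s) j) *
        ∏ m ∈ ((Finset.univ.erase i).erase j).erase k, camL B (y + u s) m 0 ^ 2) *
          (s 0 ^ 2 * s 2 ^ 2) + gS (bOf β) (β 0) ((Finset.univ.erase i).erase j)
            (camL B (y + u s)) * (s 0 ^ 2 * s 1 ^ 2)) (fun s => ?_) ?_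
  · filter_upwards [IsFrame.eventually_camL_ne_zero hyc u] with t ht hR
    funext a
    fin_cases a
    · exact (h0 t).symm.trans ((pt_mem_Dinf_iff h.det ht i).1 hR.1.1).2
    · exact (h1 t).symm.trans ((pt_mem_Dinf_iff h.det ht j).1 hR.1.2).2
    · exact (h2 t).symm.trans ((pt_mem_Dinf_iff h.det ht k).1 hR.2).2
  · rw [gS_univ_eq i, ← Finset.mul_prod_erase _ _ hj, gS_erase hj, ← Finset.mul_prod_erase _ _ hk,
      h0, h1, h2]
    ring
  · intro ε hε
    refine (estimate_triple ((contDiff_nq_camL (bOf β i) y u i).mul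
      (contDiff_prod_camL y u (((Finset.univ.erase i).erase j).erase k)))
      ((contDiff_nq_camL (bOf β j) y u j).mul
      (contDiff_prod_camL y u (((Finset.univ.erase i).erase j).erase k)))
      (contDiff_gS_camL y u ((Finset.univ.erase i).erase j)) ?_ ?_ ?_ rfl hε).mono
      fun s hs hs0 hsd t ht => by simpa only [ht, sub_zero] using hs hs0 hsd
    · rw [map_zero, add_zero]
      exact mul_ne_zero hqi hprod
    · rw [map_zero, add_zero]
      exact mul_ne_zero hqj hprod
    · rw [map_zero, add_zero, gS_erase hk, hyk, zero_pow two_ne_zero, zero_mul, add_zero]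
      exact mul_ne_zero hqk hprod

end Estimates

section Pinch

variable {n : ℕ} {A B : Fin n → Matrix (Fin 3) (Fin 4) ℂ} {C : Fin n → Matrix (Fin 3) (Fin 3) ℂ}
  {β : Fin (2 * n + 1) → ℂ} {jc : Fin n → Fin 3} {x₀ : Fin n → Fin 2 → ℂ} {y : Fin 4 → ℂ}

/-- The linear factor of the quadratic form `nq b` with coefficient `ε`, where `ε ^ 2 = -1`. -/
def isoFormAt (B : Fin n → Matrix (Fin 3) (Fin 4) ℂ) (b : Fin 2 → ℂ) (i : Fin n) (ε : ℂ) :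
    (Fin 4 → ℂ) →L[ℂ] ℂ :=
  isoForm B i ε - (b 0 + ε * b 1) • rowForm B i 0

theorem isoFormAt_apply (b : Fin 2 → ℂ) (i : Fin n) (ε : ℂ) (v : Fin 4 → ℂ) :
    isoFormAt B b i ε v = isoForm B i ε v - (b 0 + ε * b 1) * camL B v i 0 := rfl

theorem isoFormAt_of_zero (b : Fin 2 → ℂ) {i : Fin n} (ε : ℂ) {v : Fin 4 → ℂ}
    (h : camL B v i 0 = 0) : isoFormAt B b i ε v = isoForm B i ε v := by
  rw [isoFormAt_apply, h, mul_zero, sub_zero]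

theorem nq_eq_isoFormAt_mul (b : Fin 2 → ℂ) (i : Fin n) {ε : ℂ} (hε : ε ^ 2 = -1)
    (v : Fin 4 → ℂ) :
    nq b (camL B v i) = isoFormAt B b i ε v * isoFormAt B b i (-ε) v := by
  rw [nq, isoFormAt_apply, isoFormAt_apply, isoForm_apply, isoForm_apply]
  linear_combination (camL B v i 2 - b 1 * camL B v i 0) ^ 2 * hε

theorem Config.whitneyB_strat1_of_isoForm (h : Config A B C β) {i j : Fin n} (hij : i ≠ j)
    (hy : Cross B i j y) (hyc : ∀ l, camL B y l ≠ 0) (hP : stdChart jc x₀ = pt C (camL B y))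
    (hx : pt C (camL B y) ∈ strat1 A C β i j) {ε : ℂ} (hε : ε ^ 2 = -1)
    (hq : isoForm B i ε y = 0) :
    WhitneyB (stdChart jc ⁻¹' stratSm A C β) (stdChart jc ⁻¹' strat1 A C β i j) x₀ := by
  rw [strat1_eq i j hij] at hx
  have hker : ∀ a, (![rowForm B i 0, rowForm B j 0, isoFormAt B (bOf β i) i ε] :
      Fin 3 → (Fin 4 → ℂ) →L[ℂ] ℂ) a y = 0 := by
    intro a
    fin_cases a
    exacts [hy.left, hy.right, (isoFormAt_of_zero _ _ hy.left).trans hq]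
  obtain ⟨ξ₀, u, hfr⟩ := exists_isFrame hy.ne_zero _ hker fun v hv =>
    exists_eq_smul_of_forms (g := isoForm B j Complex.I) (fun v hv hg =>
      h.pos.eq_zero_of_quad hij hε Complex.I_sq (hv 0) (hv 1)
        ((isoFormAt_of_zero _ _ (hv 0)).symm.trans (hv 2)) hg) hy.ne_zero hker hv
  have h0 := hfr.camL_add_apply (a := 0) (l := i) (r := 0) rfl
  have h1 := hfr.camL_add_apply (a := 1) (l := j) (r := 0) rfl
  have h2 : ∀ s, isoFormAt B (bOf β i) i ε (y + u s) = s 2 := fun s => by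
    rw [map_add]
    exact (congrArg₂ (· + ·) (hfr.zero 2) (hfr.map s 2)).trans (zero_add _)
  have hcont : ContDiff ℂ 1 fun s => isoFormAt B (bOf β i) i (-ε) (y + u s) :=
    (isoFormAt B (bOf β i) i (-ε)).contDiff.comp (contDiff_const.add u.contDiff)
  have hneg : isoFormAt B (bOf β i) i (-ε) (y + u 0) ≠ 0 := by
    rw [map_zero, add_zero, isoFormAt_of_zero _ _ hy.left]
    exact hy.isoForm_neg_ne_zero h.pos hε hq
  have hqj : nq (bOf β j) (camL B (y + u 0) j) ≠ 0 := by
    rw [map_zero, add_zero, nq_eq_isoForm_mul _ hy.right Complex.I_sq]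
    exact mul_ne_zero
      (fun h0 => hy.ne_zero (h.pos.eq_zero_of_quad hij hε Complex.I_sq hy.left hy.right hq h0))
      (fun h0 => hy.ne_zero (h.pos.eq_zero_of_quad hij hε (by rw [neg_sq, Complex.I_sq]) hy.left
        hy.right hq h0))
  have hj : j ∈ Finset.univ.erase i := by simp [hij.symm]
  have hprod : ∏ m ∈ (Finset.univ.erase i).erase j, camL B y m 0 ^ 2 ≠ 0 :=
    Finset.prod_ne_zero_iff.2 fun m hm => pow_ne_zero 2 fun h0 => by
      rcases (hx.1 m).1 ((h.pt_camL_mem_Dinf_iff hyc m).2 h0) with rfl | rfl <;> simp at hm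
  refine h.whitneyB_stratSm hfr hyc hP (fun P hP => hP.1.1.1.1) (K := fun t => t = 0)
    ?_ (f := fun s => (isoFormAt B (bOf β i) i (-ε) (y + u s) *
        ∏ m ∈ (Finset.univ.erase i).erase j, camL B (y + u s) m 0 ^ 2) * (s 1 ^ 2 * s 2) +
        gS (bOf β) (β 0) (Finset.univ.erase i) (camL B (y + u s)) * s 0 ^ 2) (fun s => ?_) ?_
  · filter_upwards [IsFrame.eventually_camL_ne_zero hyc u,
      hcont.continuous.continuousAt.eventually_ne hneg,
      (contDiff_nq_camL (bOf β j) y u j).continuous.continuousAt.eventually_ne hqj]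
      with t ht hn hj' hR
    have ht0 : t 0 = 0 := (h0 t).symm.trans ((pt_mem_Dinf_iff h.det ht i).1 hR.1.1.1).2
    have ht1 : t 1 = 0 := (h1 t).symm.trans ((pt_mem_Dinf_iff h.det ht j).1 hR.1.1.2).2
    have ht2 : t 2 = 0 := by
      have := (quadCondAt_pt_iff h.det β ht i).1
        (hR.2.resolve_right fun hj => hj' ((quadCondAt_pt_iff h.det β ht j).1 hj))
      rw [nq_eq_isoFormAt_mul _ i hε, h2] at this
      exact (mul_eq_zero.1 this).resolve_right hn
    funext a
    fin_cases a
    exacts [ht0, ht1, ht2]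
  · rw [gS_univ_eq i, ← Finset.mul_prod_erase _ _ hj, nq_eq_isoFormAt_mul _ i hε, h0, h1, h2]
    ring
  · intro δ hδ
    refine (estimate_pinch (hcont.mul
      (contDiff_prod_camL y u ((Finset.univ.erase i).erase j)))
      (contDiff_gS_camL y u (Finset.univ.erase i)) ?_ ?_ rfl hδ).mono
      fun s hs hs0 hsd t ht => by simpa only [ht, sub_zero] using hs hs0 hsd
    · refine mul_ne_zero hneg ?_
      rwa [map_zero, add_zero]
    · rw [map_zero, add_zero] at hqj ⊢
      rw [gS_erase hj, hy.right, zero_pow two_ne_zero, zero_mul, add_zero]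
      exact mul_ne_zero hqj hprod

theorem Config.whitneyB_strat1 (h : Config A B C β) {i j : Fin n} (hij : i ≠ j)
    (hx : stdChart jc x₀ ∈ strat1 A C β i j) :
    WhitneyB (stdChart jc ⁻¹' stratSm A C β) (stdChart jc ⁻¹' strat1 A C β i j) x₀ := by
  wlog hi : QuadCondAt C β i (stdChart jc x₀ i) generalizing i j
  · rw [strat1_comm] at hx ⊢
    exact this hij.symm hx (hx.2.resolve_right hi)
  obtain ⟨y, hy, hyc, hP⟩ := h.exists_cross hij hx.1.1.1 hx.1.1.2
  rw [hP] at hx hi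
  rcases (h.quadCondAt_iff hy Complex.I_sq).1 hi with hq | hq
  · exact h.whitneyB_strat1_of_isoForm hij hy hyc hP hx Complex.I_sq hq
  · exact h.whitneyB_strat1_of_isoForm hij hy hyc hP hx (by rw [neg_sq, Complex.I_sq]) hq

theorem Config.whitneyCondAB_stratSm (h : Config A B C β) {R : Set (Fin n → P2)}
    (hR : IsStratumOf A C β R) : WhitneyCondAB R (stratSm A C β) := by
  refine whitneyCondAB_of_whitneyB fun jc x₀ hx => ?_
  obtain rfl | ⟨i, j, hij, rfl⟩ | ⟨i, j, hij, rfl⟩ | ⟨i, j, k, hij, hik, hjk, rfl⟩ := hR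
  · obtain ⟨χ, hχ⟩ := h.exists_isLocParam_stratSm hx
    simpa only [Set.inter_univ] using hχ.whitneyB_of_isOpen isOpen_univ subset_rfl
  · exact h.whitneyB_strat0 hij hx
  · exact h.whitneyB_strat1 hij hx
  · exact h.whitneyB_strat3 hij hik hjk hx

theorem Config.whitneyCondAB (h : Config A B C β) {R T : Set (Fin n → P2)}
    (hR : IsStratumOf A C β R) (hT : IsStratumOf A C β T) : WhitneyCondAB R T := by
  have hT' := hT
  obtain rfl | ⟨i, j, hij, rfl⟩ | ⟨i, j, hij, rfl⟩ | ⟨i, j, k, hij, hik, hjk, rfl⟩ := hT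
  · exact h.whitneyCondAB_stratSm hR
  · exact h.whitneyCondAB_strat0 hR hij
  · refine h.whitneyCondAB_of_finite hR hT' (Set.finite_of_ncard_ne_zero ?_)
    rw [h.ncard_strat1 hij]
    norm_num
  · obtain ⟨P, hP⟩ := h.strat3_eq_singleton hij hik hjk
    exact h.whitneyCondAB_of_finite hR hT' (hP ▸ Set.finite_singleton P)

/-- A general choice of cameras, charts and `β` is a configuration in general position. -/
theorem generically_config (hn : 3 ≤ n) :
    Generically (K := ℂ) (σ := Fin n × Fin 3 × Fin 4) fun a =>
      Generically (K := ℂ) (σ := Fin n × Fin 3 × Fin 3) fun c =>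
        (∀ i, IsUnit (chartOf c i).det) →
        Generically (K := ℂ) (σ := Fin (2 * n + 1)) fun β =>
          Config (camOfC a) (fun i => (chartOf c i)⁻¹ * camOfC a i) (chartOf c) β := by
  refine (generically₂_genPos hn).mono fun a c hc hdet => ?_
  refine (generically_genQuadric (hc hdet) (by omega)).mono fun β hβ => ⟨hn, hdet, fun l => ?_,
    hc hdet, hβ⟩
  rw [Matrix.mul_nonsing_inv_cancel_left _ _ (hdet l)]

end Pinch

/-- **Proposition 4.7.** For `n ≥ 3` general cameras, general charts and general `β`,
the decomposition
`D_Q = S₀ ⊔ ⨆_{i<j} S⁰_{i,j} ⊔ ⨆_{i<j} S¹_{i,j} ⊔ ⨆_{i<j<k} S_{i,j,k}`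
is a Whitney stratification of `D_Q`: the strata are pairwise disjoint, locally closed
and smooth, they cover `D_Q` (with `S_{i,j,k}` a point and `S¹_{i,j}` a set of 4
points), and every pair of strata satisfies Whitney's conditions (a) and (b). -/
theorem whitney_stratification_DQ (n : ℕ) (hn : 3 ≤ n) :
    Generically (K := ℂ) (σ := Fin n × Fin 3 × Fin 4) fun a =>
      (∀ i, (camOfC a i).rank = 3) →
      Generically (K := ℂ) (σ := Fin n × Fin 3 × Fin 3) fun cpar =>
        (∀ i, IsUnit (chartOf cpar i).det) →
        Generically (K := ℂ) (σ := Fin (2 * n + 1)) fun β =>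
          let A := camOfC a
          let Cs := chartOf cpar
          (⋃ S ∈ {S | IsStratumOf A Cs β S}, S) = DQ A Cs β ∧
          (∀ S T : Set (Fin n → P2), IsStratumOf A Cs β S → IsStratumOf A Cs β T →
            S ≠ T → Disjoint S T) ∧
          (∀ S, IsStratumOf A Cs β S → IsLocClosed S) ∧
          (∀ p ∈ stratSm A Cs β, IsSmoothPtP (stratSm A Cs β) p 2) ∧
          (∀ i j : Fin n, i ≠ j →
            ∀ p ∈ strat0 A Cs β i j, IsSmoothPtP (strat0 A Cs β i j) p 1) ∧
          (∀ i j : Fin n, i ≠ j → (strat1 A Cs β i j).ncard = 4) ∧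
          (∀ i j k : Fin n, i ≠ j → i ≠ k → j ≠ k → (strat3 A Cs i j k).ncard = 1) ∧
          (∀ S T : Set (Fin n → P2), IsStratumOf A Cs β S → IsStratumOf A Cs β T →
            WhitneyCondAB S T) := by
  refine (generically_config hn).mono fun a ha _ => ha.mono fun c hc hdet => (hc hdet).mono
    fun β h => ?_
  refine ⟨h.iUnion_strata, fun S T hS hT hST => Set.disjoint_left.2 fun P hPS hPT =>
    hST (h.eq_of_mem_of_mem hS hT hPS hPT), fun S hS => h.isLocClosed hS,
    fun p hp => h.isSmoothPtP_stratSm hp, fun i j hij p hp => h.isSmoothPtP_strat0 hij hp,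
    fun i j hij => h.ncard_strat1 hij, fun i j k hij hik hjk => ?_,
    fun S T hS hT => h.whitneyCondAB hS hT⟩
  obtain ⟨P, hP⟩ := h.strat3_eq_singleton hij hik hjk
  rw [hP, Set.ncard_singleton]

end PaperED
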